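/- arXiv:1810.12639 — 5 statements merged into one kernel-verified Lean document; each statement's English description precedes it below -/
import Mathlib

section
/- Up to isotopism, there are exactly 31 triples of mutually orthogonal 4 × 7 Latin rectangles in which all three rectangles are Youden rectangles (necessarily with parameter 2). -/
/-- A `k × n` Latin rectangle: each row contains each symbol exactly once
(equivalently, each row is injective `Fin n → Fin n`), and the entries of
each column are pairwise distinct. -/
def IsLatinRectangle {k n : ℕ} (A : Fin k → Fin n → Fin n) : Prop :=
  (∀ i, Function.Injective (A i)) ∧ (∀ j, Function.Injective fun i => A i j)

/-- Two `k × n` rectangles are orthogonal if the pairs `(A i j, B i j)` over all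
cells are pairwise distinct. -/
def Orthogonal {k n : ℕ} (A B : Fin k → Fin n → Fin n) : Prop :=
  Function.Injective fun p : Fin k × Fin n => (A p.1 p.2, B p.1 p.2)

/-- The set of symbols occurring in column `c`. -/
def colSymbols {k n : ℕ} (A : Fin k → Fin n → Fin n) (c : Fin n) : Finset (Fin n) :=
  Finset.univ.image fun i => A i c

/-- A Youden rectangle with parameter `lam`: every pair of distinct columns has
exactly `lam` symbols in common. -/
def IsYouden {k n : ℕ} (A : Fin k → Fin n → Fin n) (lam : ℕ) : Prop :=
  ∀ c c' : Fin n, c ≠ c' → (colSymbols A c ∩ colSymbols A c').card = lam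

/-- A triple of mutually orthogonal `k × n` Latin rectangles, indexed by `Fin 3`. -/
def IsMOLRTriple {k n : ℕ} (M : Fin 3 → Fin k → Fin n → Fin n) : Prop :=
  (∀ s, IsLatinRectangle (M s)) ∧ ∀ s t, s ≠ t → Orthogonal (M s) (M t)

/-- Two triples are isotopic: one is obtained from the other by permuting the order
of the three rectangles, a common row permutation, a common column permutation, and
a separate symbol permutation in each rectangle. -/
def Isotopic {k n : ℕ} (M M' : Fin 3 → Fin k → Fin n → Fin n) : Prop :=
  ∃ (ρ : Equiv.Perm (Fin 3)) (σr : Equiv.Perm (Fin k)) (σc : Equiv.Perm (Fin n))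
    (f : Fin 3 → Equiv.Perm (Fin n)),
    ∀ s i j, M' s i j = f s (M (ρ s) (σr i) (σc j))

/-! ### Combinators that evaluate quickly in the kernel

They are written directly with recursors; `force` replaces a natural number expression
by its value before passing it on. -/

namespace YoudenTriple

/-- `force n k` is `k n`, with `n` evaluated first. -/
def force {β : Type} (n : ℕ) (k : ℕ → β) : β := Nat.rec (k 0) (fun m _ => k (Nat.succ m)) n

theorem force_eq {β : Type} (n : ℕ) (k : ℕ → β) : force n k = k n := by
  cases n <;> rfl

/-- `p m` for all `m < n`. -/
def allBelow (n : ℕ) (p : ℕ → Bool) : Bool := Nat.rec true (fun m ih => Bool.rec false ih (p m)) n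

theorem allBelow_iff {n : ℕ} {p : ℕ → Bool} : allBelow n p = true ↔ ∀ m < n, p m = true := by
  induction n with
  | zero => simp [allBelow]
  | succ n ih =>
    have : allBelow (n + 1) p = (p n && allBelow n p) := by
      simp only [allBelow]; cases p n <;> rfl
    rw [this, Bool.and_eq_true, ih]
    exact ⟨fun h m hm => (Nat.lt_succ_iff_lt_or_eq.1 hm).elim (h.2 m) (fun e => e ▸ h.1),
      fun h => ⟨h n (Nat.lt_succ_self n), fun m hm => h m (Nat.lt_succ_of_lt hm)⟩⟩

/-- `p x` for all `x ∈ l`. -/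
def allMem {α : Type} (l : List α) (p : α → Bool) : Bool :=
  List.rec true (fun x _ ih => Bool.rec false ih (p x)) l

theorem allMem_iff {α : Type} {l : List α} {p : α → Bool} :
    allMem l p = true ↔ ∀ x ∈ l, p x = true := by
  induction l with
  | nil => simp [allMem]
  | cons x l ih =>
    have : allMem (x :: l) p = (p x && allMem l p) := by
      simp only [allMem]; cases p x <;> rfl
    simp [this, ih]

/-- `p x` for some `x ∈ l`. -/
def anyMem {α : Type} (l : List α) (p : α → Bool) : Bool :=
  List.rec false (fun x _ ih => Bool.rec ih true (p x)) l

theorem anyMem_iff {α : Type} {l : List α} {p : α → Bool} :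
    anyMem l p = true ↔ ∃ x ∈ l, p x = true := by
  induction l with
  | nil => simp [anyMem]
  | cons x l ih =>
    have : anyMem (x :: l) p = (p x || anyMem l p) := by
      simp only [anyMem]; cases p x <;> rfl
    simp [this, ih]

/-- The entry of index `n` of `l`, or `0`. -/
def nth (l : List ℕ) : ℕ → ℕ :=
  List.rec (fun _ => 0) (fun x _ ih n => Nat.rec x (fun m _ => ih m) n) l

theorem nth_mem {l : List ℕ} {n : ℕ} (hn : n < l.length) : nth l n ∈ l := by
  induction l generalizing n with
  | nil => simp at hn
  | cons x l ih =>
    cases n with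
    | zero => exact List.mem_cons_self
    | succ n => exact List.mem_cons_of_mem x (ih (Nat.lt_of_succ_lt_succ hn))

/-- The natural number whose binary digits `1` are at the positions listed in `l`. -/
def mask (l : List ℕ) : ℕ := List.rec 0 (fun x _ ih => Nat.lor (Nat.pow 2 x) ih) l

theorem testBit_mask {l : List ℕ} {n : ℕ} : (mask l).testBit n = true ↔ n ∈ l := by
  induction l with
  | nil => simp [mask]
  | cons x l ih =>
    have : mask (x :: l) = 2 ^ x ||| mask l := rfl
    rw [this, Nat.testBit_or, Nat.testBit_two_pow]
    simp only [Bool.or_eq_true, decide_eq_true_eq, ih, List.mem_cons]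
    exact or_congr eq_comm Iff.rfl

theorem land_eq_zero {a b : ℕ} (h : ∀ n, a.testBit n = true → b.testBit n = true → False) :
    Nat.land a b = 0 := by
  apply Nat.eq_of_testBit_eq
  intro n
  have : (Nat.land a b).testBit n = (a.testBit n && b.testBit n) := Nat.testBit_and a b n
  rw [this, Nat.zero_testBit, Bool.and_eq_false_iff]
  specialize h n
  cases ha : a.testBit n <;> cases hb : b.testBit n <;> simp_all

/-- The values `f (n - 1), …, f 0` are pairwise distinct and are not positions of a binary
digit `1` of the initial accumulator. -/
def injBelow (n : ℕ) (f : ℕ → ℕ) : ℕ → Bool :=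
  Nat.rec (fun _ => true) (fun p ih m => force (Nat.pow 2 (f p)) fun b =>
    Nat.rec (force (Nat.lor m b) ih) (fun _ _ => false) (Nat.land m b)) n

theorem injBelow_iff_aux {n : ℕ} {f : ℕ → ℕ} : ∀ {m : ℕ}, injBelow n f m = true ↔
    (∀ p < n, m.testBit (f p) = false) ∧ ∀ p < n, ∀ q < n, f p = f q → p = q := by
  induction n with
  | zero => intro m; simp [injBelow]
  | succ n ih =>
    intro m
    have e : injBelow (n + 1) f m = (!(m.testBit (f n)) && injBelow n f (m ||| 2 ^ f n)) := by
      have h1 : injBelow (n + 1) f m = force (Nat.pow 2 (f n)) fun b =>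
        Nat.rec (force (Nat.lor m b) (injBelow n f)) (fun _ _ => false) (Nat.land m b) := rfl
      rw [h1, force_eq, force_eq]
      have h2 : Nat.land m (Nat.pow 2 (f n)) = (m.testBit (f n)).toNat * 2 ^ f n :=
        Nat.and_two_pow m (f n)
      rw [h2]
      cases m.testBit (f n) with
      | false => simp
      | true =>
        obtain ⟨k, hk⟩ := Nat.exists_eq_succ_of_ne_zero (pow_pos (show 0 < 2 by norm_num) (f n)).ne'
        simp [hk]
    rw [e, Bool.and_eq_true, ih]
    simp only [Nat.testBit_or, Nat.testBit_two_pow, Bool.or_eq_false_iff, decide_eq_false_iff_not,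
      Bool.not_eq_true']
    constructor
    · rintro ⟨h0, h1, h2⟩
      refine ⟨fun p hp => ?_, fun p hp q hq hpq => ?_⟩
      · rcases Nat.lt_succ_iff_lt_or_eq.1 hp with h | rfl
        exacts [(h1 p h).1, h0]
      · rcases Nat.lt_succ_iff_lt_or_eq.1 hp with h | rfl <;>
          rcases Nat.lt_succ_iff_lt_or_eq.1 hq with h' | rfl
        · exact h2 p h q h' hpq
        · exact absurd hpq.symm (h1 p h).2
        · exact absurd hpq (h1 q h').2
        · rfl
    · rintro ⟨h1, h2⟩
      refine ⟨h1 n (Nat.lt_succ_self n), fun p hp => ⟨h1 p (Nat.lt_succ_of_lt hp), fun h => ?_⟩,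
        fun p hp q hq => h2 p (Nat.lt_succ_of_lt hp) q (Nat.lt_succ_of_lt hq)⟩
      exact hp.ne' (h2 n (Nat.lt_succ_self n) p (Nat.lt_succ_of_lt hp) h)

theorem injBelow_iff {n : ℕ} {f : ℕ → ℕ} :
    injBelow n f 0 = true ↔ ∀ p < n, ∀ q < n, f p = f q → p = q := by
  simp [injBelow_iff_aux]

/-! ### Normalized rectangles as natural numbers -/

/-- Entry `(i, j)` of the rectangle with code `c`: row `0` is the identity, and the entries of the
other rows are the base `7` digits of `c`, column by column. -/
def cell (c i j : ℕ) : ℕ :=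
  Nat.rec j (fun i' _ => Nat.mod (Nat.div c (Nat.pow 7 (Nat.add (Nat.mul 3 j) i'))) 7) i

theorem cell_lt (c i : ℕ) {j : ℕ} (hj : j < 7) : cell c i j < 7 := by
  cases i with
  | zero => exact hj
  | succ i => exact Nat.mod_lt _ (by norm_num)

/-- The rectangle with code `c`. -/
def rect (c : ℕ) (i : Fin 4) (j : Fin 7) : Fin 7 := ⟨cell c i j, cell_lt c i j.2⟩

/-- Rows `1`, `2`, `3` of column `j`, as a number in base `7`. -/
def colCode (N : Fin 4 → Fin 7 → Fin 7) (j : Fin 7) : ℕ := N 1 j + 7 * N 2 j + 49 * N 3 j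

theorem colCode_lt (N : Fin 4 → Fin 7 → Fin 7) (j : Fin 7) : colCode N j < 343 := by
  unfold colCode; omega

/-- The code of a rectangle. -/
def encode (N : Fin 4 → Fin 7 → Fin 7) : ℕ := ∑ j : Fin 7, colCode N j * 343 ^ (j : ℕ)

theorem rect_encode {N : Fin 4 → Fin 7 → Fin 7} (h : ∀ j, N 0 j = j) : rect (encode N) = N := by
  have key : ∀ (v : Fin 7 → ℕ), (∀ j, v j < 343) → ∀ j : Fin 7,
      (∑ j : Fin 7, v j * 343 ^ (j : ℕ)) / 343 ^ (j : ℕ) % 343 = v j := by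
    intro v hv j
    have h0 := hv 0; have h1 := hv 1; have h2 := hv 2; have h3 := hv 3
    have h4 := hv 4; have h5 := hv 5; have h6 := hv 6
    simp only [Fin.sum_univ_seven]
    fin_cases j <;> simp <;> omega
  have key2 : ∀ j : Fin 7, encode N / 343 ^ (j : ℕ) % 343 = colCode N j :=
    key _ (colCode_lt N)
  funext i j
  apply Fin.ext
  have kj := key2 j
  have pw : ∀ i : ℕ, 7 ^ (3 * (j : ℕ) + i) = 343 ^ (j : ℕ) * 7 ^ i := by
    intro i; rw [pow_add, pow_mul]; norm_num
  have e1 := (N 1 j).2; have e2 := (N 2 j).2; have e3 := (N 3 j).2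
  unfold colCode at kj
  fin_cases i
  · exact (congrArg Fin.val (h j)).symm
  all_goals
    change _ / 7 ^ (3 * (j : ℕ) + _) % 7 = _
    rw [pw, ← Nat.div_div_eq_div_mul]
    simp only [pow_zero, pow_one, Nat.reducePow, Fin.reduceFinMk, Fin.mk_one]
    omega

/-! ### Column by column search -/

/-- A candidate for a column: its contribution to the code of the rectangle, the mask of its
features and the mask of the features it excludes in other columns. -/
structure Cand where
  val : ℕ
  own : ℕ
  con : ℕ

/-- Pass on the elements of `l` compatible with `con`, on top of an accumulator. -/
def filterK (con : ℕ) (l : List Cand) : List Cand → (List Cand → Bool) → Bool :=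
  List.rec (fun acc k => k acc)
    (fun x _ ih acc k => Nat.rec (ih (x :: acc) k) (fun _ _ => ih acc k) (Nat.land con x.own)) l

theorem filterK_sound {con : ℕ} {l : List Cand} {k : List Cand → Bool} :
    ∀ {acc : List Cand}, filterK con l acc k = true →
      ∃ l', (∀ x ∈ acc, x ∈ l') ∧ (∀ x ∈ l, Nat.land con x.own = 0 → x ∈ l') ∧ k l' = true := by
  induction l with
  | nil => exact fun {acc} h => ⟨acc, fun _ h => h, by simp, h⟩
  | cons x l ih =>
    intro acc h
    have e : filterK con (x :: l) acc k =
      Nat.rec (filterK con l (x :: acc) k) (fun _ _ => filterK con l acc k)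
        (Nat.land con x.own) := rfl
    rw [e] at h
    cases hx : Nat.land con x.own with
    | zero =>
      rw [hx] at h
      obtain ⟨l', h1, h2, h3⟩ := ih h
      refine ⟨l', fun y hy => h1 y (List.mem_cons_of_mem _ hy), fun y hy hy0 => ?_, h3⟩
      rcases List.mem_cons.1 hy with rfl | hy
      exacts [h1 _ List.mem_cons_self, h2 y hy hy0]
    | succ m =>
      rw [hx] at h
      obtain ⟨l', h1, h2, h3⟩ := ih h
      refine ⟨l', h1, fun y hy hy0 => ?_, h3⟩
      rcases List.mem_cons.1 hy with rfl | hy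
      exacts [absurd (hx.symm.trans hy0) (Nat.succ_ne_zero m), h2 y hy hy0]

/-- Filter all the lists in `L`, giving up as soon as one of them becomes empty. -/
def filterAllK (con : ℕ) (L : List (List Cand)) : (List (List Cand) → Bool) → Bool :=
  List.rec (fun k => k [])
    (fun l _ ih k => filterK con l [] fun l' =>
      List.rec true (fun x t _ => ih fun L' => k ((x :: t) :: L')) l') L

theorem filterAllK_sound {con : ℕ} {xs : List Cand} {L : List (List Cand)}
    (hL : List.Forall₂ (· ∈ ·) xs L) (hxs : ∀ x ∈ xs, Nat.land con x.own = 0) :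
    ∀ {k : List (List Cand) → Bool}, filterAllK con L k = true →
      ∃ L', List.Forall₂ (· ∈ ·) xs L' ∧ k L' = true := by
  induction hL with
  | nil => exact fun {k} h => ⟨[], .nil, h⟩
  | @cons x l xs L hx _ ih =>
    intro k h
    obtain ⟨l', -, h2, h3⟩ := filterK_sound h
    have hx' := h2 x hx (hxs x List.mem_cons_self)
    cases l' with
    | nil => simp at hx'
    | cons y t =>
      obtain ⟨L', h4, h5⟩ := ih (fun z hz => hxs z (List.mem_cons_of_mem _ hz)) h3
      exact ⟨(y :: t) :: L', .cons hx' h4, h5⟩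

/-- All ways to choose pairwise compatible candidates from `n` lists lead to a code satisfying
`P`. -/
def search (P : ℕ → Bool) (n : ℕ) : List (List Cand) → ℕ → Bool :=
  Nat.rec (fun _ acc => P acc)
    (fun _ ih L acc => List.rec true (fun l L' _ =>
      allMem l fun c => filterAllK c.con L' fun L'' => ih L'' (Nat.add acc c.val)) L) n

theorem search_sound {P : ℕ → Bool} {n : ℕ} : ∀ {xs : List Cand} {L : List (List Cand)} {acc : ℕ},
    xs.length = n → List.Forall₂ (· ∈ ·) xs L →
    xs.Pairwise (fun c x => Nat.land c.con x.own = 0) → search P n L acc = true →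
    P (acc + (xs.map Cand.val).sum) = true := by
  induction n with
  | zero =>
    intro xs L acc hn _ _ h
    rw [List.length_eq_zero_iff.1 hn]
    exact h
  | succ n ih =>
    intro xs L acc hn hL hp h
    cases hL with
    | nil => simp at hn
    | @cons x l xs L hx hL =>
      have h1 := allMem_iff.1 h x hx
      rw [List.pairwise_cons] at hp
      obtain ⟨L', h2, h3⟩ := filterAllK_sound hL hp.1 h1
      have h4 := ih (by simpa using hn) h2 hp.2 h3
      rw [List.map_cons, List.sum_cons, ← add_assoc]
      exact h4

/-- The mask of those `n < 128` with exactly two binary digits `1`. -/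
def twoBits : ℕ := 79229376568279087382969849448

/-- Whether the set with mask `s` has exactly two elements. -/
def hasTwo (s : ℕ) : ℕ := Nat.land (Nat.shiftRight twoBits s) 1

/-- The mask of those sets of symbols that do not meet the set with mask `s` in exactly two
symbols. -/
def badMask (s : ℕ) : ℕ :=
  Nat.rec 0 (fun n ih => Nat.rec (Nat.lor (Nat.pow 2 n) ih) (fun _ _ => ih)
    (hasTwo (Nat.land s n))) 128

/-- The candidate for column `j` with entries given by the digits of `v`, with features `idx`. -/
def mkCand (idx : ℕ → ℕ → ℕ → ℕ → List ℕ) (j v : ℕ) (k : Cand → Bool) : Bool :=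
  force (Nat.mod v 7) fun a => force (Nat.mod (Nat.div v 7) 7) fun b =>
  force (Nat.div v 49) fun d => force (mask (idx j a b d)) fun m => force (mask [j, a, b, d]) fun s =>
  force (Nat.mul v (Nat.pow 343 j)) fun v' =>
  force (Nat.lor m (Nat.pow 2 (Nat.add 70 s))) fun o =>
  force (Nat.lor m (Nat.shiftLeft (badMask s) 70)) fun c => k ⟨v', o, c⟩

/-- The features of the column with code `v` that are determined by `idx`. -/
def features (idx : ℕ → ℕ → ℕ → ℕ → List ℕ) (j v : ℕ) : List ℕ := idx j (v % 7) (v / 7 % 7) (v / 49)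

/-- The mask of the set of entries of the column with code `v`. -/
def colMask (j v : ℕ) : ℕ := mask [j, v % 7, v / 7 % 7, v / 49]

/-- The candidate passed on by `mkCand`. -/
def cand (idx : ℕ → ℕ → ℕ → ℕ → List ℕ) (j v : ℕ) : Cand :=
  ⟨v * 343 ^ j, mask (features idx j v) ||| 2 ^ (70 + colMask j v),
    mask (features idx j v) ||| badMask (colMask j v) <<< 70⟩

theorem mkCand_eq (idx : ℕ → ℕ → ℕ → ℕ → List ℕ) (j v : ℕ) (k : Cand → Bool) :
    mkCand idx j v k = k (cand idx j v) := by
  simp only [mkCand, force_eq]; rfl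

/-- The candidates for column `j` with code below `n`. -/
def candsK (ok : ℕ → ℕ → ℕ → ℕ → Bool) (idx : ℕ → ℕ → ℕ → ℕ → List ℕ) (j n : ℕ) :
    List Cand → (List Cand → Bool) → Bool :=
  Nat.rec (fun acc k => k acc) (fun v ih acc k => Bool.rec (ih acc k)
    (mkCand idx j v fun c => ih (c :: acc) k)
    (force (Nat.mod v 7) fun a => force (Nat.mod (Nat.div v 7) 7) fun b =>
      force (Nat.div v 49) fun d => ok j a b d)) n

theorem candsK_sound {ok : ℕ → ℕ → ℕ → ℕ → Bool} {idx : ℕ → ℕ → ℕ → ℕ → List ℕ} {j n : ℕ}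
    {k : List Cand → Bool} : ∀ {acc : List Cand}, candsK ok idx j n acc k = true →
    ∃ l, (∀ x ∈ acc, x ∈ l) ∧
      (∀ v < n, ok j (v % 7) (v / 7 % 7) (v / 49) = true → cand idx j v ∈ l) ∧ k l = true := by
  induction n with
  | zero => exact fun {acc} h => ⟨acc, fun _ h => h, by simp, h⟩
  | succ n ih =>
    intro acc h
    have e : candsK ok idx j (n + 1) acc k = Bool.rec (candsK ok idx j n acc k)
      (candsK ok idx j n (cand idx j n :: acc) k) (ok j (n % 7) (n / 7 % 7) (n / 49)) := by
      rw [← mkCand_eq idx j n fun c => candsK ok idx j n (c :: acc) k]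
      have : ok j (n % 7) (n / 7 % 7) (n / 49) = force (Nat.mod n 7) fun a =>
        force (Nat.mod (Nat.div n 7) 7) fun b => force (Nat.div n 49) fun d => ok j a b d := by
        simp only [force_eq]; rfl
      rw [this]; rfl
    rw [e] at h
    cases hn : ok j (n % 7) (n / 7 % 7) (n / 49) with
    | false =>
      rw [hn] at h
      obtain ⟨l, h1, h2, h3⟩ := ih h
      refine ⟨l, h1, fun v hv hok => ?_, h3⟩
      rcases Nat.lt_succ_iff_lt_or_eq.1 hv with hv | rfl
      · exact h2 v hv hok
      · simp [hn] at hok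
    | true =>
      rw [hn] at h
      obtain ⟨l, h1, h2, h3⟩ := ih h
      refine ⟨l, fun x hx => h1 x (List.mem_cons_of_mem _ hx), fun v hv hok => ?_, h3⟩
      rcases Nat.lt_succ_iff_lt_or_eq.1 hv with hv | rfl
      exacts [h2 v hv hok, h1 _ List.mem_cons_self]

/-- The lists of candidates for the columns `n - 1, …, 0`. -/
def allCandsK (ok : ℕ → ℕ → ℕ → ℕ → Bool) (idx : ℕ → ℕ → ℕ → ℕ → List ℕ) (n : ℕ) :
    (List (List Cand) → Bool) → Bool :=
  Nat.rec (fun k => k [])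
    (fun j ih k => candsK ok idx j 343 [] fun l => ih fun L => k (l :: L)) n

theorem allCandsK_sound {ok : ℕ → ℕ → ℕ → ℕ → Bool} {idx : ℕ → ℕ → ℕ → ℕ → List ℕ} {n : ℕ}
    {v : ℕ → ℕ}
    (hv : ∀ j < n, v j < 343 ∧ ok j (v j % 7) (v j / 7 % 7) (v j / 49) = true) :
    ∀ {k : List (List Cand) → Bool}, allCandsK ok idx n k = true →
      ∃ L, List.Forall₂ (· ∈ ·) ((List.range n).reverse.map fun j => cand idx j (v j)) L ∧
        k L = true := by
  induction n with
  | zero => exact fun {k} h => ⟨[], .nil, h⟩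
  | succ n ih =>
    intro k h
    obtain ⟨l, -, h2, h3⟩ := candsK_sound (show candsK ok idx n 343 [] (fun l =>
      allCandsK ok idx n fun L => k (l :: L)) = true from h)
    obtain ⟨L, h4, h5⟩ := ih (fun j hj => hv j (Nat.lt_succ_of_lt hj)) h3
    have hn := hv n (Nat.lt_succ_self n)
    refine ⟨l :: L, ?_, h5⟩
    rw [List.range_succ, List.reverse_append, List.reverse_singleton, List.singleton_append,
      List.map_cons]
    exact .cons (h2 _ hn.1 hn.2) h4

/-- Search through all normalized rectangles whose columns are allowed by `ok`, with the features
of different columns being disjoint. -/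
def searchAll (ok : ℕ → ℕ → ℕ → ℕ → Bool) (idx : ℕ → ℕ → ℕ → ℕ → List ℕ) (P : ℕ → Bool) : Bool :=
  allCandsK ok idx 7 fun L => search P 7 L 0

/-- The set with mask `n`. -/
def bits (n : ℕ) : Finset (Fin 7) := Finset.univ.filter fun i => n.testBit i = true

theorem hasTwo_iff {n : ℕ} (hn : n < 128) : hasTwo n = 1 ↔ (bits n).card = 2 := by
  have : ∀ n : Fin 128, hasTwo n = 1 ↔ (bits n).card = 2 := by decide +kernel
  exact this ⟨n, hn⟩

theorem bits_land (m n : ℕ) : bits (Nat.land m n) = bits m ∩ bits n := by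
  ext i
  simp [bits]

theorem mask_lt {l : List ℕ} (h : ∀ x ∈ l, x < 7) : mask l < 128 := by
  refine Nat.lt_of_testBit 7 ?_ (by decide) fun j hj => ?_
  · by_contra h'
    exact absurd (h 7 (testBit_mask.1 (by simpa using h'))) (by norm_num)
  · have h1 : (mask l).testBit j = false := by
      by_contra h'
      exact absurd (h j (testBit_mask.1 (by simpa using h'))) (by omega)
    rw [h1]
    exact (Nat.testBit_two_pow_of_ne (n := 7) (m := j) (by omega)).symm

theorem testBit_badMask {s n : ℕ} (h : hasTwo (Nat.land s n) = 1) :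
    (badMask s).testBit n = false := by
  have : ∀ N, (Nat.rec 0 (fun n ih => Nat.rec (Nat.lor (Nat.pow 2 n) ih) (fun _ _ => ih)
    (hasTwo (Nat.land s n))) N : ℕ).testBit n = false := by
    intro N
    induction N with
    | zero => simp
    | succ N ih =>
      dsimp only
      cases hN : hasTwo (Nat.land s N) with
      | zero =>
        have e : ∀ x, (Nat.lor (Nat.pow 2 N) x).testBit n = (decide (N = n) || x.testBit n) := by
          intro x
          rw [← Nat.testBit_two_pow]
          exact Nat.testBit_or _ _ _
        refine (e _).trans ?_
        rw [ih]
        have : N ≠ n := by rintro rfl; omega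
        simp [this]
      | succ m => exact ih
  exact this 128

theorem cand_compatible {idx : ℕ → ℕ → ℕ → ℕ → List ℕ} {j v j' v' : ℕ}
    (hlt : ∀ x ∈ features idx j v, x < 70) (hlt' : ∀ x ∈ features idx j' v', x < 70)
    (hd : ∀ x ∈ features idx j v, x ∉ features idx j' v')
    (hy : hasTwo (Nat.land (colMask j v) (colMask j' v')) = 1) :
    Nat.land (cand idx j v).con (cand idx j' v').own = 0 := by
  refine land_eq_zero fun n h1 h2 => ?_
  simp only [cand, Nat.testBit_or, Nat.testBit_shiftLeft, Nat.testBit_two_pow, Bool.or_eq_true,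
    testBit_mask, Bool.and_eq_true, decide_eq_true_eq] at h1 h2
  rcases h1 with h1 | ⟨h1, h1'⟩ <;> rcases h2 with h2 | h2
  · exact hd n h1 h2
  · have := hlt n h1; omega
  · have := hlt' n h2; omega
  · subst h2
    rw [Nat.add_sub_cancel_left, testBit_badMask hy] at h1'
    exact absurd h1' (by simp)

theorem colCode_digits (N : Fin 4 → Fin 7 → Fin 7) (j : Fin 7) :
    colCode N j % 7 = N 1 j ∧ colCode N j / 7 % 7 = N 2 j ∧ colCode N j / 49 = N 3 j := by
  unfold colCode; omega

theorem bits_colMask {N : Fin 4 → Fin 7 → Fin 7} (h : ∀ j, N 0 j = j) (j : Fin 7) :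
    bits (colMask j (colCode N j)) = colSymbols N j := by
  obtain ⟨h1, h2, h3⟩ := colCode_digits N j
  ext x
  have h0 := h j
  simp only [bits, colMask, h1, h2, h3, Finset.mem_filter, Finset.mem_univ, true_and,
    testBit_mask, List.mem_cons, List.not_mem_nil, or_false, Fin.val_inj, colSymbols,
    Finset.mem_image]
  constructor
  · rintro (rfl | rfl | rfl | rfl)
    exacts [⟨0, h0⟩, ⟨1, rfl⟩, ⟨2, rfl⟩, ⟨3, rfl⟩]
  · rintro ⟨i, rfl⟩
    fin_cases i <;> simp [h0]

theorem colMask_lt (N : Fin 4 → Fin 7 → Fin 7) (j : Fin 7) : colMask j (colCode N j) < 128 := by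
  obtain ⟨h1, h2, h3⟩ := colCode_digits N j
  refine mask_lt fun x hx => ?_
  simp only [h1, h2, h3, List.mem_cons, List.not_mem_nil, or_false] at hx
  omega

theorem sum_map_reverse_range (f : ℕ → ℕ) (n : ℕ) :
    ((List.range n).reverse.map f).sum = ∑ j ∈ Finset.range n, f j := by
  induction n with
  | zero => rfl
  | succ n ih =>
    rw [List.range_succ, List.reverse_append, List.reverse_singleton, List.singleton_append,
      List.map_cons, List.sum_cons, ih, Finset.sum_range_succ, add_comm]

theorem searchAll_sound {ok : ℕ → ℕ → ℕ → ℕ → Bool} {idx : ℕ → ℕ → ℕ → ℕ → List ℕ} {P : ℕ → Bool}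
    (h : searchAll ok idx P = true) {N : Fin 4 → Fin 7 → Fin 7} (hN : ∀ j, N 0 j = j)
    (hY : IsYouden N 2) (hok : ∀ j : Fin 7, ok j (N 1 j) (N 2 j) (N 3 j) = true)
    (hlt : ∀ j : Fin 7, ∀ x ∈ idx j (N 1 j) (N 2 j) (N 3 j), x < 70)
    (hd : ∀ j j' : Fin 7, j ≠ j' → ∀ x ∈ idx j (N 1 j) (N 2 j) (N 3 j),
      x ∉ idx j' (N 1 j') (N 2 j') (N 3 j')) : P (encode N) = true := by
  have hdig := colCode_digits N
  let v : ℕ → ℕ := fun j => if hj : j < 7 then colCode N ⟨j, hj⟩ else 0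
  have v_eq : ∀ j : Fin 7, v j = colCode N j := fun j => by simp [v]
  have hf : ∀ j : Fin 7, features idx j (v j) = idx j (N 1 j) (N 2 j) (N 3 j) := by
    intro j; simp only [features, v_eq, hdig]
  have hv : ∀ j < 7, v j < 343 ∧ ok j (v j % 7) (v j / 7 % 7) (v j / 49) = true := by
    intro j hj
    have : v j = colCode N ⟨j, hj⟩ := v_eq ⟨j, hj⟩
    obtain ⟨e1, e2, e3⟩ := hdig ⟨j, hj⟩
    rw [this, e1, e2, e3]
    exact ⟨colCode_lt _ _, hok ⟨j, hj⟩⟩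
  obtain ⟨L, h1, h2⟩ := allCandsK_sound (k := fun L => search P 7 L 0) hv h
  have h3 := search_sound (by simp) h1 ?_ h2
  · have : (((List.range 7).reverse.map fun j => cand idx j (v j)).map Cand.val).sum =
        encode N := by
      rw [List.map_map]
      refine (sum_map_reverse_range _ 7).trans ?_
      rw [Finset.sum_range]
      exact Finset.sum_congr rfl fun j _ => congrArg (· * 343 ^ (j : ℕ)) (v_eq j)
    rwa [this, zero_add] at h3
  · rw [List.pairwise_map, List.pairwise_reverse]
    refine List.Pairwise.imp_of_mem ?_ List.pairwise_lt_range
    intro a b ha hb hab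
    lift a to Fin 7 using List.mem_range.1 ha
    lift b to Fin 7 using List.mem_range.1 hb
    have hne : b ≠ a := by rintro rfl; exact lt_irrefl _ hab
    refine cand_compatible ?_ ?_ ?_ ?_
    · rw [hf]; exact hlt b
    · rw [hf]; exact hlt a
    · rw [hf, hf]; exact hd b a hne
    · rw [v_eq, v_eq,
        hasTwo_iff (n := Nat.land _ _) (lt_of_le_of_lt Nat.and_le_left (colMask_lt N b)), bits_land,
        bits_colMask hN, bits_colMask hN]
      exact hY b a hne

/-! ### Isotopisms -/

theorem Isotopic.trans {k n : ℕ} {M M' M'' : Fin 3 → Fin k → Fin n → Fin n}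
    (h : Isotopic M M') (h' : Isotopic M' M'') : Isotopic M M'' := by
  obtain ⟨ρ, r, c, f, h⟩ := h
  obtain ⟨ρ', r', c', f', h'⟩ := h'
  refine ⟨ρ'.trans ρ, r'.trans r, c'.trans c, fun s => (f (ρ' s)).trans (f' s), fun s i j => ?_⟩
  rw [h', h]; rfl

theorem Isotopic.isMOLRTriple {k n : ℕ} {M M' : Fin 3 → Fin k → Fin n → Fin n}
    (h : Isotopic M M') (hM : IsMOLRTriple M) : IsMOLRTriple M' := by
  obtain ⟨ρ, r, c, f, h⟩ := h
  refine ⟨fun s => ⟨fun i j j' e => ?_, fun j i i' e => ?_⟩, fun s t hst => ?_⟩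
  · simp only [h] at e
    exact c.injective ((hM.1 _).1 _ ((f s).injective e))
  · simp only [h] at e
    exact r.injective ((hM.1 _).2 _ ((f s).injective e))
  · rintro ⟨i, j⟩ ⟨i', j'⟩ e
    simp only [h, Prod.mk.injEq] at e
    have := hM.2 _ _ (ρ.injective.ne hst) (a₁ := (r i, c j)) (a₂ := (r i', c j'))
      (Prod.ext ((f s).injective e.1) ((f t).injective e.2))
    simpa using this

theorem Isotopic.isYouden {k n lam : ℕ} {M M' : Fin 3 → Fin k → Fin n → Fin n}
    (h : Isotopic M M') (hM : ∀ s, IsYouden (M s) lam) (s : Fin 3) : IsYouden (M' s) lam := by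
  obtain ⟨ρ, r, c, f, h⟩ := h
  have e : ∀ j, colSymbols (M' s) j = (colSymbols (M (ρ s)) (c j)).image (f s) := by
    intro j
    ext x
    simp only [colSymbols, Finset.mem_image, Finset.mem_univ, true_and, h, exists_exists_eq_and]
    exact ⟨fun ⟨i, hi⟩ => ⟨r i, hi⟩, fun ⟨i, hi⟩ => ⟨r.symm i, by simpa using hi⟩⟩
  intro j j' hj
  rw [e, e, ← Finset.image_inter _ _ (f s).injective,
    Finset.card_image_of_injective _ (f s).injective]
  exact hM _ _ _ (c.injective.ne hj)

/-- After given permutations of the rows and columns, the first rows can be made the identity. -/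
theorem exists_normalized {M : Fin 3 → Fin 4 → Fin 7 → Fin 7} (hM : IsMOLRTriple M)
    (r : Equiv.Perm (Fin 4)) (c : Equiv.Perm (Fin 7)) :
    ∃ M', Isotopic M M' ∧ (∀ s j, M' s 0 j = j) ∧
      ∀ s i j, M s (r i) (c j) = M s (r 0) (c (M' s i j)) := by
  have hb : ∀ s, Function.Bijective fun j => M s (r 0) (c j) := fun s =>
    Finite.injective_iff_bijective.1 (((hM.1 s).1 _).comp c.injective)
  let e : Fin 3 → Equiv.Perm (Fin 7) := fun s => Equiv.ofBijective _ (hb s)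
  have he : ∀ s j, e s j = M s (r 0) (c j) := fun s j => rfl
  refine ⟨fun s i j => (e s).symm (M s (r i) (c j)), ⟨1, r, c, fun s => (e s).symm,
    fun s i j => rfl⟩, fun s j => ?_, fun s i j => ?_⟩
  · rw [Equiv.symm_apply_eq, he]
  · rw [← he, Equiv.apply_symm_apply]

theorem isotopic_of_normalized {M M' : Fin 3 → Fin 4 → Fin 7 → Fin 7} (hM : IsMOLRTriple M)
    {ρ : Equiv.Perm (Fin 3)} {r : Equiv.Perm (Fin 4)} {c : Equiv.Perm (Fin 7)}
    (h : ∀ s i j, M (ρ s) (r i) (c j) = M (ρ s) (r 0) (c (M' s i j))) : Isotopic M M' := by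
  have hb : ∀ s, Function.Bijective fun j => M (ρ s) (r 0) (c j) := fun s =>
    Finite.injective_iff_bijective.1 (((hM.1 (ρ s)).1 _).comp c.injective)
  refine ⟨ρ, r, c, fun s => (Equiv.ofBijective _ (hb s)).symm, fun s i j => ?_⟩
  rw [eq_comm, Equiv.symm_apply_eq]
  exact h s i j

/-! ### Codes of permutations -/

/-- Digit `j` of `t` in base `b`. -/
def digit (b t j : ℕ) : ℕ := Nat.mod (Nat.div t (Nat.pow b j)) b

/-- Whether the base `n` digits of `t` define a permutation. -/
def isPerm (n t : ℕ) : Bool := injBelow n (digit n t) 0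

theorem exists_perm {n t : ℕ} [NeZero n] (h : isPerm n t = true) :
    ∃ σ : Equiv.Perm (Fin n), ∀ j : Fin n, (σ j : ℕ) = digit n t j := by
  have hinj : Function.Injective fun j : Fin n =>
      (⟨digit n t j, Nat.mod_lt _ (NeZero.pos n)⟩ : Fin n) := fun i j e =>
    Fin.ext (injBelow_iff.1 h _ i.2 _ j.2 (congrArg Fin.val e))
  exact ⟨Equiv.ofBijective _ (Finite.injective_iff_bijective.1 hinj), fun j => rfl⟩

/-- Whether the row and column permutations with codes `r` and `q` transform the rectangle with
code `x` to the one with code `y`, up to a permutation of symbols. -/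
def transforms (x y r q : ℕ) : Bool :=
  allBelow 4 fun i => allBelow 7 fun j =>
    force (digit 4 r i) fun i' => force (digit 4 r 0) fun i₀ => force (digit 7 q j) fun j' =>
    force (cell y i j) fun k => force (digit 7 q k) fun k' => Nat.beq (cell x i' j') (cell x i₀ k')

theorem transforms_sound {x y r q : ℕ} (h : transforms x y r q = true) {σ : Equiv.Perm (Fin 4)}
    {τ : Equiv.Perm (Fin 7)} (hσ : ∀ i : Fin 4, (σ i : ℕ) = digit 4 r i)
    (hτ : ∀ j : Fin 7, (τ j : ℕ) = digit 7 q j) (i : Fin 4) (j : Fin 7) :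
    rect x (σ i) (τ j) = rect x (σ 0) (τ (rect y i j)) := by
  have h1 := allBelow_iff.1 (allBelow_iff.1 h i i.2) j j.2
  simp only [force_eq, Nat.beq_eq] at h1
  apply Fin.ext
  simp only [rect, hσ, hτ]
  exact h1

/-- Whether two numbers are different. -/
def differ (a b : ℕ) : Bool := Bool.rec true false (Nat.beq a b)

theorem differ_iff {a b : ℕ} : differ a b = true ↔ a ≠ b := by
  have : differ a b = !(Nat.beq a b) := by unfold differ; cases Nat.beq a b <;> rfl
  rw [this, Bool.not_eq_true', ← Bool.not_eq_true, Nat.beq_eq]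

/-! ### Orthogonality -/

/-- Whether the rectangles with codes `x` and `y` are orthogonal. -/
def isOrthogonal (x y : ℕ) : Bool :=
  injBelow 28 (fun p => Nat.add (Nat.mul 7 (cell x (Nat.div p 7) (Nat.mod p 7)))
    (cell y (Nat.div p 7) (Nat.mod p 7))) 0

theorem isOrthogonal_iff {x y : ℕ} :
    isOrthogonal x y = true ↔ Orthogonal (rect x) (rect y) := by
  have hc : ∀ (z : ℕ) (p : ℕ), cell z (p / 7) (p % 7) < 7 := fun z p =>
    cell_lt _ _ (Nat.mod_lt _ (by norm_num))
  rw [isOrthogonal, injBelow_iff]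
  constructor
  · rintro h ⟨i, j⟩ ⟨i', j'⟩ e
    have e1 := congrArg Fin.val (congrArg Prod.fst e)
    have e2 := congrArg Fin.val (congrArg Prod.snd e)
    simp only [rect] at e1 e2
    have d : ∀ (i : Fin 4) (j : Fin 7), (7 * (i : ℕ) + j) / 7 = i ∧ (7 * (i : ℕ) + j) % 7 = j := by
      omega
    have h1 := h (7 * i + j) (by omega) (7 * i' + j') (by omega) (by
      change 7 * cell x (_ / 7) (_ % 7) + cell y (_ / 7) (_ % 7) =
        7 * cell x (_ / 7) (_ % 7) + cell y (_ / 7) (_ % 7)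
      rw [(d i j).1, (d i j).2, (d i' j').1, (d i' j').2, e1, e2])
    ext <;> simp only <;> omega
  · intro h p hp q hq e
    change 7 * cell x (p / 7) (p % 7) + cell y (p / 7) (p % 7) =
        7 * cell x (q / 7) (q % 7) + cell y (q / 7) (q % 7) at e
    have b1 := hc x p; have b2 := hc y p; have b3 := hc x q; have b4 := hc y q
    have := @h (⟨p / 7, by omega⟩, ⟨p % 7, by omega⟩) (⟨q / 7, by omega⟩, ⟨q % 7, by omega⟩) (by
      simp only [rect, Prod.mk.injEq, Fin.mk.injEq]; omega)
    simp only [Prod.mk.injEq, Fin.mk.injEq] at this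
    omega

/-- The mask of the entries in rows `1`, `2`, `3` of the rectangle with code `x`. -/
def entryMask (x : ℕ) : ℕ :=
  mask ((List.range 21).map fun p => Nat.add (Nat.mul 7 p) (digit 7 x p))

theorem Orthogonal.ne {A B : Fin 4 → Fin 7 → Fin 7} (h : Orthogonal A B) (hA : ∀ j, A 0 j = j)
    (hB : ∀ j, B 0 j = j) {i : Fin 4} (hi : i ≠ 0) (j : Fin 7) : A i j ≠ B i j := by
  intro e
  have := @h (i, j) (0, A i j) (by simp only [hA, hB, e])
  exact hi (congrArg Prod.fst this)

theorem land_entryMask {x y : ℕ} (h : Orthogonal (rect x) (rect y)) :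
    Nat.land (entryMask x) (entryMask y) = 0 := by
  refine land_eq_zero fun n h1 h2 => ?_
  rw [entryMask, testBit_mask, List.mem_map] at h1 h2
  obtain ⟨p, hp, h1⟩ := h1
  obtain ⟨q, hq, h2⟩ := h2
  rw [List.mem_range] at hp hq
  have b1 : digit 7 x p < 7 := Nat.mod_lt _ (by norm_num)
  have b2 : digit 7 y q < 7 := Nat.mod_lt _ (by norm_num)
  change 7 * p + digit 7 x p = n at h1
  change 7 * q + digit 7 y q = n at h2
  obtain rfl : p = q := by omega
  refine Orthogonal.ne h (fun _ => rfl) (fun _ => rfl) (i := ⟨p % 3 + 1, by omega⟩)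
    (fun e => absurd (congrArg Fin.val e) (Nat.succ_ne_zero _)) ⟨p / 3, by omega⟩ (Fin.ext ?_)
  change digit 7 x (3 * (p / 3) + p % 3) = digit 7 y (3 * (p / 3) + p % 3)
  rw [Nat.div_add_mod]
  omega

/-! ### Conjugacy classes of derangements -/

theorem multiset_sum_eq_seven {s : Multiset ℕ} (h2 : ∀ x ∈ s, 2 ≤ x) (h : s.sum = 7) :
    s = {7} ∨ s = {5, 2} ∨ s = {4, 3} ∨ s = {3, 2, 2} := by
  rcases s.empty_or_exists_mem with rfl | ⟨a, ha⟩
  · simp at h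
  obtain ⟨s, rfl⟩ := Multiset.exists_cons_of_mem ha
  rcases s.empty_or_exists_mem with rfl | ⟨b, hb⟩
  · simp_all
  obtain ⟨s, rfl⟩ := Multiset.exists_cons_of_mem hb
  rcases s.empty_or_exists_mem with rfl | ⟨c, hc⟩
  · have := h2 a; have := h2 b
    simp at *
    obtain rfl : b = 7 - a := by omega
    have : a ≤ 5 := by omega
    interval_cases a <;> decide
  obtain ⟨s, rfl⟩ := Multiset.exists_cons_of_mem hc
  rcases s.empty_or_exists_mem with rfl | ⟨d, hd⟩
  · have := h2 a; have := h2 b; have := h2 c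
    simp at *
    obtain rfl : c = 7 - a - b := by omega
    have : a ≤ 3 := by omega
    have : b ≤ 3 := by omega
    interval_cases a <;> interval_cases b <;> first | omega | decide
  · obtain ⟨s, rfl⟩ := Multiset.exists_cons_of_mem hd
    have := h2 a; have := h2 b; have := h2 c; have := h2 d
    simp at *
    omega

/-- Codes of representatives of the conjugacy classes of derangements of seven points. -/
def derangements : List ℕ := [114381, 690621, 583605, 697677]

theorem exists_conj (δ : Equiv.Perm (Fin 7)) (h : ∀ j, δ j ≠ j) :
    ∃ t ∈ derangements, ∃ τ : Equiv.Perm (Fin 7), ∀ j k : Fin 7, δ (τ j) = τ k →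
      (k : ℕ) = digit 7 t j := by
  have key : ∀ π : Equiv.Perm (Fin 7), δ.cycleType = π.cycleType → ∀ t,
      (∀ j : Fin 7, (π j : ℕ) = digit 7 t j) →
      ∃ τ : Equiv.Perm (Fin 7), ∀ j k : Fin 7, δ (τ j) = τ k → (k : ℕ) = digit 7 t j := by
    intro π hπ t ht
    obtain ⟨τ, hτ⟩ := isConj_iff.1 (Equiv.Perm.isConj_iff_cycleType_eq.2 hπ.symm)
    refine ⟨τ, fun j k hjk => ?_⟩
    rw [← hτ] at hjk
    have e : π j = k := by simpa [Equiv.Perm.mul_apply] using hjk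
    rw [← e, ht]
  have hs : δ.cycleType.sum = 7 := by
    rw [Equiv.Perm.sum_cycleType]
    have : δ.support = Finset.univ := by ext j; simp [h j]
    rw [this]; rfl
  rcases multiset_sum_eq_seven (fun _ => Equiv.Perm.two_le_of_mem_cycleType) hs with e | e | e | e
  · obtain ⟨τ, hτ⟩ := key c[0, 1, 2, 3, 4, 5, 6] (e.trans (by decide +kernel)) 114381
      (by decide +kernel)
    exact ⟨_, by simp [derangements], τ, hτ⟩
  · obtain ⟨τ, hτ⟩ := key (c[0, 1, 2, 3, 4] * c[5, 6]) (e.trans (by decide +kernel)) 690621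
      (by decide +kernel)
    exact ⟨_, by simp [derangements], τ, hτ⟩
  · obtain ⟨τ, hτ⟩ := key (c[0, 1, 2, 3] * c[4, 5, 6]) (e.trans (by decide +kernel)) 583605
      (by decide +kernel)
    exact ⟨_, by simp [derangements], τ, hτ⟩
  · obtain ⟨τ, hτ⟩ := key (c[0, 1, 2] * c[3, 4] * c[5, 6]) (e.trans (by decide +kernel)) 697677
      (by decide +kernel)
    exact ⟨_, by simp [derangements], τ, hτ⟩

/-! ### Computations -/

/-- Whether column `j` may have entries `j`, `a`, `b`, `d` in a rectangle whose row `1` is the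
permutation with code `t`, and in which row `2` precedes row `3`. -/
def okBase (t j a b d : ℕ) : Bool :=
  Nat.beq a (digit 7 t j) && differ a b && differ a d && differ b d && differ b j &&
    differ d j && (differ j 0 || Nat.ble b d)

/-- The positions of the entries of a column in their rows. -/
def rowFeatures (_ a b d : ℕ) : List ℕ := [a, Nat.add 7 b, Nat.add 14 d]

/-- Whether `p` is the code of a rectangle together with a code of a transformation of it to one of
the rectangles with codes in `base`. -/
def validBase (base : List ℕ) (p : ℕ × ℕ) : Bool :=
  force (nth base (Nat.mod p.2 6)) fun x => force (Nat.mod (Nat.div p.2 6) 256) fun r =>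
    force (Nat.div p.2 1536) fun q => isPerm 4 r && isPerm 7 q && transforms p.1 x r q

/-- Whether every Youden rectangle with row `1` given by `t` is in the list `l` and can be
transformed to one with code in `base`. -/
def baseCheck (base : List ℕ) (t : ℕ) (l : List (ℕ × ℕ)) : Bool :=
  searchAll (okBase t) rowFeatures fun c => force c fun c =>
    anyMem l fun p => Nat.beq p.1 c && validBase base p

/-- Whether column `j` may have entries `j`, `a`, `b`, `d` in a rectangle orthogonal to the one
with code `x`. -/
def okMate (x j a b d : ℕ) : Bool :=
  differ a b && differ a d && differ b d && differ a j && differ b j && differ d j &&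
    differ a (cell x 1 j) && differ b (cell x 2 j) && differ d (cell x 3 j)

/-- The positions of the entries of a column in their rows, and the pairs of these entries with the
corresponding entries of the rectangle with code `x`. -/
def mateFeatures (x j a b d : ℕ) : List ℕ :=
  [a, Nat.add 7 b, Nat.add 14 d, Nat.add 21 (Nat.add (Nat.mul 7 (cell x 1 j)) a),
    Nat.add 21 (Nat.add (Nat.mul 7 (cell x 2 j)) b),
    Nat.add 21 (Nat.add (Nat.mul 7 (cell x 3 j)) d)]

/-- Whether every Youden rectangle orthogonal to the one with code `x` has its code in `l`. -/
def mateCheck (x : ℕ) (l : List ℕ) : Bool :=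
  searchAll (okMate x) (mateFeatures x) fun c => force c fun c => anyMem l fun p => Nat.beq p c

/-- Whether the triple of rectangles with codes `x`, `y`, `z` is transformed by `t` to one of
the triples in `reps`. -/
def validTriple (reps : List ℕ) (x y z t : ℕ) : Bool :=
  force (Nat.mod t 31) fun a => force (Nat.mod (Nat.div t 31) 27) fun ρ =>
    force (Nat.mod (Nat.div t 837) 256) fun r => force (Nat.div t 214272) fun q =>
    isPerm 3 ρ && isPerm 4 r && isPerm 7 q && allBelow 3 fun s =>
      force (nth [x, y, z] (digit 3 ρ s)) fun u =>
      force (nth reps (Nat.add (Nat.mul 3 a) s)) fun v => transforms u v r q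

/-- `p x y` for all `x` before `y` in `l`. -/
def allPairs {α : Type} (l : List α) (p : α → α → Bool) : Bool :=
  List.rec true (fun x t ih => Bool.rec false ih (allMem t (p x))) l

/-- Pass on `l`, with entry masks added. -/
def withMasks (l : List ℕ) : (List (ℕ × ℕ) → Bool) → Bool :=
  List.rec (fun k => k []) (fun x _ ih k => force (entryMask x) fun m =>
    ih fun L => k ((x, m) :: L)) l

/-- Whether the triples of orthogonal rectangles with codes `x`, `y`, `z`, where `y` precedes `z`
in `l`, appear in `certs` with a transformation to one of the triples in `reps`. -/
def pairCheck (reps : List ℕ) (x : ℕ) (l : List ℕ) (certs : List (ℕ × ℕ × ℕ)) : Bool :=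
  withMasks l fun L => allPairs L fun y z =>
    Nat.rec (Bool.rec true (anyMem certs fun c => Nat.beq c.1 y.1 && Nat.beq c.2.1 z.1 &&
      validTriple reps x c.1 c.2.1 c.2.2) (isOrthogonal y.1 z.1)) (fun _ _ => true)
      (Nat.land y.2 z.2)

/-- The mask of the set of symbols in column `j` of the rectangle with code `x`. -/
def symbolMask (x j : ℕ) : ℕ := mask [cell x 0 j, cell x 1 j, cell x 2 j, cell x 3 j]

/-- Whether `y` is a code of the inverses of the rows of the rectangle with code `x`. -/
def isInverse (x y : ℕ) : Bool :=
  allBelow 4 fun i => allBelow 7 fun j => force (cell x i j) fun k => Nat.beq (cell y i k) j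

/-- Whether `x` is the code of a Latin rectangle, given that its rows are injective, which is a
Youden rectangle. -/
def isValid (x : ℕ) : Bool :=
  (allBelow 7 fun j => injBelow 4 (fun i => cell x i j) 0) &&
  allBelow 7 fun j => force (symbolMask x j) fun m => allBelow 7 fun k =>
    Nat.beq j k || Nat.beq (hasTwo (Nat.land m (symbolMask x k))) 1

/-- Sum of `f x` over the members `x` of `l`. -/
def sumMem {α : Type} (l : List α) (f : α → ℕ) : ℕ := List.rec 0 (fun x _ ih => Nat.add (f x) ih) l

/-- Number of `m < n` satisfying `p`. -/
def countBelow (n : ℕ) (p : ℕ → Bool) : ℕ :=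
  Nat.rec 0 (fun m ih => Bool.rec ih (Nat.add ih 1) (p m)) n

/-- The first three values of the permutations of three points. -/
def perms₃ : List (ℕ × ℕ × ℕ) := [(0, 1, 2), (0, 2, 1), (1, 0, 2), (1, 2, 0), (2, 0, 1), (2, 1, 0)]

/-- The first three values of the permutations of four points. -/
def perms₄ : List (ℕ × ℕ × ℕ) :=
  [(0, 1, 2), (0, 2, 1), (1, 0, 2), (1, 2, 0), (2, 0, 1), (2, 1, 0),
   (0, 1, 3), (0, 3, 1), (1, 0, 3), (1, 3, 0), (3, 0, 1), (3, 1, 0),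
   (0, 2, 3), (0, 3, 2), (2, 0, 3), (2, 3, 0), (3, 0, 2), (3, 2, 0),
   (1, 2, 3), (1, 3, 2), (2, 1, 3), (2, 3, 1), (3, 1, 2), (3, 2, 1)]

/-- The isotopism invariant of the triple of index `n`, computed from the codes in `reps` and the
codes of inverses in `inv`. -/
def invariantCode (reps inv : List ℕ) (n : ℕ) : ℕ :=
  sumMem perms₃ fun s =>
    force (nth reps (Nat.add (Nat.mul 3 n) s.1)) fun x =>
    force (nth reps (Nat.add (Nat.mul 3 n) s.2.1)) fun y =>
    force (nth reps (Nat.add (Nat.mul 3 n) s.2.2)) fun z =>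
    force (nth inv (Nat.add (Nat.mul 3 n) s.1)) fun x' =>
    force (nth inv (Nat.add (Nat.mul 3 n) s.2.1)) fun y' =>
    force (nth inv (Nat.add (Nat.mul 3 n) s.2.2)) fun z' =>
    sumMem perms₄ fun i =>
      Nat.pow (countBelow 7 fun j =>
        force (cell x i.2.1 j) fun k => force (cell x' i.1 k) fun j₁ =>
        force (cell y i.1 j₁) fun k => force (cell y' i.2.2 k) fun j₂ =>
        force (cell z i.2.1 j₂) fun k => Nat.beq (cell z' i.2.2 k) j) 3

/-- Codes of representatives of the Youden rectangles. -/
def baseCodes : List ℕ :=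
  [122341460985599031, 122628962034229239, 179257780813145679, 122341803152185863,
   20572627389198543, 331062236653339647]

/-- Youden rectangles with a given row `1`, with transformations to one of the `baseCodes`. -/
def baseList₀ : List (ℕ × ℕ) :=
  [(353428898284125315, 1074932572), (205441601435279091, 651742384),
   (125517467211445233, 347070890), (216940001350220289, 1069697200),
   (330697573778623941, 982366958), (205309057262473179, 50914876),
   (251270770850933247, 1226664797), (137415536532681219, 72645843),
   (285036108501005289, 1194067730), (137415622994006967, 878464836),
   (285235512839122581, 586604270), (410987268534810591, 356378796),
   (114152575549944555, 145627218), (250938155106297387, 1126781139),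
   (410987954919196971, 810313491), (126149465476147401, 1193182958),
   (331296347828360097, 471809201), (205907819482837683, 587489042),
   (330930783646014357, 377189138), (251369793382091427, 379465454),
   (194541480699815187, 443065180), (376924869422664291, 386303728),
   (205312535097705351, 139047284), (251373281366672235, 983316242),
   (114152573864944413, 600013227), (250938153421297245, 693453636),
   (296998122891557655, 1021129491), (296766748549944009, 386496684),
   (433784865116006559, 908582634), (433553490774392913, 282945675),
   (296765591250505455, 678358694), (445317469094164941, 190030378),
   (103353810870306879, 441442390), (262237744969039701, 256431190),
   (205907829660085995, 276014916), (205910736305691915, 204250539),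
   (296766760697949879, 70895288), (205242786310869315, 653364796),
   (285068665192376367, 988946604), (216975355673189751, 677473976),
   (285071571837982287, 885911691), (376957910268407889, 778453744),
   (376692821967137733, 1214047786), (262705710997192149, 45679702),
   (217573558567787619, 1125914924), (103583724571904445, 862558294),
   (330896981215695231, 235926364), (125485487630933823, 486314730),
   (125884279408066047, 389262099), (171780412934950695, 864116572),
   (331428697370802207, 356185840), (285966048385254861, 611597866),
   (125484334272124605, 798304682), (331062661421848917, 349347566),
   (444886700553861903, 282595628), (205974286470559755, 675095763),
   (376493329466271711, 917891408), (422753471911204407, 1226664311),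
   (342494594065738143, 1099814998), (205974294944745195, 778646610),
   (342363011474848491, 915615020), (206174460305772099, 466657616),
   (217439065341346311, 71780006), (422618600713938399, 887773520),
   (342826916027116095, 1029036586), (354127370283066591, 1200021232),
   (103351685526514251, 1105050460), (102720260147096565, 797355380),
   (171115948121327721, 139932074), (342694952626711455, 145885936),
   (216942132877154721, 821898058), (250875078646698297, 1199762514),
   (251273870423830521, 916029651), (422121460677349581, 571507794),
   (433685262935762181, 1228267947), (262537412523093513, 65198916),
   (217339569647620029, 467956875), (296700292575354501, 1119334122),
   (262537420997278953, 174132651), (434185695222132015, 249114155),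
   (422519097390981795, 885497132), (422122046221392651, 281646416),
   (262801631120023395, 1125030584), (194808799176749451, 467606828),
   (342562408460455527, 400846378), (206239761234096003, 571314550),
   (285566098144252059, 989204854), (194640791937924249, 159912778)]

/-- Youden rectangles with a given row `1`, with transformations to one of the `baseCodes`. -/
def baseList₁ : List (ℕ × ℕ) :=
  [(122628934070003817, 596013609), (168091583089217985, 746676918),
   (122628256128599481, 742999734), (168090905147813649, 596004393),
   (213386422608795213, 653364792), (20170164277134999, 400468806),
   (213585828636822741, 72645840), (88563543833983779, 100523790),
   (213386519209582377, 400478022), (20170260877922163, 653355576),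
   (213585923547699669, 96911118), (88563638744860707, 76258512), (213387585276891285, 261122185),
   (20171326945231071, 777743191), (213586991304918813, 758048726),
   (88564706502079851, 296594084), (213388263211726485, 777217879),
   (20172004880066271, 261647497), (213587667549843777, 296529572),
   (88565382747004815, 758113238), (214083052333802793, 46583478),
   (259545701353016961, 804184617), (134258230191414771, 458197326),
   (247914852739450191, 193191753), (123092164360370871, 442926648),
   (327674084946834627, 190030662), (259877743916723703, 547315652),
   (328071717445544955, 85861046), (213454535289080121, 254754126),
   (42969601467026991, 111464265), (54100600527497931, 797004558),
   (122294574056319183, 769126608), (54498233026208259, 585884431),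
   (259080153612672015, 69263569), (214082955721502883, 804193833),
   (259545604740717051, 50260662), (134258133303211149, 193200969),
   (247914755851246569, 461874510), (123092164642005819, 190039878),
   (327674085228469575, 442917432), (259877744198358651, 85796534),
   (328071717727179903, 547380164), (213453857348480169, 111455049),
   (42968923526427039, 251076942), (54100600804206027, 772739280),
   (122294574333027279, 793391886), (54498233302916355, 69788881),
   (259080153889380111, 585359119), (134258240368663083, 204250536),
   (247914862916698503, 439765851), (134258145451217019, 439756635),
   (247914767999252439, 200573352), (133627487826414303, 407325456),
   (31336527533182425, 650194491), (134324600572618443, 801032742),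
   (270712547630260947, 42362712), (271310740365689991, 273416150),
   (339504713894511243, 570493604), (293210662563128367, 763034761),
   (31800430702646901, 375437143), (293609454340260591, 565729416),
   (168587169537421629, 588962646), (293213569208734287, 234737208),
   (31803337348252821, 108303174), (293612360985866511, 465717188),
   (168590076183027549, 778600118), (134324610741640971, 294216463),
   (270712557799283475, 552790225), (271310750534712519, 487743696),
   (339504724063533771, 381906702), (133626331646982315, 668626614),
   (31335371353750437, 403638825), (133627391214114393, 650203707),
   (31336430920882515, 411002640), (134324697179136843, 42371928),
   (270712644236779347, 801023526), (271310836972208391, 570558116),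
   (339504810501029643, 273351638), (134324705653322283, 552264913),
   (270712652710964787, 294741775), (271310845446393831, 385519374),
   (339504818975215083, 484131024), (133626329670476763, 403629609),
   (31335369377244885, 664949430), (293210565668355609, 375962455),
   (31800333807874143, 762509449), (293609357445487833, 592575318),
   (168587072642648871, 562116744), (293212890984840345, 108293958),
   (31802659124358879, 234746424), (293611682761972569, 778664630),
   (168589397959133607, 465652676), (42668285405497263, 277075080),
   (110862258934318515, 307533654), (42869999850907167, 735101784),
   (179257946908549671, 608648742), (123159113535827979, 818939304),
   (350472358631898819, 39201627), (111460451684528115, 84497239),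
   (247848398742170619, 471044233), (179856139658759271, 378257060),
   (248050113187580523, 65245142), (350836959893045697, 247390779),
   (248545999599813819, 126200592), (31703833742002227, 731940699),
   (259017078838073067, 618122664), (42668186539983705, 303920982),
   (110862160068804957, 280687752), (42869321346182661, 608657958),
   (179257268403825165, 735092568), (123159016647624357, 39210843),
   (350472261743695197, 822616488), (111460352819014557, 471569545),
   (247848299876657061, 83971927), (179855461154034765, 65309654),
   (248049434682856017, 378192548), (350836957916540145, 122523408),
   (248545997623308267, 247381563), (31703155801402275, 614445480),
   (259016400897473115, 731931483)]

/-- Youden rectangles with a given row `1`, with transformations to one of the `baseCodes`. -/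
def baseList₂ : List (ℕ × ℕ) :=
  [(120566342583186417, 946147538), (417367991046053727, 746427530),
   (200458494100457181, 1180989650), (223155432333004977, 58895534),
   (41208325200918639, 570530900), (257452485305546007, 375437486), (18275380595100693, 57918638),
   (167090790927209787, 570908756), (64103779967617125, 376036526),
   (18540279092682117, 1130393810), (166230609716341143, 919835786),
   (64269459621963387, 823335122), (223453653317330031, 772739282),
   (41704009379803233, 1104082058), (257883447612302037, 996743378),
   (121129462065092895, 58296494), (417003494014069677, 571507796),
   (201055136061559473, 375059630), (29575251258041511, 65198918),
   (303146313758464023, 1003949912), (166494543863129847, 769144664),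
   (109867465128453075, 1100450576), (269083730219483565, 368230214),
   (406235542334103315, 261647084), (143796450306763269, 368608070),
   (257621074435955511, 260670188), (86403562249569615, 1177358168),
   (87165497980864773, 65797958), (144094678058974203, 953390936),
   (258249302226018405, 742796048), (269183328167523771, 1126799192),
   (405804773783946573, 927042320), (166892369563380987, 367631174),
   (110064924368359227, 261269228), (302980632985688841, 66175814),
   (30171506216561487, 819703640), (257419548101858283, 577811270),
   (166428466091750619, 970394834), (177596466309995895, 268098644),
   (246255605673408171, 1151046416), (223223056324566453, 977638232),
   (303213946782589893, 269075630), (428635700474611995, 578788076),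
   (439768148620793175, 796986506), (41339229294450123, 578410310),
   (109964453543050149, 1154641106), (121530189086691561, 793391888),
   (30371676657168015, 268476500)]

/-- Youden rectangles with a given row `1`, with transformations to one of the `baseCodes`. -/
def baseList₃ : List (ℕ × ℕ) :=
  [(202184940328801263, 445100706), (88528317780765843, 650194472),
   (202188611377137267, 566568361), (88531988829101847, 1112588586),
   (202185035239678191, 650203688), (88528412691642771, 445165218),
   (202187933435732931, 931954986), (88531310887697511, 562891177),
   (201986315607533031, 808258105), (20135719530676359, 1137886578),
   (201988440951306507, 293368770), (20137844874449835, 808248890),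
   (201986220690086967, 957252978), (20135624613230295, 808248889),
   (201989118886141707, 808258106), (20138522809285035, 293433282),
   (213583835508407253, 746750377), (88561550705568291, 1112072490),
   (213587506556743257, 470389410), (88565221753904295, 805087784),
   (213583930419284181, 931438890), (88561645616445219, 743073193),
   (213586828615338921, 805097000), (88564543812499959, 470453922),
   (213385210792065873, 268080066), (20168952460405659, 653355578),
   (213387336135839349, 653364793), (20171077804179135, 1138402674),
   (213385115874619809, 653364794), (20168857542959595, 268144578),
   (213388014070674549, 957769074), (20171755739014335, 653355577),
   (134258174826736563, 1221282361), (247914797374771983, 345881538),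
   (134256435909103719, 777393522), (247913058457139139, 1221273146),
   (123091910149588227, 596759922), (327673830736051983, 1221282362),
   (123090171231955383, 1221273145), (327672091818419139, 345946050),
   (43332878492999019, 497613474), (338840097117891111, 921642409),
   (43331719214577123, 1063218728), (338838937839469215, 752095530),
   (54499143163578219, 1063227944), (259081063750041975, 571461930),
   (54497983885156323, 497677986), (259079904471620079, 917965225),
   (134258271714906669, 320592834), (247914894262942089, 1066389049),
   (134256436190738667, 1066379834), (247913058738774087, 777909618),
   (123092007037758333, 1066389050), (327673927624222089, 597276018),
   (123090171513590331, 320657346), (327672092100054087, 1066379833),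
   (43332975376242273, 1101824425), (338840194001134365, 522902178),
   (43331719491285219, 751579434), (338838938116177311, 1218112040),
   (54499240046821473, 570945834), (259081160633285229, 1218121256),
   (54497984161864419, 1098147241), (259079904748328175, 522966690),
   (54067125220444197, 646591034), (110895436494461907, 441479106),
   (54069443777287989, 909827442), (110897755051305699, 646581817),
   (134323385084563221, 600446250), (270711332142205725, 1220830760),
   (134324254543379643, 1123813801), (270712201601022147, 165238434),
   (111693026828074707, 112725684), (327640609669342005, 807806792),
   (111695345384918499, 768740113), (327642928226185797, 960939684),
   (54531796735762641, 136199106), (270479379577029939, 1062324793),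
   (54531893342297799, 1062315578), (270479476183565097, 759468402),
   (54534703381368561, 338508468), (270482286222635859, 1153379089),
   (54531901791848979, 1214048072), (270479484633116277, 733138596),
   (134324264712402171, 1059606361), (270712211770044675, 493991892),
   (134326873088851437, 549334764), (270714820146493941, 1059615578),
   (133626760723238427, 798304681), (31335800430006549, 1093631274),
   (133628982673547061, 285995682), (31338022380315183, 801023528),
   (31933993165435593, 1119961836), (338806874045131227, 649300825),
   (31936215115744227, 649291610), (338809095995439861, 83686356), (54067220131304367, 441414594),
   (110895531405322077, 646581818), (54068765835866895, 646591033),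
   (110897077109884605, 1090461042), (134323288196359599, 1065937448),
   (270711235254002103, 600962346), (134324254261711179, 139949730),
   (270712201319353683, 943631785), (111693121738934877, 807797576),
   (327640704580202175, 112661172), (111694667443497405, 1141573284),
   (327642250284764703, 772417297), (134324262735896619, 519280596),
   (270712209793539123, 1214499673), (134326194866599779, 1214508890),
   (270714141924242283, 548818668), (133626855634919739, 912997674),
   (31335895341687861, 794627497), (133628304732947109, 801032744),
   (31337344439715231, 286060194), (31934088077116905, 649291609),
   (338806968956812539, 939328236), (31935537175144275, 83750868),
   (338808418054839909, 649300826), (54531699840989883, 1217218105),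
   (270479282682257181, 161487810), (54531893054060199, 758952306),
   (270479475895327497, 1217208890), (54534025157474619, 973197073),
   (270481607998741917, 313219764), (54531899813701143, 733654692),
   (270479482654968441, 1059154760), (42668230040819055, 909311346),
   (110862203569640307, 801475129), (42670548597662847, 801484346),
   (110864522126484099, 466767810), (123157120407412491, 1127490985),
   (350470365503483331, 165173922), (123157989866228913, 781079850),
   (350471234962299753, 1220821544), (111460396319849907, 588558097),
   (247848343377492411, 961455780), (111462714876693699, 87436980),
   (247850661934336203, 652913480), (43365532064359905, 1062324794),
   (350238412944055539, 578834802), (43365628670895063, 136263618),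
   (350238509550590697, 1062315577), (43368438709965825, 1214057288),
   (350241319589661459, 552504996), (43365637120446243, 338572980),
   (350238518000141877, 1149701905), (123158000035251441, 729968364),
   (350471245131322281, 1059606362), (123160608411700707, 1059615577),
   (350473853507771547, 493927380), (122227865532117297, 260706978),
   (31302567493688961, 646130216), (122230087482425931, 618122665),
   (31304789443997595, 1094147370), (31701362650641657, 804184922),
   (259014607746712497, 108975060), (31703584600950291, 1119445740),
   (259016829697021131, 804194137), (42668324951679225, 801484345),
   (110862298480500477, 1089944946), (42669870656241753, 466703298),
   (110863844185063005, 801475130), (123157023519208869, 139885218),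
   (350470268615279709, 947308969), (123157989584560449, 1065928232),
   (350471234680631289, 781595946), (111460491230710077, 1142089380),
   (247848438288352581, 592235281), (111462036935272605, 652904264),
   (247849983992915109, 87372468), (123157998058745889, 1214499674),
   (350471243154816729, 729452268), (123159930189449049, 519216084),
   (350473175285519889, 1214508889), (122227960443798609, 646139432),
   (31302662405370273, 260771490), (122229409541825979, 913513770),
   (31304111503397643, 614445481), (31701457562322969, 109039572),
   (259014702658393809, 804194138), (31702906660350339, 804184921),
   (259016151756421179, 938812140), (43365435169587147, 578318706),
   (350238316049282781, 1217218106), (43365628382657463, 1217208889),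
   (350238509262353097, 161552322), (43367760486071883, 553021092),
   (350240641365767517, 1059163976), (43365635142298407, 969519889),
   (350238516021994041, 313284276)]

/-- Codes of the representative triples. -/
def repCodes : List ℕ :=
  [122341460985599031, 342829570655565675, 164804659137410193, 122628962034229239,
   324786688808339025, 447225668081002017, 122628962034229239, 377669469252078405,
   403121934863006769, 122628962034229239, 377669469252078405, 165469366689864255,
   122628962034229239, 64548731354899473, 403121934863006769, 122628962034229239,
   64548731354899473, 210152869008736491, 122628962034229239, 61389654871400181,
   210152869008736491, 122628962034229239, 61389654871400181, 346963349202144057,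
   122628962034229239, 403353203010498297, 210152869008736491, 122628962034229239,
   165469366689864255, 379297564747436529, 179257780813145679, 246324416380857621,
   61266524503380165, 179257780813145679, 355309520540135877, 403134948496972737,
   179257780813145679, 347689130494476537, 49305674208185631, 122341803152185863,
   445152559941684765, 242548452185621355, 122341803152185863, 269202320101590381,
   216834823829980593, 122341803152185863, 286452443792438289, 15362724228025221,
   122341803152185863, 347683693240801017, 417446235263005875, 122341803152185863,
   347683693240801017, 216834823829980593, 122341803152185863, 417446235263005875,
   210833198049978837, 122341803152185863, 242548452185621355, 381312031159399023,
   20572627389198543, 400741191066011427, 137504246095405395, 20572627389198543,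
   400741191066011427, 263617115835888603, 20572627389198543, 164801794534876935,
   437133027738886695, 20572627389198543, 321125585878078551, 437133027738886695,
   331062236653339647, 48688357599751095, 86518508516145387, 331062236653339647,
   48688357599751095, 406383426613086345, 331062236653339647, 48688357599751095,
   300664030559575491, 331062236653339647, 48688357599751095, 427396436992510263,
   331062236653339647, 48688357599751095, 202307285727084663, 331062236653339647,
   207111762413405649, 84899603922190083, 331062236653339647, 435618785170434987,
   210387524328350829]

/-- Codes of the inverses of the rows of the representative triples. -/
def inverseCodes : List ℕ :=
  [303214007613864159, 31984152135955515, 114128703089090541, 361836897144287391,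
   268839511661302713, 208317479935287537, 361836897144287391, 414537419814055929,
   65015346845911185, 361836897144287391, 414537419814055929, 29918075329560843,
   361836897144287391, 243306800485336305, 65015346845911185, 361836897144287391,
   243306800485336305, 25158665395289799, 361836897144287391, 141191321765716989,
   25158665395289799, 361836897144287391, 141191321765716989, 28418248391874777,
   361836897144287391, 144808963634646405, 25158665395289799, 361836897144287391,
   29918075329560843, 448715115283049289, 361836896867531415, 144141101211366369,
   51619075830740637, 361836896867531415, 51235219090076121, 299538656229498633,
   361836896867531415, 25138154856756393, 142237601349436287, 221860458041968971,
   123547754226790809, 428383145202247539, 221860458041968971, 47942618670353529,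
   331237631628838773, 221860458041968971, 406516665829971717, 344094493965068529,
   221860458041968971, 245942507228840721, 48631012059114243, 221860458041968971,
   245942507228840721, 331237631628838773, 221860458041968971, 48631012059114243,
   269667511050995181, 221860458041968971, 428383145202247539, 122799770352050103,
   200625985331733015, 348293144613486195, 288899661552571971, 200625985331733015,
   348293144613486195, 447216265176669603, 200625985331733015, 339427123138157463,
   126827795575348407, 200625985331733015, 270468209754266463, 126827795575348407,
   202307285727084663, 427396436992510263, 300664030559575491, 202307285727084663,
   427396436992510263, 61753855095831609, 202307285727084663, 427396436992510263,
   86518508516145387, 202307285727084663, 427396436992510263, 48688357599751095,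
   202307285727084663, 427396436992510263, 331062236653339647, 202307285727084663,
   347370177831693021, 299030855800754583, 202307285727084663, 17701453952392887,
   344094415916747841]

/-- Codes of the Youden rectangles orthogonal to the one of index 0 in `baseCodes`. -/
def mates₀ : List ℕ :=
  [423975627438911109, 423742998941665461, 269072192521814733, 343947244881181041,
   344179872890668341, 347687013215697129, 17123684869892799, 63362226544582275,
   18519507287003529, 251031918664248003, 269215882916759613, 429673675225534749,
   422753467862820789, 423956634368656545, 269727356006663445, 269257351412186181,
   263575654346111445, 64523744954039961, 330898077009749475, 347579807472322749,
   18163860524330985, 264302827269939747, 381813887302177059, 17080974370057635,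
   426905848071729063, 424798603580149101, 418284216679285791, 17820128161187991,
   345110489255517813, 347455400190200703, 347423908145543721, 402581280654484515,
   49173023349365499, 321149322070607817, 47544609789345231, 322746619906199835,
   166494793007705067, 321657056064439749, 446681725240865859, 49449848744863395,
   446779389360935907, 342829570655565675, 60505614208471743, 402586411540262463,
   64240205675182659, 18940567406667525, 18916973684671653, 60587240987907567, 29906089964563095,
   411395463687437001, 25158662843280669, 378388819196911953, 422519488534934451,
   217339906240528893, 59191857876303729, 178535471944460697, 428838491777253309,
   403733231084354517, 410680371615140511, 444877057047729519, 14909595066840015,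
   413871368391501471, 423295228445829057, 15227661593281077, 446672228987945691,
   49437694987389243, 446769893108015739, 205964208812508219, 323876422917987327,
   48707763062434731, 402104488393709433, 331271122874389029, 403720690021605477,
   178333175827659429, 177865191840293541, 217365761500939089, 178336074375866781,
   422343819755285949, 205964216851971987, 49324722381311247, 332051733742066299,
   49437529122584907, 288557448508267425, 285237505014579009, 216826211351296089,
   62508627069052455, 210792245745332241, 211066330011555519, 301160416047193287,
   15283574808426243, 171380895659488197, 403211276751601413, 422752069593987669,
   51983352892782315, 285951665182493853, 210830750188636869, 427249365811119513,
   243246279323227653, 404881807933952577, 219706331208421509, 29185788021239133,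
   262645132127403645, 165972557824496217, 28155594752464113, 378521961834269223,
   264371964191515647, 51947066192249583, 285228009042611157, 379790053035123897,
   165952282569142599, 298499097709596663, 244063948624360443, 241504631640552663,
   15053360310062541, 264302227669706595, 30809565915366915, 25925694428005461,
   247320765932723649, 62211003791551767, 381383355311282133, 324388889242238133,
   347214964937350347, 269215938281822229, 262702275981411285, 336156169327088913,
   28443619327554387, 17321758531995069, 378526706983368963, 325591481225393955,
   381416417026933797, 177798238158403665, 300231287804857113, 262787732087205141,
   257536440422025273, 285228593485389945, 444877057049263047, 324388889244591093,
   404202229263341739, 404200126009109205, 423876219152819103, 208323513950274729,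
   205502630685292359, 376999358943056877, 423207835498942101, 335709159680460663,
   172517405042755233, 15025622365584837, 219706331209833285, 429770329841370825,
   28717845118661565, 29185788022650909, 165504587343110469, 348350111578642347,
   258291621587893095, 165972557825907993, 164804659137410193, 344112436821811671,
   413868306585214809, 16639744171401945]

/-- Codes of the Youden rectangles orthogonal to the one of index 1 in `baseCodes`. -/
def mates₁ : List ℕ :=
  [262294584822637929, 268836675716002473, 343814700714944265, 321696695164702545,
   28715262651412731, 406478371843663317, 62650472182039233, 378007328280651309,
   62650554982713945, 421813304829630387, 325518516983158011, 424366972077993723,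
   62180831158182207, 17416593907047855, 59375019412821303, 377912635233065109,
   265252899722287563, 348302211932270745, 324786688808339025, 268903137624135345,
   62664401112660279, 404597290688483643, 18248897999015217, 241374793142212767,
   403919505150219459, 330886420208474265, 403249334077068867, 401620920502268043,
   49883963186692323, 342107230030794567, 345111177205424241, 377071276501868805,
   380318415361599501, 377073926281118853, 380321065140849549, 377669469252078405,
   380916608111809101, 377672119031328453, 380919257891059149, 65016714496493889,
   403733229389503065, 334179696034608273, 48742059644999451, 406450870956017415,
   401506309484671779, 401496810406999191, 18818257430042325, 445598680344079419,
   64548731354899473, 171093382474405905, 402552790126028937, 223860428463058173,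
   417714410496566025, 428382722755070793, 51617789809117389, 61389654871400181,
   403353203010498297, 289700178008736177, 447225668081002017, 243665158547734641,
   218422109233036377, 28515865076203509, 28587002813250921, 403121934863006769,
   218353615996820931, 298212019098261111, 165469366689864255, 62916998714929377,
   25403431872294459, 444600607259177289, 448792511665914441, 255576077359417917,
   403761714758562717, 47525105991777453, 171127110291628131, 410503612585459887,
   300607058762529453, 264783017495599425, 162753782539999599, 448584503570501841,
   411395830581019869, 51215944935693969, 415356715229855193, 262223446274727669,
   422732745179831349, 448850119099715505, 241969892264049051, 241048865123555031,
   250850343365748207, 17321346202355829, 251810911156103541, 242967846246835581,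
   288311778306666405, 298147636558438497, 380318429769246225, 297511461912820419,
   299014903423097937, 243664773810800067, 166939570622178639, 30808238833718883,
   222300196427979927, 342076780503914391, 303858779610422601, 381261277852096059,
   61399068681196377, 59604568137095175, 379854525185770437, 288451201592646027,
   288551273852046357, 14977789422855957, 18289931781753441, 286656692350723875,
   210152869008736491, 299481558770458251, 297813416374956627, 18248901388724277,
   379297564747436529, 335339989954435989, 346963349202144057, 299778879429267831,
   378137223950902407, 51521419452920625, 299679181456429143, 247028708604335013,
   288315395992095345, 51478860923357643, 381261084033726441, 19054217650929579,
   288680493600915093, 335897026076556279, 28601161390157481, 429769665459601641,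
   424305248790279429, 298212018038008101, 61698247621891929, 62333040697134003,
   62333040938549751, 299747716512271551, 171093354781730877, 258767702832657591,
   250848318839162589, 346963835377933227, 30288389711395563, 167075131935844467,
   287743645109813661, 17821282896031131, 322312196390734521, 252322059272661027,
   321176230300955385, 254140607044675791, 17056935806998275, 17052202091786175,
   17194620942201051]

/-- Codes of the Youden rectangles orthogonal to the one of index 2 in `baseCodes`. -/
def mates₂ : List ℕ :=
  [41144303058964821, 246324416380857621, 59341084855552215, 36505254314814651, 62333040705303699,
   298483173305578305, 355309520540135877, 286915781093875173, 62551332406763559,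
   51265718917768413, 87769703456931267, 59308747307467443, 137472600001521843,
   137306919592546083, 381302340996690927, 381300691664007999, 85593961110750759,
   47710857955887639, 64179746003850129, 59308747329702915, 143979680176871625, 62333054544119949,
   62333054785535697, 114468631259426775, 36507579651064251, 42140322090818037, 51215944935661137,
   285223251755810349, 47976098499142137, 126106718545068669, 406080066469245471,
   353845433904089157, 131741810805908151, 446968825172208495, 142275291938038611,
   241518317732840115, 241519125000590271, 401496815491553547, 296813087931919779,
   59530641845224455, 47667842360497845, 301032218937616407, 49106339661312027,
   446970612917771631, 298245791793652209, 59540135921840619, 49305155905706823,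
   243303608439528255, 376607366191710405, 300231701348621661, 303826211075639745,
   263590423937224821, 286107323185447641, 61387699643330301, 61190342666052435,
   243765095459364783, 429239162744957925, 429210273759034617, 403134948496972737,
   289362822624138357, 269067281415236181, 126293563613223891, 243069326569588221,
   49372532688509523, 286920818028899127, 288547892893433925, 288747951226812549,
   103527542136656151, 379200919164760269, 323959720266303327, 289644193176879915,
   402130482572196423, 265233058498468413, 103297622778343017, 129398377879550601,
   29678731769696355, 87305114700385011, 380189644464326679, 87305122448211699,
   355245010820784207, 380252493496958625, 60957581646291075, 355309512065966511,
   355309439429387475, 60699303235582029, 347689518211931193, 264051534437452773,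
   60501946258304163, 62880696273882897, 62880695388691821, 381819435235337187,
   404987162765230791, 84049657610364135, 61266524503380165, 142515793410454629,
   108179401003570341, 344505584316100869, 36592991423405631, 347689130494476537,
   380834094808655289, 62823433781779101, 86213499268518423, 118781540755153119,
   356433848300053647, 242444897558172495, 356434977341513403, 299876635363035105,
   347457169724581557, 436866397104905199, 445464912577267665, 433942669773437823,
   405328868838708057, 448260389323855533, 29689112264671935, 427780872135324531,
   49287050696163159, 49106643039726039, 448067989506974373, 445000758850628433,
   49305674208185631, 402736915783590813, 402536844738934029, 403667042374200645,
   49532566883101839, 103533646092432687, 108312800246438373, 41723120282765157,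
   246903233619438513, 424286707395473739, 87206748061950333, 87041067652974573,
   437865100951207347, 436715892779064561, 450446021588296683, 353620998325088793,
   427377343074742359, 269067281416769709, 299875634261140923, 354273458450905881,
   354848198289555249, 325593559399330431, 381493890529906671, 142512960166798437,
   142516281806075169, 450383431230813807, 427097222392231215, 143156714390828991,
   83732918918715639, 422012694624801993, 402664933056702483, 402664932010567575,
   429684458495592285, 434641797182314539, 86129203671719235, 242149551370493031,
   110548694050544889, 110005895599246737, 114895980801968337, 262621173992144337,
   263618161884526077, 83951273997827865, 354276068522199417, 357072448808884563,
   289175231763295569, 36735418021680027, 288679080538599057, 289676068430980797,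
   110005897294098189]

/-- Codes of the Youden rectangles orthogonal to the one of index 3 in `baseCodes`. -/
def mates₃ : List ℕ :=
  [269085978455959737, 428534265063459753, 51248587796847765, 62908598817620271,
   285466303776284829, 296855717115798675, 404630099088641631, 257620907972976417,
   269722040967994365, 401615590575717891, 241997825343929139, 269722701701546949,
   269637249270744189, 28418299744285593, 269723874780550521, 269723405288791197,
   25153554237146757, 347423937197552469, 251370469633329027, 381379853412736047,
   297386492162319387, 17222093541314559, 445152559941684765, 405327996516611205,
   427365485027340435, 447134358105776007, 405382350594077145, 402133662086660037,
   428180441514286617, 424931753006869509, 28254881856667041, 16856083560270789,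
   269202320101590381, 51187044348691533, 286452443792438289, 288099947511301725,
   63363175633687239, 296944662453569433, 286476281415661689, 247370521118261949,
   51419763513856089, 347683693240801017, 49640141025352251, 50350530281169807, 49639173830813115,
   402104499410128959, 205976943979810083, 444910876257087117, 64271462082132735,
   321529556216251449, 406268878922968995, 380192963185319805, 334598325449878773,
   15221441280164661, 423207507142837161, 445086191009676681, 445143078700070733,
   445558978388465973, 16158570558201837, 428742967986946665, 428772033276163083,
   417348155981785563, 446686121216341863, 171752854961299545, 447184957880809683,
   423873046672419627, 417446235263005875, 49636507287051387, 208325237758247025,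
   47944556426674197, 445341312324054261, 18618956725824549, 423259522929655065,
   178901201042179101, 61038059975482257, 16138018616277015, 447217861646124909,
   285237192662837055, 286936598504218527, 448762880778902757, 50843883894226371,
   242548452185621355, 207869465074625505, 286914463946462223, 298630050101305227,
   211057869073599405, 210833198049978837, 450905163745819059, 288724225159823247,
   243260911741478607, 15283159573339683, 300230281547276679, 222199363290655755,
   171686333090660301, 405315788708646855, 423202759576400367, 448380829315334241,
   206240980558726719, 450009273842848143, 450174040567924887, 289264366763761113,
   28045988522857953, 171346887340713837, 241504745790631383, 165304276946817957,
   219753965006435493, 289231306448987277, 165972173111324829, 411837771590013843,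
   288709691808263247, 243246378389918607, 162712099483998489, 221784976821863439,
   342826472484922095, 221782955987647647, 51946647083249679, 47754405925005267,
   287122263266712501, 17755108507583487, 64271342030453451, 166895028205600707,
   18386229317892273, 165242890802490597, 47977530426591309, 241518280955016483,
   335227937803480125, 381312031159399023, 15362724228025221, 257620645351702071,
   258291405721911735, 251246024602609167, 30343893605312355, 167130635829761259,
   303453405912102255, 17001902874261933, 177799889200704237, 298518154616052747,
   50736786261470973, 289643221660547313, 288546545480512437, 449311853913044625,
   402540680227411809, 296726606976385809, 30344308821339939, 207162475870341249,
   167131051045788843, 217352319143338161, 418336837389740583, 161981316085865625,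
   216834823829980593, 404845766777165643, 428773375885966803, 252253516074180291,
   255529342530535779, 324654711163984935, 450013993762019301, 450215457571077687,
   241504756211777337]

/-- Codes of the Youden rectangles orthogonal to the one of index 4 in `baseCodes`. -/
def mates₄ : List ℕ :=
  [200612780588681757, 218458268596302471, 194565224300522049, 241399798723707255,
   205973493990894387, 378042414202015299, 404520250026245355, 400741191066011427,
   324152758556669457, 403936203999798927, 161435552477316651, 246518348088940461,
   377607742216862859, 218458276223031063, 86933133321805395, 131057095973393025,
   131057096214808773, 86837337765621837, 193847539719217869, 194028696107711145,
   303146195964334263, 144779504758919487, 440152124570005059, 320948995951569141,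
   201025426749642693, 194028699751249869, 164674898701456761, 401105179377445923,
   446235430083035553, 450910409589277605, 164801794534876935, 449703585862315983,
   440152117545046671, 449504852700211695, 287118814107780531, 200689458286893921,
   86125730314204485, 322632567348929631, 342408887217999927, 137504246095405395,
   129131621213884047, 262436230501346961, 141460977884401143, 140133459882372183,
   140530076181727263, 379199854220718555, 321125585878078551, 377937010200995577,
   300231701348621661, 126304642760680233, 162006314095572453, 216897426710913861,
   262844520768515745, 126304401365343477, 125476000326363627, 109268831787904827,
   400679404689254463, 83271865887885195, 241052505032783853, 320893632740207691,
   143399739996499815, 379891637285524983, 223165144184115717, 216899751179972871,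
   301029578111102823, 378585794573649351, 423873959170422015, 402825536700645159,
   423641849703058395, 423643593705202503, 448067988562539663, 322631019647105571,
   379200919164760269, 140906463456976479, 400734313062233391, 406316286498351393,
   87165751645043865, 109267682927601159, 162006795711079245, 448067607842596185,
   322753977721344375, 322955182410012099, 126138477906652473, 104038583027515209,
   355159219809087117, 262440287975856771, 421908951864689055, 379503697993573437,
   141588773383988151, 423769985741554029, 194641048850624541, 194484380652465453,
   347017042467833805, 343760229142140969, 108206266897556307, 264182656041983907,
   379800780504713145, 320846157983609325, 322341636804485085, 85418638202702655,
   323105747942067759, 400969679974026741, 83100159149730993, 405314183109517623,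
   423636581094924915, 357353132149045701, 437118825102507279, 325588775116509279,
   346997068251904557, 194484382608497517, 380150445933911601, 379569789235001943,
   114696850031108307, 355044190962364047, 126108742279047057, 404244892428326955,
   118656408500500491, 405857032632908001, 195494348587475691, 428655198690828009,
   242723682658529847, 321657034984495803, 423302682533772501, 86120000061620355,
   323286126724855971, 85541087147486787, 85422699672118569, 288757390984420293,
   161530293839297913, 439754551154655903, 263617115835888603, 200625985331733015,
   200379104736034761, 325596216922943391, 324200434080536739, 323972453997534879,
   322576671155128227, 129428330618921283, 86119719240869361, 84723936398462709,
   84495956315460849, 83100173473054197, 434869283827074465, 405854425582837335,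
   357073403306818365, 402540679623872439, 107688629328054543, 195732314922196611,
   109250575089145839, 355312086224137587, 110647188650297025, 380323319886397971,
   379870806683184165, 321243607489181985, 141728211469716129, 402067528196347593,
   83728267963741197, 109783135558657413, 243317809459370799, 403936425457217631,
   437133027738886695, 303329941228610883, 297811087675349751, 221536758389603481,
   195249525142649697, 342878015018170827, 265341844073518281, 437251042184557635,
   427247920110239703, 427484293870635315, 126304454711694321]

/-- Codes of the Youden rectangles orthogonal to the one of index 5 in `baseCodes`. -/
def mates₅ : List ℕ :=
  [202143911789496231, 202142640944153079, 202143914331751863, 142506890297876673,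
   221683604119074351, 224126967757664295, 130493132724649599, 143516094143112819,
   131173782669157167, 210151789278099741, 201425734589377671, 202011368187836475,
   48688357599751095, 51911273924186301, 48707444435030397, 213536595363988437,
   207111762413405649, 86208183871688475, 207125367441991245, 64953446254110549,
   59004159834748851, 54038804055487155, 130478696388907785, 86356090060847469,
   213394664378401893, 241128145712569635, 165954702817902861, 36593605460928357,
   245939657722301349, 62332473193414461, 62633923346606859, 203373542852102835,
   302934078221181885, 62664401354076027, 167132653982834535, 195625481289050115,
   447663921885349479, 37356025442063967, 54489422501299179, 210963681988127217,
   211533398880449697, 88774275813314499, 50933566144164951, 51383616289250373,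
   122271325767975267, 435618785170434987, 201197861455184883, 195730413752962755,
   210835797930570465, 211200903399181887, 201972888019780425, 210833186167930293,
   293168342217229047, 298122552408869505, 123136923144449223, 142504537073226813,
   195731894165371965, 36192211234395309, 211067852471860617, 111576827048695263,
   86518508516145387, 402338120616823401, 87211652238004563, 400677830563315455,
   86518421473451103, 300664037531016351, 61282297863768159, 268900831470463965,
   55239176038941261, 299532113502258465, 446273438903347527, 110878644269016081,
   299850193952720631, 300761718014737143, 129683615842038303, 129778290246493143,
   406383426613086345, 129683619231712479, 109316018307525291, 207028987819542171,
   405547491648809583, 64415957777017227, 64418615281571211, 65011884176908413,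
   400679404689254463, 166866321474538983, 400700475008100207, 405519443591904351,
   30210462463546179, 110013978835043433, 110612171585253033, 87206917693348071,
   64415881791177129, 406382737327665129, 109150423489524609, 299847539875555899,
   64415964838898277, 299847540116971647, 241360517850438843, 405776296404664587,
   61154113695209307, 58945081623722703, 86516556891473691, 223862831784736371,
   223995708603691461, 298322166969548865, 299964422034130311, 402323939353055457,
   288584665485310323, 400910529148071183, 54181493800240509, 87809671145605923,
   241351277713793649, 403719334673362641, 29756381394586059, 49305728442700215,
   24878658235868433, 269034062570354511, 87344894316446343, 31772422058546025,
   406511504049387789, 406514153828637837, 61085710052569359, 405550398842189037,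
   405550398319121583, 88769541675865095, 298366967366310321, 402356798563158225,
   447868210264119837, 140797776038896539, 110871252856185867, 31784546691154485,
   62724302230693023, 31981538952515331, 123135410029130307, 118393545197551383,
   141884561523417633, 141189978261623967, 61285128037877223, 43338396211669143,
   165470966496267597, 25557659253425457, 32084794214432145, 31917202919339049,
   300011891314654089, 241389003242607777, 300610084050083133, 241389003219498495,
   142649321639732793, 168103982756973015, 61696877321408067, 221767443257345703,
   168729608696319423, 168042595480216965, 108611429100240105, 142639743279526497,
   264184824760170381, 31905576071736777, 404591529289926339, 404617019086146087,
   43779587241234807, 248555107953619191, 36268828495044975, 85585949511293907, 43318826070647229,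
   299031444910966401, 31914849664797705, 434935776746530665, 298151254779195591,
   402367648850184861, 248487006823498503, 427476238245184671, 142646964476890689,
   165311060143208949, 300664030559575491, 111768547916714301, 201968254555884009,
   270361044334060425, 85514738411909601, 241386677906358177, 299679956568476775,
   219220879281306039, 84724517732494329, 84752920053830781, 110612171587488345,
   406980927292919481, 110142166993011081, 436635469888600743, 110237327555877387,
   129778290246559491, 406980927309811545, 37305571232891799, 110142665279337969,
   84899603922190083, 30221922706990047, 439881524297261919, 288100275972754635,
   51249192393529233, 429175822508383725, 30212456393117871, 429308451958747023,
   447933304682603577, 25956989594720469, 165911879004380073, 403763349128412537,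
   446395683922018731, 288678952246461579, 30753370429833987, 86120000061620355,
   400972178265078915, 84494976743185209, 25569118770269121, 446501320724269179,
   288679080588811155, 131706109404719883, 244080557863594443, 449259244619596353,
   50285028301814115, 400969071172108143, 210387524328350829, 448780124993096475,
   424903455349282467, 38370755151950247, 244149366312441693, 110014191480136851,
   435107166317739207, 435107169145400337, 427396436992510263, 440646362231001939,
   450215456121877311, 165214070250819273, 427476625801233111, 269033648461234893,
   87282865919178333, 264846301918715151, 269719226169210081, 435163808819300013,
   435154110986116737, 207111333236727393, 84723935875395255, 121508481513633255,
   437944501729939959, 436270287339037521, 213394401391994325, 288348841104314157,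
   200504717491013235, 131278921929101043, 265319414266171887, 299751058174466331,
   55216213071117237, 208273471362648243, 426691238633675091, 61797752762035779,
   167576848878114927, 130091343424628697, 130090234616409465, 88081042361518611,
   109010707013863647, 32385770820560205, 270191998106562573, 441111609700954317,
   302990906130040575, 265319005548549231, 247608714948701931, 270185151580583553,
   436269838401008289, 441139416889286583, 300082810657487535, 118165665351999159,
   441102737465036163, 121403300718223719, 121981161704007591, 109148095611729369,
   270463454462577375, 288107302848537591, 30817955336661639, 289730705896951857,
   288679160024357031, 118790974938997395, 202307285727084663, 109148097306580821,
   111576827066364351, 131713325239190967, 85585949511326739, 84723935876101143,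
   84721893337929231, 28415537033087637]

/-- Triples starting with the rectangle of index 0 in `baseCodes`, with transformations to
representatives. -/
def triples₀ : List (ℕ × ℕ × ℕ) :=
  [(342829570655565675, 164804659137410193, 171560710911)]

/-- Triples starting with the rectangle of index 1 in `baseCodes`, with transformations to
representatives. -/
def triples₁ : List (ℕ × ℕ × ℕ) :=
  [(324786688808339025, 447225668081002017, 171560710912),
   (377669469252078405, 403121934863006769, 171560710913),
   (377669469252078405, 165469366689864255, 171560710914),
   (64548731354899473, 403121934863006769, 171560710915),
   (64548731354899473, 210152869008736491, 171560710916),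
   (61389654871400181, 210152869008736491, 171560710917),
   (61389654871400181, 346963349202144057, 171560710918),
   (403353203010498297, 210152869008736491, 171560710919),
   (403353203010498297, 346963349202144057, 162263019983),
   (403121934863006769, 252322059272661027, 157474030548),
   (165469366689864255, 379297564747436529, 171560710920)]

/-- Triples starting with the rectangle of index 2 in `baseCodes`, with transformations to
representatives. -/
def triples₂ : List (ℕ × ℕ × ℕ) :=
  [(246324416380857621, 61266524503380165, 171560710921),
   (355309520540135877, 403134948496972737, 171560710922),
   (131741810805908151, 403134948496972737, 168409458157),
   (87305122448211699, 288679080538599057, 40084265988),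
   (347689130494476537, 49305674208185631, 171560710923),
   (356433848300053647, 110005895599246737, 13321101430),
   (356434977341513403, 289175231763295569, 126744774141)]

/-- Triples starting with the rectangle of index 3 in `baseCodes`, with transformations to
representatives. -/
def triples₃ : List (ℕ × ℕ × ℕ) :=
  [(445152559941684765, 242548452185621355, 171560710924),
   (269202320101590381, 216834823829980593, 171560710925),
   (286452443792438289, 15362724228025221, 171560710926),
   (347683693240801017, 16158570558201837, 158726243846),
   (347683693240801017, 417348155981785563, 41092131170),
   (347683693240801017, 417446235263005875, 171560710927),
   (347683693240801017, 251246024602609167, 77787855038),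
   (347683693240801017, 216834823829980593, 171560710928),
   (402104499410128959, 381312031159399023, 148918059627),
   (402104499410128959, 15362724228025221, 148918059628),
   (417446235263005875, 210833198049978837, 171560710929),
   (242548452185621355, 381312031159399023, 171560710930),
   (242548452185621355, 216834823829980593, 44515801645),
   (211057869073599405, 335227937803480125, 120451656163),
   (211057869073599405, 15362724228025221, 120451655789),
   (210833198049978837, 335227937803480125, 96133926511),
   (448380829315334241, 216834823829980593, 44515801648)]

/-- Triples starting with the rectangle of index 4 in `baseCodes`, with transformations to
representatives. -/
def triples₄ : List (ℕ × ℕ × ℕ) :=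
  [(400741191066011427, 137504246095405395, 171560710931),
   (400741191066011427, 126108742279047057, 149805102778),
   (400741191066011427, 263617115835888603, 171560710932),
   (320948995951569141, 137504246095405395, 131405137470),
   (320948995951569141, 126108742279047057, 131405137468),
   (320948995951569141, 263617115835888603, 131405137467),
   (164801794534876935, 137504246095405395, 44825679326),
   (164801794534876935, 263617115835888603, 119509327714),
   (164801794534876935, 437133027738886695, 171560710933),
   (164801794534876935, 297811087675349751, 137922006199),
   (321125585878078551, 263617115835888603, 21204762591),
   (321125585878078551, 437133027738886695, 171560710934),
   (321125585878078551, 297811087675349751, 137922006198),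
   (262844520768515745, 86119719240869361, 43691749632),
   (322753977721344375, 421908951864689055, 169440701183),
   (421908951864689055, 86119719240869361, 70410998877),
   (86119719240869361, 437133027738886695, 70410999317)]

/-- Triples starting with the rectangle of index 5 in `baseCodes`, with transformations to
representatives. -/
def triples₅ : List (ℕ × ℕ × ℕ) :=
  [(202143914331751863, 427476238245184671, 153944827651),
   (48688357599751095, 86518508516145387, 171560710935),
   (48688357599751095, 406383426613086345, 171560710936),
   (48688357599751095, 109150423489524609, 125177619376),
   (48688357599751095, 223995708603691461, 136450098185),
   (48688357599751095, 402356798563158225, 165839645705),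
   (48688357599751095, 118393545197551383, 11669227529),
   (48688357599751095, 248555107953619191, 44533838345),
   (48688357599751095, 142646964476890689, 102838535177),
   (48688357599751095, 300664030559575491, 171560710937),
   (48688357599751095, 84899603922190083, 143644407292),
   (48688357599751095, 427396436992510263, 171560710938),
   (48688357599751095, 269033648461234893, 81831308297),
   (48688357599751095, 299751058174466331, 74455637513),
   (48688357599751095, 202307285727084663, 171560710939),
   (51911273924186301, 402338120616823401, 52607567379),
   (51911273924186301, 269034062570354511, 71627209259),
   (51911273924186301, 429175822508383725, 92814454751),
   (51911273924186301, 435107169145400337, 52607567378),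
   (51911273924186301, 118165665351999159, 49147873475),
   (48707444435030397, 87211652238004563, 47884155411),
   (48707444435030397, 110871252856185867, 19370065091),
   (48707444435030397, 440646362231001939, 38616036395),
   (48707444435030397, 165214070250819273, 109716658655),
   (48707444435030397, 427476625801233111, 47884155410),
   (207111762413405649, 86518508516145387, 125177679330),
   (207111762413405649, 406383426613086345, 62226683216),
   (207111762413405649, 84899603922190083, 171560710940),
   (207111762413405649, 32385770820560205, 34310329356),
   (86208183871688475, 300664030559575491, 93273395688),
   (86208183871688475, 300082810657487535, 108182756544),
   (86208183871688475, 288679160024357031, 41554991157),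
   (59004159834748851, 439881524297261919, 138182979262),
   (59004159834748851, 200504717491013235, 93950961041),
   (54038804055487155, 86516556891473691, 162448108563),
   (54038804055487155, 244149366312441693, 160886067755),
   (54038804055487155, 264846301918715151, 140549880515),
   (54038804055487155, 265319414266171887, 26726541791),
   (54038804055487155, 265319005548549231, 162448108562),
   (86356090060847469, 427476238245184671, 164316021367),
   (86356090060847469, 427476625801233111, 164316020989),
   (165954702817902861, 31981538952515331, 104906966647),
   (165954702817902861, 31905576071736777, 104906966269),
   (36593605460928357, 447868210264119837, 76492040747),
   (36593605460928357, 141189978261623967, 169494689759),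
   (36593605460928357, 447933304682603577, 107453855939),
   (36593605460928357, 449259244619596353, 85704877586),
   (36593605460928357, 87282865919178333, 85704877587),
   (62332473193414461, 208273471362648243, 56117375005),
   (62633923346606859, 86518508516145387, 118942361485),
   (62633923346606859, 446395683922018731, 141584761535),
   (62633923346606859, 208273471362648243, 19007574810),
   (203373542852102835, 87344894316446343, 157473897899),
   (302934078221181885, 208273471362648243, 162768172801),
   (62664401354076027, 111768547916714301, 62094145451),
   (447663921885349479, 268900831470463965, 143767875603),
   (447663921885349479, 108611429100240105, 130964268587),
   (447663921885349479, 142639743279526497, 85933661891),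
   (447663921885349479, 31905576071736777, 143767875602),
   (447663921885349479, 248487006823498503, 22517382623),
   (37356025442063967, 86518508516145387, 143644437114),
   (37356025442063967, 406383426613086345, 125177619380),
   (37356025442063967, 109150423489524609, 34310422259),
   (37356025442063967, 210387524328350829, 80693383251),
   (54489422501299179, 300664030559575491, 170016626664),
   (54489422501299179, 439881524297261919, 138182979264),
   (54489422501299179, 200504717491013235, 121962273333),
   (435618785170434987, 109150423489524609, 62226635635),
   (435618785170434987, 210387524328350829, 171560710941),
   (435618785170434987, 55216213071117237, 62226550075),
   (435618785170434987, 32385770820560205, 125177619195),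
   (210835797930570465, 86518508516145387, 157186056589),
   (210835797930570465, 25956989594720469, 106197851418),
   (210835797930570465, 441102737465036163, 49615790783),
   (211200903399181887, 110612171587488345, 32763726533),
   (211200903399181887, 441102737465036163, 49615790975),
   (201972888019780425, 87809671145605923, 148432188305),
   (201972888019780425, 87344894316446343, 171560557246),
   (123136923144449223, 207028987819542171, 9500328563),
   (123136923144449223, 49305728442700215, 34026367827),
   (123136923144449223, 427396436992510263, 9500328564),
   (111576827048695263, 435107166317739207, 19909978231),
   (111576827048695263, 435107169145400337, 19909977853),
   (86518508516145387, 31905576071736777, 42631102799),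
   (86518508516145387, 300664030559575491, 125177679581),
   (86518508516145387, 449259244619596353, 9178958159),
   (86518508516145387, 435107169145400337, 127408248143),
   (86518508516145387, 427396436992510263, 125177679579),
   (86518508516145387, 427476625801233111, 97945419599),
   (86518508516145387, 55216213071117237, 171560620478),
   (86518508516145387, 265319005548549231, 64326142799),
   (86518508516145387, 202307285727084663, 125177679580),
   (86518421473451103, 208273471362648243, 19007574811),
   (300664037531016351, 110014191480136851, 23563743998),
   (300664037531016351, 111576827066364351, 23563743996),
   (300664037531016351, 28415537033087637, 10402739379),
   (61282297863768159, 110014191480136851, 126775679603),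
   (61282297863768159, 427396436992510263, 126775679604),
   (61282297863768159, 111576827066364351, 152687630163),
   (129778290246493143, 302990906130040575, 96142812931),
   (406383426613086345, 210387524328350829, 80693501640),
   (207028987819542171, 300664030559575491, 110751562728),
   (207028987819542171, 111768547916714301, 57163736256),
   (109150423489524609, 55216213071117237, 143644407110),
   (64415964838898277, 244080557863594443, 65628337411),
   (405776296404664587, 298151254779195591, 156183225909),
   (405776296404664587, 300664030559575491, 55622376936),
   (405776296404664587, 299679956568476775, 28260157632),
   (223862831784736371, 25956989594720469, 122624373865),
   (402323939353055457, 25956989594720469, 140231134237),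
   (87809671145605923, 427396436992510263, 97364276340),
   (87809671145605923, 426691238633675091, 97364276339),
   (49305728442700215, 111768547916714301, 57163736254),
   (24878658235868433, 244080557863594443, 53887946359),
   (24878658235868433, 449259244619596353, 53887945981),
   (87344894316446343, 426691238633675091, 171560557310),
   (405550398842189037, 31981538952515331, 113045016835),
   (140797776038896539, 241389003242607777, 149218844357),
   (140797776038896539, 446395683922018731, 141584761727),
   (62724302230693023, 208273471362648243, 16408029289),
   (141884561523417633, 25956989594720469, 106197851419),
   (165470966496267597, 300082810657487535, 108182756542),
   (165470966496267597, 288679160024357031, 67478512529),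
   (168103982756973015, 37305571232891799, 64277251187),
   (168103982756973015, 288100275972754635, 114884906835),
   (168103982756973015, 427396436992510263, 64277251188),
   (264184824760170381, 439881524297261919, 128056066475),
   (404617019086146087, 25956989594720469, 52394094337),
   (298151254779195591, 427396436992510263, 156183225972),
   (298151254779195591, 441139416889286583, 6157722963),
   (165311060143208949, 37305571232891799, 90703303934),
   (165311060143208949, 288100275972754635, 90703303932),
   (165311060143208949, 448780124993096475, 99673168563),
   (300664030559575491, 37305571232891799, 137162300656),
   (300664030559575491, 110014191480136851, 27743446768),
   (300664030559575491, 427396436992510263, 62226708265),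
   (300664030559575491, 426691238633675091, 23048318704),
   (300664030559575491, 202307285727084663, 80693526376),
   (299679956568476775, 424903455349282467, 39823142067),
   (299679956568476775, 441139416889286583, 28260157692),
   (84899603922190083, 55216213071117237, 80693398251),
   (84899603922190083, 32385770820560205, 34310367393),
   (51249192393529233, 302990906130040575, 83395772023),
   (51249192393529233, 265319005548549231, 83395771645),
   (210387524328350829, 32385770820560205, 143644407297),
   (435107166317739207, 84721893337929231, 6873669317),
   (427396436992510263, 200504717491013235, 121962273334),
   (427396436992510263, 288679160024357031, 41554991158),
   (427396436992510263, 202307285727084663, 34310495019),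
   (450215456121877311, 300082810657487535, 120094147499)]

theorem baseCheck₀ : baseCheck baseCodes 114381 baseList₀ = true := by
  decide +kernel

theorem baseCheck₁ : baseCheck baseCodes 690621 baseList₁ = true := by
  decide +kernel

theorem baseCheck₂ : baseCheck baseCodes 583605 baseList₂ = true := by
  decide +kernel

theorem baseCheck₃ : baseCheck baseCodes 697677 baseList₃ = true := by
  decide +kernel

theorem mateCheck₀ : mateCheck 122341460985599031 mates₀ = true := by
  decide +kernel

theorem mateCheck₁ : mateCheck 122628962034229239 mates₁ = true := by
  decide +kernel

theorem mateCheck₂ : mateCheck 179257780813145679 mates₂ = true := by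
  decide +kernel

theorem mateCheck₃ : mateCheck 122341803152185863 mates₃ = true := by
  decide +kernel

theorem mateCheck₄ : mateCheck 20572627389198543 mates₄ = true := by
  decide +kernel

theorem mateCheck₅ : mateCheck 331062236653339647 mates₅ = true := by
  decide +kernel

theorem pairCheck₀ : pairCheck repCodes 122341460985599031 mates₀ triples₀ = true := by
  decide +kernel

theorem pairCheck₁ : pairCheck repCodes 122628962034229239 mates₁ triples₁ = true := by
  decide +kernel

theorem pairCheck₂ : pairCheck repCodes 179257780813145679 mates₂ triples₂ = true := by
  decide +kernel

theorem pairCheck₃ : pairCheck repCodes 122341803152185863 mates₃ triples₃ = true := by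
  decide +kernel

theorem pairCheck₄ : pairCheck repCodes 20572627389198543 mates₄ triples₄ = true := by
  decide +kernel

theorem pairCheck₅ : pairCheck repCodes 331062236653339647 mates₅ triples₅ = true := by
  decide +kernel

theorem isInverse_repCodes :
    (allBelow 93 fun n => isInverse (nth repCodes n) (nth inverseCodes n)) = true := by
  decide +kernel

theorem isValid_repCodes : (allBelow 93 fun n => isValid (nth repCodes n)) = true := by
  decide +kernel

theorem isOrthogonal_repCodes :
    (allBelow 31 fun n => force (nth repCodes (Nat.mul 3 n)) fun x =>
      force (nth repCodes (Nat.add (Nat.mul 3 n) 1)) fun y =>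
      force (nth repCodes (Nat.add (Nat.mul 3 n) 2)) fun z =>
      isOrthogonal x y && isOrthogonal x z && isOrthogonal y z) = true := by
  decide +kernel

theorem injBelow_invariantCode :
    injBelow 31 (invariantCode repCodes inverseCodes) 0 = true := by
  decide +kernel

/-! ### Normalized rectangles and their mates -/

theorem exists_base {N : Fin 4 → Fin 7 → Fin 7} (hN : ∀ j, N 0 j = j) (hL : IsLatinRectangle N)
    (hY : IsYouden N 2) {t : ℕ} (ht : t ∈ derangements) (h1 : ∀ j, (N 1 j : ℕ) = digit 7 t j)
    (h23 : N 2 0 ≤ N 3 0) :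
    ∃ x ∈ baseCodes, ∃ (σ : Equiv.Perm (Fin 4)) (τ : Equiv.Perm (Fin 7)),
      ∀ i j, N (σ i) (τ j) = N (σ 0) (τ (rect x i j)) := by
  have hc : ∃ l, baseCheck baseCodes t l = true := by
    simp only [derangements, List.mem_cons, List.not_mem_nil, or_false] at ht
    rcases ht with rfl | rfl | rfl | rfl
    exacts [⟨_, baseCheck₀⟩, ⟨_, baseCheck₁⟩, ⟨_, baseCheck₂⟩, ⟨_, baseCheck₃⟩]
  obtain ⟨l, hl⟩ := hc
  have hne : ∀ (i i' : Fin 4) (j : Fin 7), i ≠ i' → (N i j : ℕ) ≠ N i' j := fun i i' j hi e =>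
    hi (hL.2 j (Fin.ext e))
  have key := searchAll_sound hl hN hY (fun j => ?_) (fun j x hx => ?_) (fun j j' hj x hx hx' => ?_)
  · simp only [force_eq] at key
    obtain ⟨p, -, hp⟩ := anyMem_iff.1 key
    simp only [validBase, force_eq, Bool.and_eq_true, Nat.beq_eq] at hp
    obtain ⟨hp1, ⟨hr, hq⟩, htr⟩ := hp
    obtain ⟨σ, hσ⟩ := exists_perm hr
    obtain ⟨τ, hτ⟩ := exists_perm hq
    have hk : Nat.mod p.2 6 < baseCodes.length := Nat.mod_lt _ (by decide)
    refine ⟨_, nth_mem hk, σ, τ, fun i j => ?_⟩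
    have := transforms_sound htr hσ hτ i j
    rwa [hp1, rect_encode hN] at this
  · have h0 : (N 0 j : ℕ) = j := congrArg Fin.val (hN j)
    have a1 := hne 1 2 j (by decide)
    have a2 := hne 1 3 j (by decide)
    have a3 := hne 2 3 j (by decide)
    have a4 := hne 2 0 j (by decide)
    have a5 := hne 3 0 j (by decide)
    rw [h0] at a4 a5
    simp only [okBase, Bool.and_eq_true, Bool.or_eq_true, differ_iff, Nat.beq_eq, Nat.ble_eq]
    refine ⟨⟨⟨⟨⟨⟨h1 j, a1⟩, a2⟩, a3⟩, a4⟩, a5⟩, ?_⟩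
    by_cases hj : j = 0
    · subst hj; exact Or.inr h23
    · exact Or.inl fun e => hj (Fin.ext e)
  · have := (N 1 j).2; have := (N 2 j).2; have := (N 3 j).2
    simp only [rowFeatures, List.mem_cons, List.not_mem_nil, or_false, Nat.add_eq] at hx
    omega
  · have b1 : (N 1 j : ℕ) ≠ N 1 j' := fun e => hj (hL.1 1 (Fin.ext e))
    have b2 : (N 2 j : ℕ) ≠ N 2 j' := fun e => hj (hL.1 2 (Fin.ext e))
    have b3 : (N 3 j : ℕ) ≠ N 3 j' := fun e => hj (hL.1 3 (Fin.ext e))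
    simp only [rowFeatures, List.mem_cons, List.not_mem_nil, or_false, Nat.add_eq] at hx hx'
    omega

theorem encode_mem_of_mateCheck {N : Fin 4 → Fin 7 → Fin 7} (hN : ∀ j, N 0 j = j)
    (hL : IsLatinRectangle N) (hY : IsYouden N 2) {x : ℕ} (hO : Orthogonal (rect x) N)
    {l : List ℕ} (h : mateCheck x l = true) : encode N ∈ l := by
  have hne : ∀ (i i' : Fin 4) (j : Fin 7), i ≠ i' → (N i j : ℕ) ≠ N i' j := fun i i' j hi e =>
    hi (hL.2 j (Fin.ext e))
  have hm : ∀ (i : Fin 4) (j : Fin 7), i ≠ 0 → (N i j : ℕ) ≠ cell x i j := fun i j hi e =>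
    Orthogonal.ne hO (fun _ => rfl) hN hi j (Fin.ext e.symm)
  have hp : ∀ (i i' : Fin 4) (j j' : Fin 7), j ≠ j' → (N i j : ℕ) = N i' j' →
      cell x i j ≠ cell x i' j' := fun i i' j j' hj e e' =>
    hj (congrArg Prod.snd (@hO (i, j) (i', j') (Prod.ext (Fin.ext e') (Fin.ext e))))
  have key := searchAll_sound h hN hY (fun j => ?_) (fun j y hy => ?_) (fun j j' hj y hy hy' => ?_)
  · simp only [force_eq] at key
    obtain ⟨p, hpl, e⟩ := anyMem_iff.1 key
    rw [Nat.beq_eq] at e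
    exact e ▸ hpl
  · have h0 : (N 0 j : ℕ) = j := congrArg Fin.val (hN j)
    have a1 := hne 1 0 j (by decide)
    have a2 := hne 2 0 j (by decide)
    have a3 := hne 3 0 j (by decide)
    rw [h0] at a1 a2 a3
    simp only [okMate, Bool.and_eq_true, differ_iff]
    exact ⟨⟨⟨⟨⟨⟨⟨⟨hne 1 2 j (by decide), hne 1 3 j (by decide)⟩, hne 2 3 j (by decide)⟩, a1⟩, a2⟩,
      a3⟩, hm 1 j (by decide)⟩, hm 2 j (by decide)⟩, hm 3 j (by decide)⟩
  · have := (N 1 j).2; have := (N 2 j).2; have := (N 3 j).2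
    have := cell_lt x 1 j.2; have := cell_lt x 2 j.2; have := cell_lt x 3 j.2
    simp only [mateFeatures, List.mem_cons, List.not_mem_nil, or_false, Nat.add_eq, Nat.mul_eq]
      at hy
    omega
  · have b1 : (N 1 j : ℕ) ≠ N 1 j' := fun e => hj (hL.1 1 (Fin.ext e))
    have b2 : (N 2 j : ℕ) ≠ N 2 j' := fun e => hj (hL.1 2 (Fin.ext e))
    have b3 : (N 3 j : ℕ) ≠ N 3 j' := fun e => hj (hL.1 3 (Fin.ext e))
    have key : ∀ j : Fin 7, y ∈ mateFeatures x j (N 1 j) (N 2 j) (N 3 j) →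
        (y < 21 ∧ (y = N 1 j ∨ y = 7 + N 2 j ∨ y = 14 + N 3 j)) ∨
        ∃ i : Fin 4, y = 21 + (7 * cell x i j + N i j) := by
      intro j hy
      have := (N 1 j).2; have := (N 2 j).2; have := (N 3 j).2
      simp only [mateFeatures, List.mem_cons, List.not_mem_nil, or_false, Nat.add_eq, Nat.mul_eq]
        at hy
      rcases hy with hy | hy | hy | hy | hy | hy
      · exact Or.inl ⟨by omega, Or.inl hy⟩
      · exact Or.inl ⟨by omega, Or.inr (Or.inl hy)⟩
      · exact Or.inl ⟨by omega, Or.inr (Or.inr hy)⟩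
      exacts [Or.inr ⟨1, hy⟩, Or.inr ⟨2, hy⟩, Or.inr ⟨3, hy⟩]
    have := (N 1 j).2; have := (N 2 j).2; have := (N 3 j).2
    have := (N 1 j').2; have := (N 2 j').2; have := (N 3 j').2
    rcases key j hy with ⟨h1, h2⟩ | ⟨i, h1⟩ <;> rcases key j' hy' with ⟨h3, h4⟩ | ⟨i', h3⟩
    · clear hO hm hp hne key hY hL h hN hy hy'
      omega
    · omega
    · omega
    · have := (N i j).2; have := (N i' j').2
      exact hp i i' j j' hj (by omega) (by omega)

/-! ### Triples -/

/-- The triple of rectangles with codes `x`, `y`, `z`. -/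
def triple (x y z : ℕ) (s : Fin 3) : Fin 4 → Fin 7 → Fin 7 := rect (nth [x, y, z] s)

/-- The representative triples. -/
def reps (a : Fin 31) (s : Fin 3) : Fin 4 → Fin 7 → Fin 7 := rect (nth repCodes (3 * a + s))

theorem allPairs_iff {α : Type} {l : List α} {p : α → α → Bool} :
    allPairs l p = true ↔ l.Pairwise fun x y => p x y = true := by
  induction l with
  | nil => simp [allPairs]
  | cons x l ih =>
    have : allPairs (x :: l) p = (allMem l (p x) && allPairs l p) := by
      simp only [allPairs]; cases allMem l (p x) <;> rfl
    rw [this, Bool.and_eq_true, ih, allMem_iff, List.pairwise_cons]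

theorem withMasks_eq (l : List ℕ) (k : List (ℕ × ℕ) → Bool) :
    withMasks l k = k (l.map fun x => (x, entryMask x)) := by
  induction l generalizing k with
  | nil => rfl
  | cons x l ih =>
    have : withMasks (x :: l) k =
      force (entryMask x) fun m => withMasks l fun L => k ((x, m) :: L) := rfl
    rw [this, force_eq, ih, List.map_cons]

theorem isotopic_of_validTriple {x y z t : ℕ} (hM : IsMOLRTriple (triple x y z))
    (h : validTriple repCodes x y z t = true) : ∃ a, Isotopic (triple x y z) (reps a) := by
  simp only [validTriple, force_eq, Bool.and_eq_true] at h
  obtain ⟨⟨⟨hρ, hr⟩, hq⟩, h⟩ := h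
  obtain ⟨ρ, hρ⟩ := exists_perm hρ
  obtain ⟨σ, hσ⟩ := exists_perm hr
  obtain ⟨τ, hτ⟩ := exists_perm hq
  refine ⟨⟨Nat.mod t 31, Nat.mod_lt _ (by norm_num)⟩,
    isotopic_of_normalized hM (ρ := ρ) (r := σ) (c := τ) fun s i j => ?_⟩
  have := transforms_sound (allBelow_iff.1 h s s.2) hσ hτ i j
  simp only [triple, hρ]
  exact this

theorem Isotopic.triple_swap (x y z : ℕ) : Isotopic (triple x y z) (triple x z y) := by
  refine ⟨Equiv.swap 1 2, 1, 1, fun _ => 1, fun s i j => ?_⟩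
  fin_cases s <;> rfl

theorem exists_isotopic_of_pairCheck {x : ℕ} {l : List ℕ} {certs : List (ℕ × ℕ × ℕ)}
    (h : pairCheck repCodes x l certs = true) {y z : ℕ} (hy : y ∈ l) (hz : z ∈ l)
    (hM : IsMOLRTriple (triple x y z)) : ∃ a, Isotopic (triple x y z) (reps a) := by
  rw [pairCheck, withMasks_eq, allPairs_iff, List.pairwise_map] at h
  have key : ∀ y ∈ l, ∀ z ∈ l, IsMOLRTriple (triple x y z) →
      ∃ a, Isotopic (triple x y z) (reps a) := by
    have h' : l.Pairwise fun y z => IsMOLRTriple (triple x y z) →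
        ∃ a, Isotopic (triple x y z) (reps a) := by
      refine h.imp fun {y z} h hM => ?_
      have hO : Orthogonal (rect y) (rect z) := hM.2 1 2 (by decide)
      simp only [land_entryMask hO, isOrthogonal_iff.2 hO] at h
      obtain ⟨c, -, hc⟩ := anyMem_iff.1 h
      simp only [Bool.and_eq_true, Nat.beq_eq] at hc
      obtain ⟨⟨rfl, rfl⟩, hc⟩ := hc
      exact isotopic_of_validTriple hM hc
    intro y hy z hz
    have : Std.Symm fun y z => IsMOLRTriple (triple x y z) →
        ∃ a, Isotopic (triple x y z) (reps a) := ⟨fun y z h hM => by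
      have hs := Isotopic.triple_swap x z y
      obtain ⟨a, ha⟩ := h (Isotopic.isMOLRTriple hs hM)
      exact ⟨a, Isotopic.trans hs ha⟩⟩
    refine List.Pairwise.forall_of_forall (R := fun y z => IsMOLRTriple (triple x y z) →
        ∃ a, Isotopic (triple x y z) (reps a)) (fun y _ hM => ?_) h' hy hz
    have hO : Orthogonal (rect y) (rect y) := hM.2 1 2 (by decide)
    exact absurd rfl (Orthogonal.ne hO (fun _ => rfl) (fun _ => rfl) (i := 1) (by decide) 0)
  exact key y hy z hz hM

theorem exists_isotopic_of_base {N : Fin 3 → Fin 4 → Fin 7 → Fin 7} (hM : IsMOLRTriple N)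
    (hY : ∀ s, IsYouden (N s) 2) (hN : ∀ s j, N s 0 j = j) {x : ℕ} (hx : x ∈ baseCodes)
    (h0 : N 0 = rect x) : ∃ a, Isotopic N (reps a) := by
  have hc : ∃ l certs, mateCheck x l = true ∧ pairCheck repCodes x l certs = true := by
    simp only [baseCodes, List.mem_cons, List.not_mem_nil, or_false] at hx
    rcases hx with rfl | rfl | rfl | rfl | rfl | rfl
    exacts [⟨_, _, mateCheck₀, pairCheck₀⟩, ⟨_, _, mateCheck₁, pairCheck₁⟩,
      ⟨_, _, mateCheck₂, pairCheck₂⟩, ⟨_, _, mateCheck₃, pairCheck₃⟩,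
      ⟨_, _, mateCheck₄, pairCheck₄⟩, ⟨_, _, mateCheck₅, pairCheck₅⟩]
  obtain ⟨l, certs, hl, hc⟩ := hc
  have h1 := encode_mem_of_mateCheck (hN 1) (hM.1 1) (hY 1) (h0 ▸ hM.2 0 1 (by decide)) hl
  have h2 := encode_mem_of_mateCheck (hN 2) (hM.1 2) (hY 2) (h0 ▸ hM.2 0 2 (by decide)) hl
  have e : N = triple x (encode (N 1)) (encode (N 2)) := by
    funext s
    fin_cases s
    exacts [h0, (rect_encode (hN 1)).symm, (rect_encode (hN 2)).symm]
  rw [e] at hM ⊢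
  exact exists_isotopic_of_pairCheck hc h1 h2 hM

theorem exists_isotopic_reps {M : Fin 3 → Fin 4 → Fin 7 → Fin 7} (hM : IsMOLRTriple M)
    (hY : ∀ s, IsYouden (M s) 2) : ∃ a, Isotopic M (reps a) := by
  suffices key : ∃ t ∈ derangements, ∃ N, Isotopic M N ∧ (∀ s j, N s 0 j = j) ∧
      (∀ j, (N 0 1 j : ℕ) = digit 7 t j) ∧ N 0 2 0 ≤ N 0 3 0 by
    obtain ⟨t, ht, N, hMN, hN, h1, h23⟩ := key
    have hNM := Isotopic.isMOLRTriple hMN hM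
    have hNY := Isotopic.isYouden hMN hY
    obtain ⟨x, hx, σ, τ, hx'⟩ := exists_base (hN 0) (hNM.1 0) (hNY 0) ht h1 h23
    obtain ⟨N', hNN', hN', e⟩ := exists_normalized hNM σ τ
    have h0 : N' 0 = rect x := by
      funext i j
      exact τ.injective ((hNM.1 0).1 _ ((e 0 i j).symm.trans (hx' i j)))
    obtain ⟨a, ha⟩ := exists_isotopic_of_base (Isotopic.isMOLRTriple hNN' hNM)
      (Isotopic.isYouden hNN' hNY) hN' hx h0
    exact ⟨a, Isotopic.trans hMN (Isotopic.trans hNN' ha)⟩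
  have hb : ∀ i, Function.Bijective (M 0 i) := fun i =>
    Finite.injective_iff_bijective.1 ((hM.1 0).1 i)
  let e : Fin 4 → Equiv.Perm (Fin 7) := fun i => Equiv.ofBijective _ (hb i)
  have he : ∀ i j, e i j = M 0 i j := fun i j => rfl
  obtain ⟨t, ht, τ, hτ⟩ := exists_conj ((e 1).trans (e 0).symm) fun j h => by
    rw [Equiv.trans_apply, Equiv.symm_apply_eq, he, he] at h
    exact absurd ((hM.1 0).2 j h) (by decide)
  obtain ⟨N, hMN, hN, hN'⟩ := exists_normalized hM 1 τ
  have h1 : ∀ j, (N 0 1 j : ℕ) = digit 7 t j := fun j => hτ j _ (by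
    rw [Equiv.trans_apply, Equiv.symm_apply_eq, he, he]
    exact hN' 0 1 j)
  refine ⟨t, ht, ?_⟩
  rcases le_total (N 0 2 0) (N 0 3 0) with h | h
  · exact ⟨N, hMN, hN, h1, h⟩
  · obtain ⟨N', hNN', hN₁, hN₂⟩ :=
      exists_normalized (Isotopic.isMOLRTriple hMN hM) (Equiv.swap 2 3) 1
    have e : ∀ s i j, N' s i j = N s (Equiv.swap 2 3 i) j := fun s i j => by
      have h₀ : Equiv.swap (2 : Fin 4) 3 0 = 0 := by decide
      have := hN₂ s i j
      rw [h₀, hN] at this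
      exact this.symm
    exact ⟨N', Isotopic.trans hMN hNN', hN₁, fun j => by rw [e]; exact h1 j, by rw [e, e]; exact h⟩

/-! ### The representatives -/

theorem injBelow_cell_iff {x j : ℕ} (hj : j < 7) :
    injBelow 4 (fun i => cell x i j) 0 = true ↔ Function.Injective fun i => rect x i ⟨j, hj⟩ := by
  rw [injBelow_iff]
  exact ⟨fun h i i' e => Fin.ext (h i i.2 i' i'.2 (congrArg Fin.val e)), fun h i hi i' hi' e =>
    congrArg Fin.val (@h ⟨i, hi⟩ ⟨i', hi'⟩ (Fin.ext e))⟩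

theorem cell_inverse {x y : ℕ} (h : isInverse x y = true) (i : Fin 4) (j : Fin 7) :
    rect y i (rect x i j) = j := by
  have := allBelow_iff.1 (allBelow_iff.1 h i i.2) j j.2
  rw [force_eq, Nat.beq_eq] at this
  exact Fin.ext this

theorem bits_symbolMask (x : ℕ) (j : Fin 7) : bits (symbolMask x j) = colSymbols (rect x) j := by
  ext k
  simp only [bits, symbolMask, Finset.mem_filter, Finset.mem_univ, true_and, testBit_mask,
    List.mem_cons, List.not_mem_nil, or_false, colSymbols, Finset.mem_image]
  constructor
  · rintro (h | h | h | h)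
    exacts [⟨0, Fin.ext h.symm⟩, ⟨1, Fin.ext h.symm⟩, ⟨2, Fin.ext h.symm⟩, ⟨3, Fin.ext h.symm⟩]
  · rintro ⟨i, rfl⟩
    fin_cases i
    exacts [Or.inl rfl, Or.inr (Or.inl rfl), Or.inr (Or.inr (Or.inl rfl)),
      Or.inr (Or.inr (Or.inr rfl))]

theorem isYouden_of_isValid {x : ℕ} (h : isValid x = true) : IsYouden (rect x) 2 := by
  intro j k hjk
  simp only [isValid, Bool.and_eq_true] at h
  have := allBelow_iff.1 h.2 j j.2
  rw [force_eq] at this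
  have := allBelow_iff.1 this k k.2
  simp only [Bool.or_eq_true, Nat.beq_eq, Fin.val_inj, hjk, false_or] at this
  rw [← bits_symbolMask, ← bits_symbolMask, ← bits_land]
  refine (hasTwo_iff (lt_of_le_of_lt Nat.and_le_left (mask_lt fun y hy => ?_))).1 this
  simp only [List.mem_cons, List.not_mem_nil, or_false] at hy
  rcases hy with rfl | rfl | rfl | rfl <;> exact cell_lt x _ j.2

theorem isInverse_reps (a : Fin 31) (s : Fin 3) (i : Fin 4) (j : Fin 7) :
    rect (nth inverseCodes (3 * a + s)) i (reps a s i j) = j :=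
  cell_inverse (allBelow_iff.1 isInverse_repCodes _ (by omega)) i j

theorem isYouden_reps (a : Fin 31) (s : Fin 3) : IsYouden (reps a s) 2 :=
  isYouden_of_isValid (allBelow_iff.1 isValid_repCodes _ (by omega))

theorem Orthogonal.symm {A B : Fin 4 → Fin 7 → Fin 7} (h : Orthogonal A B) : Orthogonal B A :=
  fun _ _ e => h (Prod.ext (congrArg Prod.snd e) (congrArg Prod.fst e))

theorem isMOLRTriple_reps (a : Fin 31) : IsMOLRTriple (reps a) := by
  refine ⟨fun s => ⟨fun i => Function.LeftInverse.injective (isInverse_reps a s i), fun j => ?_⟩,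
    fun s t hst => ?_⟩
  · have := allBelow_iff.1 isValid_repCodes (3 * a + s) (by omega)
    simp only [isValid, Bool.and_eq_true] at this
    exact (injBelow_cell_iff j.2).1 (allBelow_iff.1 this.1 j j.2)
  · have := allBelow_iff.1 isOrthogonal_repCodes a a.2
    simp only [force_eq, Bool.and_eq_true, isOrthogonal_iff] at this
    obtain ⟨⟨h01, h02⟩, h12⟩ := this
    change Orthogonal (reps a 0) (reps a 1) at h01
    change Orthogonal (reps a 0) (reps a 2) at h02
    change Orthogonal (reps a 1) (reps a 2) at h12
    fin_cases s <;> fin_cases t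
    exacts [absurd rfl hst, h01, h02, Orthogonal.symm h01, absurd rfl hst, h12,
      Orthogonal.symm h02, Orthogonal.symm h12,
      absurd rfl hst]

/-! ### An invariant of isotopism -/

/-- The number of columns `j₀` that are fixed when moving from row `b` to row `a` in the first
rectangle, from row `a` to row `c` in the second, and from row `c` to row `b` in the third, each
time keeping the symbol. The rectangles are given by `s`, the rows `(a, b, c)` by `i`. -/
def loops (M : Fin 3 → Fin 4 → Fin 7 → Fin 7) (s : Fin 3 × Fin 3 × Fin 3)
    (i : Fin 4 × Fin 4 × Fin 4) : ℕ :=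
  (Finset.univ.filter fun j => ∃ j₁ j₂, M s.1 i.1 j₁ = M s.1 i.2.1 j ∧
    M s.2.1 i.2.2 j₂ = M s.2.1 i.1 j₁ ∧ M s.2.2 i.2.2 j = M s.2.2 i.2.1 j₂).card

/-- The sum of the third powers of the numbers `loops` over all choices of distinct rectangles and
distinct rows. -/
def invariant (M : Fin 3 → Fin 4 → Fin 7 → Fin 7) : ℕ :=
  ∑ ρ : Equiv.Perm (Fin 3), ∑ σ : Equiv.Perm (Fin 4),
    loops M (ρ 0, ρ 1, ρ 2) (σ 0, σ 1, σ 2) ^ 3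

theorem Isotopic.invariant_eq {M M' : Fin 3 → Fin 4 → Fin 7 → Fin 7} (h : Isotopic M M') :
    invariant M' = invariant M := by
  obtain ⟨ρ', σ', τ, f, h⟩ := h
  have key : ∀ s i, loops M' s i = loops M (ρ' s.1, ρ' s.2.1, ρ' s.2.2)
      (σ' i.1, σ' i.2.1, σ' i.2.2) := by
    intro s i
    refine Finset.card_bij (fun j _ => τ j) ?_ (fun _ _ _ _ e => τ.injective e) ?_
    · intro j hj
      simp only [Finset.mem_filter, Finset.mem_univ, true_and, h,
        EmbeddingLike.apply_eq_iff_eq] at hj ⊢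
      obtain ⟨j₁, j₂, hj⟩ := hj
      exact ⟨τ j₁, τ j₂, hj⟩
    · intro j hj
      simp only [Finset.mem_filter, Finset.mem_univ, true_and, h,
        EmbeddingLike.apply_eq_iff_eq] at hj ⊢
      obtain ⟨j₁, j₂, hj⟩ := hj
      exact ⟨τ.symm j, ⟨τ.symm j₁, τ.symm j₂, by simpa using hj⟩, by simp⟩
  unfold invariant
  symm
  rw [← Equiv.sum_comp (Equiv.mulLeft ρ')]
  refine Finset.sum_congr rfl fun ρ _ => ?_
  rw [← Equiv.sum_comp (Equiv.mulLeft σ')]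
  exact Finset.sum_congr rfl fun σ _ => by rw [key]; rfl

theorem sumMem_eq {α : Type} (l : List α) (f : α → ℕ) : sumMem l f = (l.map f).sum := by
  induction l with
  | nil => rfl
  | cons x l ih =>
    have : sumMem (x :: l) f = f x + sumMem l f := rfl
    rw [this, ih, List.map_cons, List.sum_cons]

theorem countBelow_eq (n : ℕ) (p : ℕ → Bool) :
    countBelow n p = (Finset.univ.filter fun j : Fin n => p j = true).card := by
  induction n with
  | zero => rfl
  | succ n ih =>
    have : countBelow (n + 1) p = countBelow n p + (p n).toNat := by
      simp only [countBelow]; cases p n <;> rfl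
    rw [this, ih, Finset.card_filter, Finset.card_filter, Fin.sum_univ_castSucc]
    simp only [Fin.val_castSucc, Fin.val_last]
    by_cases h : p n = true <;> simp [h]

theorem sumMem_perms₃ (f : ℕ × ℕ × ℕ → ℕ) :
    sumMem perms₃ f = ∑ ρ : Equiv.Perm (Fin 3), f (ρ 0, ρ 1, ρ 2) := by
  have : (Finset.univ : Finset (Equiv.Perm (Fin 3))).val.map
      (fun ρ => ((ρ 0 : ℕ), (ρ 1 : ℕ), (ρ 2 : ℕ))) = ↑perms₃ := by decide +kernel
  rw [sumMem_eq, Finset.sum, ← Multiset.sum_coe, ← Multiset.map_coe, ← this, Multiset.map_map]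
  rfl

theorem sumMem_perms₄ (f : ℕ × ℕ × ℕ → ℕ) :
    sumMem perms₄ f = ∑ σ : Equiv.Perm (Fin 4), f (σ 0, σ 1, σ 2) := by
  have : (Finset.univ : Finset (Equiv.Perm (Fin 4))).val.map
      (fun σ => ((σ 0 : ℕ), (σ 1 : ℕ), (σ 2 : ℕ))) = ↑perms₄ := by decide +kernel
  rw [sumMem_eq, Finset.sum, ← Multiset.sum_coe, ← Multiset.map_coe, ← this, Multiset.map_map]
  rfl

theorem invariantCode_eq (a : Fin 31) :
    invariantCode repCodes inverseCodes a = invariant (reps a) := by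
  let r : Fin 3 → Fin 4 → Fin 7 → Fin 7 := fun s => rect (nth inverseCodes (3 * a + s))
  have hr : ∀ s i j k, reps a s i j = k ↔ j = r s i k := by
    intro s i j k
    have hl : Function.LeftInverse (r s i) (reps a s i) := isInverse_reps a s i
    have hb := Finite.injective_iff_bijective.1 hl.injective
    have hr' : Function.RightInverse (r s i) (reps a s i) :=
      hl.rightInverse_of_surjective hb.2
    exact ⟨fun e => by rw [← e, hl], fun e => by rw [e, hr']⟩
  unfold invariantCode invariant
  rw [sumMem_perms₃]
  refine Finset.sum_congr rfl fun ρ _ => ?_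
  simp only [force_eq]
  rw [sumMem_perms₄]
  refine Finset.sum_congr rfl fun σ _ => congrArg (fun n : ℕ => n ^ 3) ?_
  rw [countBelow_eq, loops]
  refine congrArg Finset.card (Finset.filter_congr fun j _ => ?_)
  simp only [hr, Nat.beq_eq]
  constructor
  · exact fun e => ⟨_, _, rfl, rfl, Fin.ext e.symm⟩
  · rintro ⟨_, _, rfl, rfl, e⟩
    exact (congrArg Fin.val e).symm

theorem not_isotopic_reps {a b : Fin 31} (h : a ≠ b) : ¬ Isotopic (reps a) (reps b) := by
  intro hab
  have e := Isotopic.invariant_eq hab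
  rw [← invariantCode_eq, ← invariantCode_eq] at e
  exact h (Fin.ext (injBelow_iff.1 injBelow_invariantCode _ b.2 _ a.2 e).symm)

end YoudenTriple

theorem stmt_14 :
    ∃ reps : Fin 31 → (Fin 3 → Fin 4 → Fin 7 → Fin 7),
      (∀ a, IsMOLRTriple (reps a) ∧ ∀ s, IsYouden (reps a s) 2) ∧
      (∀ a b, a ≠ b → ¬ Isotopic (reps a) (reps b)) ∧
      (∀ M : Fin 3 → Fin 4 → Fin 7 → Fin 7,
        IsMOLRTriple M → (∀ s, IsYouden (M s) 2) → ∃ a, Isotopic M (reps a)) :=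
  ⟨YoudenTriple.reps,
    fun a => ⟨YoudenTriple.isMOLRTriple_reps a, YoudenTriple.isYouden_reps a⟩,
    fun _ _ => YoudenTriple.not_isotopic_reps,
    fun _ hM hY => YoudenTriple.exists_isotopic_reps hM hY⟩
end

section
/- There exist six pairwise orthogonal 3 × 7 Latin rectangles, each of which is a Youden rectangle with parameter 1. -/
/-- The cyclic rectangle developed modulo `7` from the multiple `s + 1` of the planar difference
set `{0, 1, 3}`. -/
def cyclicRectangle (s : Fin 6) (i : Fin 3) (j : Fin 7) : Fin 7 :=
  j + s.succ * ![0, 1, 3] i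

theorem cyclicRectangle_isLatinRectangle (s : Fin 6) : IsLatinRectangle (cyclicRectangle s) := by
  refine ⟨fun i j j' h => add_right_cancel h, ?_⟩
  unfold Function.Injective
  revert s
  decide +kernel

theorem cyclicRectangle_isYouden (s : Fin 6) : IsYouden (cyclicRectangle s) 1 := by
  unfold IsYouden
  revert s
  decide +kernel

theorem cyclicRectangle_orthogonal {s s' : Fin 6} (h : s ≠ s') :
    Orthogonal (cyclicRectangle s) (cyclicRectangle s') := by
  have key : ∀ s s' : Fin 6, s ≠ s' → ∀ (i i' : Fin 3) (j j' : Fin 7),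
      cyclicRectangle s i j = cyclicRectangle s i' j' →
      cyclicRectangle s' i j = cyclicRectangle s' i' j' → i = i' ∧ j = j' := by
    decide +kernel
  rintro ⟨i, j⟩ ⟨i', j'⟩ e
  obtain ⟨e₁, e₂⟩ := Prod.mk.inj e
  obtain ⟨rfl, rfl⟩ := key s s' h i i' j j' e₁ e₂
  rfl

theorem stmt_15 :
    ∃ A : Fin 6 → Fin 3 → Fin 7 → Fin 7,
      (∀ s, IsLatinRectangle (A s)) ∧ (∀ s, IsYouden (A s) 1) ∧
      ∀ s s', s ≠ s' → Orthogonal (A s) (A s') := by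
  exact ⟨cyclicRectangle, cyclicRectangle_isLatinRectangle, cyclicRectangle_isYouden,
    fun _ _ h => cyclicRectangle_orthogonal h⟩
end

section
/- There exist six pairwise orthogonal 4 × 7 Latin rectangles, each of which is a Youden rectangle with parameter 2. -/
/-- The rectangles `A s i j = j + (s + 1) * d i` over `ZMod 7`, where the `d i` run through the
`(7, 4, 2)` difference set `{0, 3, 5, 6}`. -/
def youdenRectangle (s : Fin 6) (i : Fin 4) (j : Fin 7) : Fin 7 :=
  j + s.succ * (![0, 3, 5, 6] : Fin 4 → Fin 7) i

theorem isLatinRectangle_youdenRectangle (s : Fin 6) :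
    IsLatinRectangle (youdenRectangle s) := by
  refine ⟨fun i j j' h => add_right_cancel h, ?_⟩
  intro j i i' h
  have key : ∀ (s : Fin 6) (i i' : Fin 4),
      s.succ * (![0, 3, 5, 6] : Fin 4 → Fin 7) i =
        s.succ * (![0, 3, 5, 6] : Fin 4 → Fin 7) i' → i = i' := by decide
  exact key s i i' (add_left_cancel h)

theorem isYouden_youdenRectangle (s : Fin 6) : IsYouden (youdenRectangle s) 2 := by
  unfold IsYouden colSymbols
  revert s
  decide

theorem orthogonal_youdenRectangle {s t : Fin 6} (hst : s ≠ t) :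
    Orthogonal (youdenRectangle s) (youdenRectangle t) := by
  rintro ⟨i, j⟩ ⟨i', j'⟩ h
  obtain ⟨h₁, h₂⟩ := Prod.mk.inj h
  have cross : ∀ a b c c' x y : ZMod 7,
      x + a * c = y + a * c' → x + b * c = y + b * c' → (a - b) * c = (a - b) * c' := by
    intro a b c c' x y h h'
    linear_combination h - h'
  have key : ∀ (s t : Fin 6), s ≠ t → ∀ i i' : Fin 4,
      (s.succ - t.succ) * (![0, 3, 5, 6] : Fin 4 → Fin 7) i =
        (s.succ - t.succ) * (![0, 3, 5, 6] : Fin 4 → Fin 7) i' → i = i' := by decide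
  obtain rfl := key s t hst i i' (cross _ _ _ _ _ _ h₁ h₂)
  obtain rfl : j = j' := add_right_cancel h₁
  rfl

theorem stmt_16 :
    ∃ A : Fin 6 → Fin 4 → Fin 7 → Fin 7,
      (∀ s, IsLatinRectangle (A s)) ∧ (∀ s, IsYouden (A s) 2) ∧
      ∀ s s', s ≠ s' → Orthogonal (A s) (A s') := by
  exact ⟨youdenRectangle, isLatinRectangle_youdenRectangle, isYouden_youdenRectangle,
    fun _ _ hst => orthogonal_youdenRectangle hst⟩
end

section
/- There exist four pairwise orthogonal 5 × 6 Latin rectangles, each of which is a Youden rectangle with parameter 4, but there do not exist five pairwise orthogonal 5 × 6 Latin rectangles each of which is a Youden rectangle with parameter 4. -/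
/-- Given `m` linear forms in `m + 1` rational variables, one can find a rational point with last
coordinate `1` at which the `i`-th form agrees up to sign with the `i`-th coordinate. -/
theorem exists_sq_linearForm_eq_sq_coord :
    ∀ (m : ℕ) (L : Fin m → (Fin (m + 1) → ℚ) →ₗ[ℚ] ℚ),
      ∃ v : Fin (m + 1) → ℚ, v (Fin.last m) = 1 ∧ ∀ i, L i v ^ 2 = v i.castSucc ^ 2
  | 0, _ => ⟨fun _ => 1, rfl, fun i => i.elim0⟩
  | m + 1, L => by
    have key : ∃ t : (Fin (m + 1) → ℚ) →ₗ[ℚ] ℚ, ∀ v,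
        L 0 (Fin.cons (t v) v : Fin (m + 2) → ℚ) ^ 2 = t v ^ 2 := by
      let c : (Fin (m + 1) → ℚ) →ₗ[ℚ] (Fin (m + 2) → ℚ) :=
        LinearMap.pi (Fin.cons 0 fun i => LinearMap.proj i)
      have hc : ∀ (s : ℚ) (v : Fin (m + 1) → ℚ),
          (Fin.cons s v : Fin (m + 2) → ℚ) = s • Pi.single 0 1 + c v := by
        intro s v
        ext i
        refine Fin.cases ?_ (fun i => ?_) i <;> simp [c]
      by_cases ha : L 0 (Pi.single 0 1) = 1
      · refine ⟨(-1 / 2 : ℚ) • (L 0 ∘ₗ c), fun v => ?_⟩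
        rw [hc, map_add, map_smul, ha]
        simp only [LinearMap.smul_apply, LinearMap.comp_apply, smul_eq_mul]
        ring
      · refine ⟨(1 - L 0 (Pi.single 0 1))⁻¹ • (L 0 ∘ₗ c), fun v => ?_⟩
        have h1 : 1 - L 0 (Pi.single 0 1) ≠ 0 := sub_ne_zero.2 (Ne.symm ha)
        rw [hc, map_add, map_smul]
        simp only [LinearMap.smul_apply, LinearMap.comp_apply, smul_eq_mul]
        congr 1
        field_simp
        ring
    obtain ⟨t, ht⟩ := key
    let S : (Fin (m + 1) → ℚ) →ₗ[ℚ] (Fin (m + 2) → ℚ) :=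
      LinearMap.pi (Fin.cons t fun i => LinearMap.proj i)
    have hS : ∀ v, S v = Fin.cons (t v) v := by
      intro v
      ext i
      refine Fin.cases ?_ (fun i => ?_) i <;> simp [S]
    obtain ⟨v, hv1, hv⟩ := exists_sq_linearForm_eq_sq_coord m fun i => L i.succ ∘ₗ S
    refine ⟨S v, ?_, fun i => ?_⟩
    · rw [hS, ← Fin.succ_last, Fin.cons_succ, hv1]
    · refine Fin.cases ?_ (fun i => ?_) i
      · simpa [hS] using ht v
      · simpa [hS, ← Fin.succ_castSucc] using hv i

/-- Over `ℚ`, six times a sum of `4 * n` squares is equivalent to a sum of `4 * n` squares. -/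
theorem exists_linearMap_six_mul_sum_sq (n : ℕ) :
    ∃ T : (Fin (n * 4) → ℚ) →ₗ[ℚ] (Fin (n * 4) → ℚ),
      ∀ y, 6 * ∑ i, T y i ^ 2 = ∑ i, y i ^ 2 := by
  let H : Matrix (Fin 4) (Fin 4) ℚ :=
    !![2, 1, 1, 0; -1, 2, 0, 1; -1, 0, 2, -1; 0, -1, 1, 2]
  let e : Fin n × Fin 4 ≃ Fin (n * 4) := finProdFinEquiv
  refine ⟨LinearMap.pi fun i => ∑ k, (H (e.symm i).2 k / 6) •
    LinearMap.proj (e ((e.symm i).1, k)), fun y => ?_⟩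
  rw [← e.sum_comp, ← e.sum_comp, Fintype.sum_prod_type, Fintype.sum_prod_type, Finset.mul_sum]
  refine Finset.sum_congr rfl fun a _ => ?_
  simp [Fin.sum_univ_four, H]
  ring

/-- `1 + w ^ 2 = 6 * x ^ 2` has no rational solutions. -/
theorem one_add_sq_ne_six_mul_sq (w x : ℚ) : 1 + w ^ 2 ≠ 6 * x ^ 2 := by
  intro h
  have hx : x ≠ 0 := by
    rintro rfl
    nlinarith [sq_nonneg w]
  have hwd : (w.den : ℚ) ≠ 0 := by exact_mod_cast w.den_ne_zero
  have hxd : (x.den : ℚ) ≠ 0 := by exact_mod_cast x.den_ne_zero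
  have hz : ((w.den : ℤ) * x.den) ^ 2 + (w.num * x.den) ^ 2 = 6 * (x.num * w.den) ^ 2 := by
    rw [← Rat.num_div_den w, ← Rat.num_div_den x] at h
    field_simp at h
    have : ((w.den : ℚ) * x.den) ^ 2 + (w.num * x.den) ^ 2 = 6 * (x.num * w.den) ^ 2 := by
      linear_combination h
    exact_mod_cast this
  have hn : 6 * (x.num.natAbs * w.den) ^ 2 = (w.den * x.den) ^ 2 + (w.num.natAbs * x.den) ^ 2 := by
    zify
    rw [mul_pow |x.num|, mul_pow |w.num|, sq_abs, sq_abs]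
    linear_combination -hz
  have h0 : x.num.natAbs * w.den ≠ 0 := by
    simp [hx]
  have : Fact (Nat.Prime 3) := ⟨Nat.prime_three⟩
  have heven := (Nat.eq_sq_add_sq_iff (n := 6 * (x.num.natAbs * w.den) ^ 2)).1 ⟨_, _, hn⟩ 3
    (by
      rw [Nat.mem_primeFactors]
      exact ⟨Nat.prime_three, Dvd.dvd.mul_right (by norm_num) _, by positivity⟩) (by norm_num)
  rw [padicValNat.mul (by norm_num) (by positivity), padicValNat.pow,
    show 6 = 3 * 2 from rfl, padicValNat.mul (by norm_num) (by norm_num), padicValNat_self,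
    padicValNat.eq_zero_of_not_dvd (by norm_num : ¬ 3 ∣ 2)] at heven
  revert heven
  simp [Nat.even_add]

/-- The Bruck–Ryser obstruction for order six: the quadratic form `6 I + J` in `43` variables is
not a sum of `43` squares of rational linear forms. -/
theorem not_sum_sq_linearForm_eq {ι κ : Type*} [Fintype ι] [Fintype κ]
    (hι : Fintype.card ι = 43) (hκ : Fintype.card κ = 43) (L : κ → (ι → ℚ) →ₗ[ℚ] ℚ) :
    ¬ ∀ x : ι → ℚ, ∑ l, L l x ^ 2 = 6 * ∑ p, x p ^ 2 + (∑ p, x p) ^ 2 := by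
  intro h
  let e : Fin 43 ≃ ι := (Fintype.equivFinOfCardEq hι).symm
  let f : Fin 43 ≃ κ := (Fintype.equivFinOfCardEq hκ).symm
  obtain ⟨T, hT⟩ := exists_linearMap_six_mul_sum_sq 11
  let R : (Fin 44 → ℚ) →ₗ[ℚ] (ι → ℚ) := LinearMap.funLeft ℚ ℚ (fun p => (e.symm p).castSucc) ∘ₗ T
  obtain ⟨v, hv1, hv⟩ := exists_sq_linearForm_eq_sq_coord 43 fun i => L (f i) ∘ₗ R
  have hR := h (R v)
  have hTv : 6 * ∑ i : Fin 44, T v i ^ 2 = ∑ i : Fin 44, v i ^ 2 := hT v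
  rw [Fin.sum_univ_castSucc, Fin.sum_univ_castSucc (fun i => v i ^ 2), hv1] at hTv
  have h1 : ∑ l, L l (R v) ^ 2 = ∑ i : Fin 43, v i.castSucc ^ 2 := by
    rw [← f.sum_comp]
    exact Finset.sum_congr rfl fun i _ => hv i
  have h2 : ∑ p, R v p ^ 2 = ∑ i : Fin 43, T v i.castSucc ^ 2 := by
    rw [← e.sum_comp]
    simp [R, LinearMap.funLeft]
  rw [h1, h2] at hR
  exact one_add_sq_ne_six_mul_sq (∑ p, R v p) (T v (Fin.last 43)) (by linear_combination -hTv - hR)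

/-- There is no affine plane of order six: `36` points cannot carry `7` labellings by six symbols
any two of which jointly separate points. -/
theorem no_affine_plane_of_order_six {P C : Type*} [Fintype P] [Fintype C]
    (hP : Fintype.card P = 36) (hC : Fintype.card C = 7) (f : C → P → Fin 6)
    (hf : ∀ s s', s ≠ s' → Function.Injective fun p => (f s p, f s' p)) : False := by
  classical
  have hfib : ∀ s σ, (Finset.univ.filter fun p => f s p = σ).card = 6 := by
    intro s σ
    obtain ⟨s', hs'⟩ := Fintype.exists_ne_of_one_lt_card (by omega : 1 < Fintype.card C) s
    have hb : Function.Bijective fun p => (f s p, f s' p) :=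
      (Fintype.bijective_iff_injective_and_card _).2 ⟨hf s s' hs'.symm, by simp [hP]⟩
    refine (Finset.card_bij (fun p _ => f s' p) (t := Finset.univ) (by simp) ?_ ?_).trans (by simp)
    · intro p hp q hq h
      simp only [Finset.mem_filter, Finset.mem_univ, true_and] at hp hq
      exact hb.1 (Prod.ext (hp.trans hq.symm) h)
    · intro τ _
      obtain ⟨p, hp⟩ := hb.2 (σ, τ)
      simp only [Prod.mk.injEq] at hp
      exact ⟨p, by simp [hp.1], hp.2⟩
  let agree (p q : P) : Finset C := Finset.univ.filter fun s => f s p = f s q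
  have hle : ∀ p q, p ≠ q → (agree p q).card ≤ 1 := by
    intro p q hpq
    refine Finset.card_le_one.2 fun s hs s' hs' => ?_
    by_contra hne
    simp only [agree, Finset.mem_filter, Finset.mem_univ, true_and] at hs hs'
    exact hpq (hf s s' hne (Prod.ext hs hs'))
  have hself : ∀ p, (agree p p).card = 7 := by simp [agree, hC]
  have hsum : ∀ p, ∑ q, (agree p q).card = 42 := by
    intro p
    simp only [agree, Finset.card_filter]
    rw [Finset.sum_comm]
    simp only [← Finset.card_filter, eq_comm (a := f _ p), hfib]
    simp [hC]
  have hone : ∀ p q, p ≠ q → (agree p q).card = 1 := by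
    intro p q hpq
    have h1 : ∑ q ∈ Finset.univ.erase p, (agree p q).card = ∑ q ∈ Finset.univ.erase p, 1 := by
      have := Finset.add_sum_erase Finset.univ (fun q => (agree p q).card) (Finset.mem_univ p)
      simp only [hsum, hself] at this
      simp [hP]
      omega
    exact (Finset.sum_eq_sum_iff_of_le fun q hq => hle p q (Finset.ne_of_mem_erase hq).symm).1 h1
      q (by simp [hpq.symm])
  let pt (p : P) : (P ⊕ C → ℚ) →ₗ[ℚ] ℚ := LinearMap.proj (Sum.inl p)
  let inf (s : C) : (P ⊕ C → ℚ) →ₗ[ℚ] ℚ := LinearMap.proj (Sum.inr s)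
  let L : Option (C × Fin 6) → (P ⊕ C → ℚ) →ₗ[ℚ] ℚ := fun l => l.elim (∑ s, inf s)
    fun b => ∑ p, (if f b.1 p = b.2 then (1 : ℚ) else 0) • pt p + inf b.1
  refine not_sum_sq_linearForm_eq (by simp [hP, hC]) (by simp [hC]) L fun x => ?_
  have hquad : ∑ s, ∑ σ, (∑ p, if f s p = σ then x (Sum.inl p) else 0) ^ 2 =
      6 * ∑ p, x (Sum.inl p) ^ 2 + (∑ p, x (Sum.inl p)) ^ 2 := by
    have h1 : ∀ s, ∑ σ, (∑ p, if f s p = σ then x (Sum.inl p) else 0) ^ 2 =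
        ∑ p, ∑ q, if f s p = f s q then x (Sum.inl p) * x (Sum.inl q) else 0 := by
      intro s
      simp only [sq, Finset.sum_mul_sum]
      rw [Finset.sum_comm]
      refine Finset.sum_congr rfl fun p _ => ?_
      rw [Finset.sum_comm]
      refine Finset.sum_congr rfl fun q _ => ?_
      simp [eq_comm]
    have h2 : ∀ p q, (∑ s, if f s p = f s q then x (Sum.inl p) * x (Sum.inl q) else 0) =
        x (Sum.inl p) * x (Sum.inl q) + if p = q then 6 * x (Sum.inl p) ^ 2 else 0 := by
      intro p q
      rw [← Finset.sum_filter, Finset.sum_const]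
      change (agree p q).card • _ = _
      split_ifs with h
      · subst h
        rw [hself, nsmul_eq_mul]
        push_cast
        ring
      · simp [hone p q h]
    simp only [h1]
    rw [Finset.sum_comm]
    simp only [Finset.sum_comm (s := (Finset.univ : Finset C)), h2, Finset.sum_add_distrib]
    simp [sq, ← Finset.mul_sum, ← Finset.sum_mul, add_comm]
  have hlin : ∀ s, ∑ σ, ∑ p, (if f s p = σ then x (Sum.inl p) else 0) = ∑ p, x (Sum.inl p) := by
    intro s
    rw [Finset.sum_comm]
    simp
  have hL : ∑ b : C × Fin 6, L (some b) x ^ 2 =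
      ∑ s, ∑ σ, (∑ p, if f s p = σ then x (Sum.inl p) else 0) ^ 2 +
        2 * (∑ s, x (Sum.inr s)) * (∑ p, x (Sum.inl p)) + 6 * ∑ s, x (Sum.inr s) ^ 2 := by
    rw [Fintype.sum_prod_type, mul_assoc, Finset.sum_mul, Finset.mul_sum, Finset.mul_sum,
      ← Finset.sum_add_distrib, ← Finset.sum_add_distrib]
    refine Finset.sum_congr rfl fun s _ => ?_
    have : ∀ σ, L (some (s, σ)) x =
        (∑ p, if f s p = σ then x (Sum.inl p) else 0) + x (Sum.inr s) := by
      intro σ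
      simp [L, pt, inf, LinearMap.sum_apply, -ite_smul]
    simp only [this, add_sq, Finset.sum_add_distrib, ← Finset.sum_mul, ← Finset.mul_sum, hlin]
    simp
    ring
  have hnone : L none x = ∑ s, x (Sum.inr s) := by
    simp [L, inf, LinearMap.sum_apply]
  rw [Fintype.sum_option, hL, hquad, hnone, Fintype.sum_sum_type, Fintype.sum_sum_type]
  ring

/-- A `5 × 6` Latin rectangle extends to a Latin square by a row of missing symbols. -/
theorem IsLatinRectangle.exists_missing_row {A : Fin 5 → Fin 6 → Fin 6} (hA : IsLatinRectangle A) :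
    ∃ m : Fin 6 → Fin 6, Function.Injective m ∧ ∀ i j, A i j ≠ m j := by
  have h : ∀ j, ∃ σ, ∀ i, A i j ≠ σ := by
    intro j
    by_contra! hs
    have := Fintype.card_le_of_surjective (fun i => A i j) hs
    simp at this
  choose m hm using h
  refine ⟨m, fun j j' hj => ?_, fun i j => hm j i⟩
  by_contra hne
  have hsurj : ∀ i, ∃ c, A i c = m j := fun i =>
    (Finite.injective_iff_surjective.1 (hA.1 i)) (m j)
  choose c hc using hsurj
  have hcinj : Function.Injective c := fun i i' h => hA.2 (c i) <| by
    change A i (c i) = A i' (c i)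
    rw [hc, h, hc]
  have hsub : Finset.univ.image c ⊆ (Finset.univ.erase j).erase j' := by
    intro a ha
    obtain ⟨i, -, rfl⟩ := Finset.mem_image.1 ha
    simp only [Finset.mem_erase, Finset.mem_univ, and_true]
    constructor
    · intro h
      exact hm j' i (by rw [← hj, ← hc i, h])
    · intro h
      exact hm j i (by rw [← hc i, h])
  have := Finset.card_le_card hsub
  rw [Finset.card_image_of_injective _ hcinj, Finset.card_erase_of_mem (by simp [Ne.symm hne]),
    Finset.card_erase_of_mem (by simp)] at this
  simp at this

/-- Two cells in different rows and columns of a set of five pairwise orthogonal `5 × 6` Latin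
rectangles carry equal symbols in some rectangle of the set. -/
theorem exists_agree_of_orthogonal {A : Fin 5 → Fin 5 → Fin 6 → Fin 6}
    (hA : ∀ s, IsLatinRectangle (A s)) (hO : ∀ s s', s ≠ s' → Orthogonal (A s) (A s'))
    {i i' : Fin 5} {j j' : Fin 6} (hi : i ≠ i') (hj : j ≠ j') : ∃ s, A s i j = A s i' j' := by
  have hsurj : ∀ s, ∃ c, A s i' c = A s i j := fun s =>
    (Finite.injective_iff_surjective.1 ((hA s).1 i')) _
  choose c hc using hsurj
  have hcinj : Function.Injective c := by
    intro s s' h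
    by_contra hne
    have := hO s s' hne (a₁ := (i, j)) (a₂ := (i', c s))
      (Prod.ext (hc s).symm (by simp [h, hc]))
    exact hi (congrArg Prod.fst this)
  have hsub : Finset.univ.image c ⊆ Finset.univ.erase j := by
    intro a ha
    obtain ⟨s, -, rfl⟩ := Finset.mem_image.1 ha
    simp only [Finset.mem_erase, Finset.mem_univ, and_true]
    intro h
    exact hi ((hA s).2 j (by simpa [h] using (hc s).symm))
  have heq := Finset.eq_of_subset_of_card_le hsub (by
    rw [Finset.card_image_of_injective _ hcinj]
    simp)
  have hmem : j' ∈ Finset.univ.image c := by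
    rw [heq]
    simp [hj.symm]
  obtain ⟨s, -, rfl⟩ := Finset.mem_image.1 hmem
  exact ⟨s, (hc s).symm⟩

/-- In a set of five pairwise orthogonal `5 × 6` Latin rectangles, at most one symbol of a given
cell is absent from a given column. -/
theorem eq_of_missing_of_orthogonal {A : Fin 5 → Fin 5 → Fin 6 → Fin 6}
    (hA : ∀ s, IsLatinRectangle (A s)) (hO : ∀ s s', s ≠ s' → Orthogonal (A s) (A s'))
    {i : Fin 5} {c j : Fin 6} {s s' : Fin 5} (hs : ∀ i', A s i' j ≠ A s i c)
    (hs' : ∀ i', A s' i' j ≠ A s' i c) : s = s' := by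
  by_contra hne
  have hcj : c ≠ j := by
    rintro rfl
    exact hs i rfl
  have h : ∀ i' : {i' // i' ≠ i}, ∃ t, A t i c = A t i' j := fun i' =>
    exists_agree_of_orthogonal hA hO i'.2.symm hcj
  choose t ht using h
  have htinj : Function.Injective t := fun a b hab =>
    Subtype.ext <| (hA (t a)).2 j <| by
      change A (t a) a j = A (t a) b j
      rw [← ht, hab, ht]
  have hsub : Finset.univ.image t ⊆ (Finset.univ.erase s).erase s' := by
    intro a ha
    obtain ⟨i', -, rfl⟩ := Finset.mem_image.1 ha
    simp only [Finset.mem_erase, Finset.mem_univ, and_true]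
    constructor
    · rintro h
      exact hs' i' (by rw [← h, ht])
    · rintro h
      exact hs i' (by rw [← h, ht])
  have := Finset.card_le_card hsub
  rw [Finset.card_image_of_injective _ htinj, Finset.card_erase_of_mem (by simp [Ne.symm hne]),
    Finset.card_erase_of_mem (by simp)] at this
  simp at this

/-- There are no five pairwise orthogonal `5 × 6` Latin rectangles. -/
theorem no_five_orthogonal_latinRectangle {A : Fin 5 → Fin 5 → Fin 6 → Fin 6}
    (hA : ∀ s, IsLatinRectangle (A s)) (hO : ∀ s s', s ≠ s' → Orthogonal (A s) (A s')) :
    False := by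
  choose m hminj hm using fun s => (hA s).exists_missing_row
  let B : Fin 5 → Fin 6 → Fin 6 → Fin 6 := fun s => Fin.snoc (A s) (m s)
  have hBrow : ∀ s i, Function.Injective (B s i) := by
    intro s i
    refine Fin.lastCases ?_ (fun i => ?_) i
    · simpa only [B, Fin.snoc_last] using hminj s
    · simpa only [B, Fin.snoc_castSucc] using (hA s).1 i
  have hBcol : ∀ s j i i', B s i j = B s i' j → i = i' := by
    intro s j i i'
    refine Fin.lastCases ?_ (fun i => ?_) i <;> refine Fin.lastCases ?_ (fun i' => ?_) i'
    · simp
    · intro h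
      simp only [B, Fin.snoc_last, Fin.snoc_castSucc] at h
      exact absurd h.symm (hm s i' j)
    · intro h
      simp only [B, Fin.snoc_last, Fin.snoc_castSucc] at h
      exact absurd h (hm s i j)
    · intro h
      simp only [B, Fin.snoc_castSucc] at h
      rw [(hA s).2 j h]
  have hmix : ∀ s s' i c j, s ≠ s' → A s i c = m s j → A s' i c = m s' j → False := by
    intro s s' i c j hne h h'
    refine hne (eq_of_missing_of_orthogonal hA hO (i := i) (c := c) (j := j) ?_ ?_)
    · simpa [h] using fun i' => hm s i' j
    · simpa [h'] using fun i' => hm s' i' j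
  have hBO : ∀ s s', s ≠ s' → ∀ i j i' j', B s i j = B s i' j' → B s' i j = B s' i' j' →
      (i, j) = (i', j') := by
    intro s s' hne i j i' j'
    refine Fin.lastCases ?_ (fun i => ?_) i <;> refine Fin.lastCases ?_ (fun i' => ?_) i' <;>
      simp only [B, Fin.snoc_last, Fin.snoc_castSucc] <;> intro h h'
    · rw [hminj s h]
    · exact (hmix s s' i' j' j hne h.symm h'.symm).elim
    · exact (hmix s s' i j j' hne h h').elim
    · have := hO s s' hne (a₁ := (i, j)) (a₂ := (i', j')) (Prod.ext h h')
      simp only [Prod.mk.injEq] at this ⊢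
      exact ⟨by rw [this.1], this.2⟩
  let f : Option (Option (Fin 5)) → Fin 6 × Fin 6 → Fin 6
    | none, p => p.1
    | some none, p => p.2
    | some (some s), p => B s p.1 p.2
  refine no_affine_plane_of_order_six (by simp) (by simp) f ?_
  rintro (_ | _ | s) (_ | _ | s') hne ⟨i, j⟩ ⟨i', j'⟩ h <;>
    simp only [f, Prod.mk.injEq] at h <;> obtain ⟨h1, h2⟩ := h
  · exact absurd rfl hne
  · rw [h1, h2]
  · subst h1
    rw [hBrow s' _ h2]
  · rw [h1, h2]
  · exact absurd rfl hne
  · subst h1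
    rw [hBcol s' _ _ _ h2]
  · subst h2
    rw [hBrow s _ h1]
  · subst h2
    rw [hBcol s _ _ _ h1]
  · exact hBO s s' (by simpa using hne) _ _ _ _ h1 h2

/-- Four pairwise orthogonal `5 × 6` Latin rectangles. -/
def fourRectangles : Fin 4 → Fin 5 → Fin 6 → Fin 6 :=
  ![![![3, 4, 5, 0, 1, 2], ![2, 0, 1, 5, 3, 4], ![4, 5, 3, 1, 2, 0], ![0, 1, 2, 4, 5, 3],
      ![1, 2, 0, 3, 4, 5]],
    ![![3, 4, 5, 1, 2, 0], ![2, 0, 1, 4, 5, 3], ![0, 1, 2, 5, 3, 4], ![5, 3, 4, 2, 0, 1],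
      ![4, 5, 3, 0, 1, 2]],
    ![![3, 4, 5, 2, 0, 1], ![4, 5, 3, 1, 2, 0], ![2, 0, 1, 4, 5, 3], ![1, 2, 0, 3, 4, 5],
      ![5, 3, 4, 0, 1, 2]],
    ![![2, 0, 1, 5, 3, 4], ![1, 2, 0, 3, 4, 5], ![3, 4, 5, 2, 0, 1], ![0, 1, 2, 4, 5, 3],
      ![4, 5, 3, 0, 1, 2]]]

theorem isLatinRectangle_fourRectangles (s : Fin 4) : IsLatinRectangle (fourRectangles s) := by
  unfold IsLatinRectangle Function.Injective
  revert s
  decide +kernel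

theorem isYouden_fourRectangles (s : Fin 4) : IsYouden (fourRectangles s) 4 := by
  unfold IsYouden
  revert s
  decide +kernel

theorem orthogonal_fourRectangles (s s' : Fin 4) (h : s ≠ s') :
    Orthogonal (fourRectangles s) (fourRectangles s') := by
  unfold Orthogonal Function.Injective
  revert s s'
  decide +kernel

theorem stmt_17 :
    (∃ A : Fin 4 → Fin 5 → Fin 6 → Fin 6,
      (∀ s, IsLatinRectangle (A s)) ∧ (∀ s, IsYouden (A s) 4) ∧
      ∀ s s', s ≠ s' → Orthogonal (A s) (A s')) ∧
    ¬ ∃ A : Fin 5 → Fin 5 → Fin 6 → Fin 6,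
      (∀ s, IsLatinRectangle (A s)) ∧ (∀ s, IsYouden (A s) 4) ∧
      ∀ s s', s ≠ s' → Orthogonal (A s) (A s') := by
  refine ⟨⟨fourRectangles, isLatinRectangle_fourRectangles, isYouden_fourRectangles,
    orthogonal_fourRectangles⟩, ?_⟩
  rintro ⟨A, hA, -, hO⟩
  exact no_five_orthogonal_latinRectangle hA hO
end

section
/- Every triple of mutually orthogonal 2 × 6 Latin rectangles can be extended by one more row; that is, for every such triple there exists a triple of mutually orthogonal 3 × 6 Latin rectangles whose first two rows (in each of the three rectangles) agree with it. -/
/-- The values of a self-map of `Fin 6`. -/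
def valueList (f : Fin 6 → Fin 6) : List ℕ :=
  [f 0, f 1, f 2, f 3, f 4, f 5]

/-- The set of values of a list, as a bit mask. -/
def valueMask : List ℕ → ℕ
  | [] => 0
  | x :: s => Nat.lor (Nat.shiftLeft 1 x) (valueMask s)

/-- The set of pairs of corresponding entries of two lists of numbers below 6, as a bit mask. -/
def pairMask : List ℕ → List ℕ → ℕ
  | x :: s, y :: t => Nat.lor (Nat.shiftLeft 1 (Nat.add (Nat.mul 6 x) y)) (pairMask s t)
  | _, _ => 0

/-- The pairs (position, entry of `t`) and the pairs of corresponding entries of `s` and `t`,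
as one bit mask. -/
def keyMask (s t : List ℕ) : ℕ :=
  Nat.lor (pairMask [0, 1, 2, 3, 4, 5] t) (Nat.shiftLeft (pairMask s t) 36)

/-- Two sets given by bit masks are disjoint. -/
def disjointMasks (m n : ℕ) : Bool := Nat.beq (Nat.land m n) 0

/-- Equal to `k n`, but `n` is reduced to a numeral first when this is evaluated by the kernel. -/
def withNumeral (n : ℕ) (k : ℕ → Bool) : Bool :=
  match n + 1 with
  | 0 => true
  | m + 1 => k m

/-- The list `acc`, preceded by all lists of the form `l ++ pre` where the entries of `l`, from last
to first, are numbers below 6 that are distinct, not in the set `used`, and not in the respective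
sets of forbidden values. Sets are given by bit masks. -/
def selections : List ℕ → ℕ → List ℕ → List (List ℕ) → List (List ℕ)
  | [], _, pre, acc => pre :: acc
  | f :: fs, used, pre, acc => [0, 1, 2, 3, 4, 5].foldr (fun v acc' =>
      bif disjointMasks (Nat.shiftLeft 1 v) (Nat.lor used f) then
        selections fs (Nat.lor used (Nat.shiftLeft 1 v)) (v :: pre) acc'
      else acc') acc

/-- All permutations discordant with the identity and with `a`. -/
def discordantLists (a : List ℕ) : List (List ℕ) :=
  selections (List.zipWith (fun x y => Nat.lor (Nat.shiftLeft 1 x) (Nat.shiftLeft 1 y))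
    [5, 4, 3, 2, 1, 0] a.reverse) 0 [] []

/-- Pass the given lists with their key masks relative to `a` on to `k`. -/
def withKeys (a : List ℕ) (k : List (List ℕ × ℕ) → Bool) :
    List (List ℕ) → List (List ℕ × ℕ) → Bool
  | [], acc => k acc
  | l :: ls, acc => withNumeral (keyMask a l) fun m => withKeys a k ls ((l, m) :: acc)

/-- Six consecutive decimal digits of `w`, starting with the digit at `10 ^ (n + 5)`, each reduced
modulo 6. -/
def digitFun (n w : ℕ) (i : Fin 6) : Fin 6 :=
  ⟨w / 10 ^ (n + 5 - i) % 10 % 6, Nat.mod_lt _ (by decide)⟩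

/-- The masks needed to compare the row `(1, p, q, r)` coded by `w` with other rows. -/
def withRowMasks (k : List (ℕ × ℕ × ℕ) → Bool) : List ℕ → List (ℕ × ℕ × ℕ) → Bool
  | [], acc => k acc
  | w :: ws, acc =>
    withNumeral (keyMask (valueList (digitFun 12 w)) (valueList (digitFun 6 w))) fun m₁ =>
    withNumeral (keyMask (valueList (digitFun 12 w)) (valueList (digitFun 0 w))) fun m₂ =>
    withNumeral (pairMask (valueList (digitFun 6 w)) (valueList (digitFun 0 w))) fun m₃ =>
      withRowMasks k ws ((m₁, m₂, m₃) :: acc)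

/-- Pass the elements of a list that satisfy `t`, together with those in `acc`, on to `k`. -/
def filterThen {α : Type} (t : α → Bool) (k : List α → Bool) : List α → List α → Bool
  | [], acc => k acc
  | w :: ws, acc => bif t w then filterThen t k ws (w :: acc) else filterThen t k ws acc

/-- The position masks of two lists are disjoint. -/
def discordant (s t : List ℕ) : Bool :=
  disjointMasks (pairMask [0, 1, 2, 3, 4, 5] s) (pairMask [0, 1, 2, 3, 4, 5] t)

/-- The maps `p`, `q`, `r` are permutations which, with the identity, form a row compatible with
the identity row, and `p` is discordant with `a`. -/
def isNormalRow (a p q r : List ℕ) : Bool :=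
  Nat.beq (valueMask p) 63 && Nat.beq (valueMask q) 63 && Nat.beq (valueMask r) 63 &&
  discordant [0, 1, 2, 3, 4, 5] p && discordant [0, 1, 2, 3, 4, 5] q &&
  discordant [0, 1, 2, 3, 4, 5] r && discordant p q && discordant p r && discordant q r &&
  discordant a p

/-- Every row `(1, a, b, c)` compatible with the identity row admits a third row coded in `W`. -/
def rowsSuffice (a : List ℕ) (W : List ℕ) : Bool :=
  W.all (fun w => isNormalRow a (valueList (digitFun 12 w)) (valueList (digitFun 6 w))
    (valueList (digitFun 0 w))) &&
  withRowMasks (fun V => withKeys a (fun E =>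
    E.all fun b => filterThen (fun w => disjointMasks b.2 w.1) (fun V' =>
      E.all fun c => !(disjointMasks b.2 c.2) ||
        withNumeral (pairMask b.1 c.1) fun m =>
          V'.any fun w => disjointMasks c.2 w.2.1 && disjointMasks m w.2.2) V [])
    (discordantLists a) []) W []

/-- Codes of third rows that together extend every normalized pair of rows whose second row starts
with a 6-cycle. -/
def sixCycleRows : List ℕ := [
  501234123450450123, 501234450123123450, 351024123450540213, 351024240513423150,
  405132123450351024, 405132354021120453, 540213123450405132, 540213435102153420,
  450123123450345012, 305214123450254103, 541032123450430521, 201534420153153420,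
  504231150423423150, 531204453120120453, 234501103254450123, 234501143052450123,
  234501325410450123, 234501450123103254, 234501450123143052, 234501450123325410,
  234501450123521430, 234501521430450123, 254103501234325410, 254103541032305214,
  345012204531120453, 345012231504423150, 345012534201153420, 430521305214541032,
  430521501234143052, 240513103254351402, 240513135024521430, 240513351402103254,
  240513521430135024, 305124130452524031, 305124140253534012, 354021245130103254,
  354021403512521430, 354021521430403512, 435102340251521430, 435102521430340251,
  435102524013103254, 345012423150231504, 430521105432341250, 430521321054503412,
  254103105432523014, 254103321054145230, 254103543210301452, 305124140253524031,
  350124143502425031, 405123243051530412, 430521543210125034, 450132324510145203,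
  451023235410304152, 451032105423543201, 451032520413304251, 501234124053350421,
  501234135420453102, 501234153402435120, 501234243150420513, 501234320451154023,
  501234423510240153, 501234453102135420, 234501123450450213, 234501123450540123,
  234501350124123450, 234501451023123450, 350214403152245031, 351024423150240513,
  351024524130240513, 405132120453354021, 405132130254354021, 405213143520531402,
  501234154023320451, 501234350421124053, 501234420513243150, 540213153420435102,
  234501123450350124, 234501123450450132, 234501123450451023, 234501143250325014,
  234501450132123450, 234501450213123450, 234501540123123450, 351024403251240513,
  351024405213123450, 351024540132123450, 451032304521135204, 204531351204123450,
  231504120453345210, 234501105432321054, 234501321054543210, 234501543210105432,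
  245031104523423150, 254013305124543201, 254103103452530214, 254103130452501234,
  254103143520501234, 254103305214123450, 254103423051501234, 304512250431423150,
  305124254031531402, 340521451032534210, 350214524031241503, 351024125430204513,
  430521125403501234, 430521324150501234, 430521541032123450, 451032245103523410,
  501234135402240513, 501234240513135402, 501234243510354021, 501234324051435102,
  501234354021243510, 501234435102324051, 540132321450254013, 230514421053153420,
  234501123450405123, 234501405123123450, 245031123450304512, 251034104253340521,
  251034520413345201, 254103140532305214, 254103305214140532, 254103501234135420,
  254103523410341052, 341502153420230154, 345012503421421503, 401532145203324051,
  405213534102241530, 430521125403541032, 430521253410501234, 430521354210541032,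
  430521501234324150, 435021540132321504, 541023324150203514, 204531531024123450,
  230514421053503421, 254103301452543210, 254103501234320451, 301524534012140253,
  305214124530240153, 305214231450453102, 305214534021150432, 351204240153423510,
  354021120453243510, 405132320451134520, 531204120453453120, 204513135402543021,
  204531153420431052, 204531530412145203, 234501305124123450, 235014153420421503,
  235104124053350412, 240531531204153420, 254103143052325410, 254103145230321054,
  254103305214431052, 254103501234423510, 305214241053420531, 305214241503423051,
  305214524031231450, 405132523410354021, 450123103254521430, 450123521034305412,
  450123521430103254, 451032135204304521, 451203125034340152, 540132253410135204,
  541023354102125430, 541023430251153402, 541032123450405123, 204513425031531204,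
  204531345012153420, 231504123450504231, 231504154032305421, 231504345012120453,
  231504345021120453, 234501540132123450, 240531304152531204, 240531431250105423,
  240531534120351402, 241503320154153420, 251034345201520413, 254103431052305214,
  345102130254451023, 430521251034324150, 450213134052325401, 531024304152420513,
  201534120453354012, 201534124053345102, 201534134250523401, 201534153420340152,
  201534354102435021, 204513153402425031, 305124241530450213]

/-- Codes of third rows that together extend every normalized pair of rows whose second row starts
with a permutation of cycle type 4 + 2. -/
def fourTwoCycleRows : List ℕ := [
  341502123054405231, 341502250431425013, 351420405213123054, 351420425031240513,
  405231123054351420, 405231143502534120, 341502405231123054, 351420240513425031,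
  405231351420123054, 405231534120143502, 341502425013250431, 341520120453504231,
  341520253014504231, 341520504231120453, 341520504231253014, 351402120534405213,
  351402243051405213, 351402405213120534, 351402405213243051, 351420123054405213,
  240513105432423150, 240513135024453201, 240513423150105432, 240513453201135024,
  435102120453354021, 435102253014521430, 435102354021120453, 435102521430253014,
  504213123054435102, 504213435102123054, 304521125403450132, 304521230154541203,
  305412124530540123, 305412230154451230, 341502123054250431, 341502250431123054,
  341520120453253014, 405213134052523104, 234501321054105432, 235410321054104523,
  305412234501541023, 305412541023234501, 341520253014120453, 401523123054345210,
  401523345210123054, 405213341520523104, 405213523104134052, 405213523104341520,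
  450123543210321054, 504213123054341502, 204531321450450123, 204531450123321450,
  205413321504450132, 234501301254453012, 234501305412451230, 234501453012301254,
  234510301254453021, 234510305421541203, 235401304512541230, 235410104523453201,
  235410453201104523, 250431523104104523, 345210123054254103, 345210254103503421,
  431520123054540213, 450123321054543210, 450123543210105432, 534120243051421503,
  534201403152150423, 205413321504540132, 205413341502123054, 205413540132321504,
  234501105432321054, 234510453021301254, 234510543021301254, 235401304512451230,
  235410301254543021, 240513153420435102, 240513435102153420, 250431543210134052,
  254130401523345201, 254130423501301254, 345210254103430521, 351420125034240513,
  351420240513125034, 450213235401341052, 501432123054430521, 534120120534345012,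
  205431541023134502, 235401103254324510, 235401301254543012, 235401324510103254,
  235410104523321054, 241503103452520134, 241503520134103452, 250413304521431250,
  250431143502321054, 254103521430345012, 304512231054523401, 345102201453153024,
  351420123054540213, 354120520431145203, 401532135024523401, 405213123054351402,
  450213341052235401, 451230204153523401, 540123451230305412, 540132321054104523,
  205413520134143520, 235401324150103524, 240531103254531420, 240531304152451203,
  240531305412531204, 245103401532354210, 245130103254421503, 245130430521104253,
  250413143520304152, 250413143520521034, 250413521034143520, 254130340251401523,
  304512523401231054, 304521235410451032, 304521451032523410, 305421154032530214,
  305421253014124530, 351402524013240531, 354210523104145023, 431520103254524013,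
  435102321054153420, 501423350214425031, 530421241530103254, 534120240513425031,
  540213325104153420, 205431453102324510, 240513153024501432, 240531451203304152,
  241530435012320451, 250413431250304521, 251403140532523014, 251403435021320514,
  254103503421345210, 254130340521503214, 304512235401450123, 304512451023235401,
  341520405213123054, 351402120534435120, 351402405213130524, 354210201453425031,
  354210425031201453, 401532154203530421, 405123534012123450, 405132351420534201,
  405213123054341520, 405213341520123054, 430521345102103254, 435102253014104523,
  450132541023103254, 451203324510540132, 504231345120123504, 504231351402435120,
  530412145023301254, 530412451023103254, 531402403251254130, 204513431250153402,
  204531135402453120, 234501125034453210, 234501305124453012, 234501453012305124,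
  240513321054153420, 240531453210134052, 241503154032320154, 245103503412154230,
  305412450123123504, 341502524013153420, 341520504231123054, 345120130254524031,
  351420123054204513, 354201401523123054, 354210405132120453, 401523135402350214,
  405123534210143052, 430521354102503214, 435120203514124053, 450123523014104532,
  450213341052103524, 451230523401204153, 534102345210201453, 204513321054453120,
  204513340152523401, 204513431250125034, 205431130254453012, 205431431250143502,
  234501103452541230, 234501150234523410, 234501451230305124, 235410103524541203,
  235410124053543102, 235410153024324501, 235410354021103254, 240513521034135420,
  240531324150531024, 240531354120103254, 241503523014150432, 245103523410301254,
  245130124503350214, 304512123054451203, 354102103254425013, 435120140253203514,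
  435201321054543120, 450231123054345120, 504132231054423501, 504132243051135204,
  531402450231203514, 204513523401145230, 204531120453453012, 204531123054450213,
  205413140532321054, 205413320154143520, 234501523410145023]

/-- Codes of third rows that together extend every normalized pair of rows whose second row starts
with a permutation of cycle type 3 + 3. -/
def threeThreeCycleRows : List ℕ := [
  354021120453543210, 354021543210120453, 345120120453534012, 345120534012120453,
  453012120453345201, 453012345201120453, 534201120453453120, 534201453120120453,
  435102120453354021, 435102354021120453, 543210124053431502, 543210150423405132,
  543210235104320451, 543210320451235104, 543210405132150423, 543210431502124053,
  201534120453345021, 201534120453345201, 201534120453354012, 201534345021120453,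
  201534345201120453, 201534354012120453, 305124124503530412, 305124530412124503,
  543021120453435210, 543021435210120453, 354102120453543021, 354102543021120453,
  201534120453345102, 201534120453354120, 201534345102120453, 201534354120120453,
  201534120453345210, 201534120453354201, 201534120453435120, 201534120453453021,
  201534120453453102, 201534120453453120, 201534120453534012, 201534435201120453,
  201534453210120453, 354021130452503214, 354021243510420153, 354021420153243510,
  354021503214130452, 435210120453354102, 435210354102120453, 201534120453435012,
  201534453120120453, 201534534012120453, 354021125403541230, 354021541230125403,
  201534120453435201, 201534120453453210, 201534120453534210, 201534120453543120,
  201534120453543201, 201534345210120453, 201534120453543012, 201534453021120453,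
  201534453102120453, 201534354201120453, 201534435120120453, 201534534210120453,
  201534543120120453, 201534543201120453, 234501350214403152, 234501403152350214,
  234501425130541023, 234501541023425130, 245130351402504213, 245130430521523014,
  245130504213351402, 245130523014430521, 305124154230531402, 305124531402154230,
  403512135024540231, 403512540231135024, 201534120453534021, 201534120453534102,
  201534435012120453, 201534534021120453, 201534534102120453, 201534543012120453,
  253014104523540132, 253014425130304521, 305124243051430512, 305124430512243051,
  341520135204254031, 341520150432405213, 341520230451523104, 435102140253304521,
  435102304521140253, 504231320154143502, 531204143520425031, 531204253410304152,
  531204304152253410, 531204425031143520, 254130103524430251, 254130430251103524,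
  431520250134523401, 431520523401250134, 451032130254324510, 451032143520235104,
  453120120453345012, 503124154203421530, 503124421530154203, 504231143502320154,
  504231235410421053, 504231421053235410, 234501150234325410, 351204425013240531,
  534012120453453201, 234501103254351420, 234501325410150234, 234501521430153024,
  234510145023501432, 234510341052105423, 235014104523450132, 235014104532540123,
  235014450132104523, 235014540123104532, 304512135420521034, 403512321054135420,
  435102123450351024, 451032230154503421, 503124350412245031, 504132245013321450,
  531204250431425013, 203514351420524031, 203514524031351420, 234501501423143052,
  245130154203301452, 245130320451154203, 245130321054134502, 253014304521531402,
  305124241053523401, 305124423051240513, 305214253401421053, 341520105432450213,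
  403512234051521430, 403512321450254103, 403512524103250431, 435021201534154203,
  435021250134124503, 435021543102321450, 451032203451540123, 451032324150240513,
  531204350412204153, 531204425013250431, 534120205413341502, 534120420531351204,
  204531120453345012, 231504350412425130, 234510340251105432, 235014150432524103,
  341520135204250431, 345201503124150432, 354102240513423051, 451032320451245103,
  453120520431235014, 531204420153153420, 534120140253403512, 203514450132125403,
  204531351402135024, 234501301254543012, 304512120453435120]

/-- Codes of third rows that together extend every normalized pair of rows whose second row starts
with a permutation of cycle type 2 + 2 + 2. -/
def twoTwoTwoCycleRows : List ℕ := [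
  240513103254351402, 240513351402103254, 250431103254341520, 250431341520103254,
  345012103254254103, 345012254103103254, 354021103254245130, 354021245130103254,
  421503103254530412, 421503530412103254, 435102103254524013, 435102524013103254,
  521430103254430521, 521430430521103254, 534120103254425031, 534120425031103254,
  234501103254325410, 235410103254324501, 324510103254235401, 325401103254234510,
  234501325410541032, 235410324501451023, 324510235401450132, 325401234510540123,
  234510325401540123, 235401324510450132, 324501235410451023, 325410234501541032,
  245130103254354021, 245130153024421503, 245130304251421503, 245130421503304251,
  254103143052430521, 254103305214430521, 254103430521305214, 341520150234435102,
  341520203451435102, 341520435102203451, 351402140253425031, 351402203514425031,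
  351402425031203514, 425031134250240513, 425031240513134250, 425031503124240513,
  430521123450254103, 430521345012123450, 430521501234345012, 524013135204250431,
  524013341520135204, 524013403152341520, 530412103254421503, 530412123504245130,
  530412245130123504, 530412401253245130, 240513103254351420, 240513103254354102,
  240513123054351402, 240513351402123054, 240513351402403251, 240513351420103254,
  240513354102103254, 240513403251351402, 435102524013103524, 521430340521103254,
  240513103254531402, 240513105234351402, 240513351402105234, 240513531402103254,
  251403103254340512, 251403340512103254, 341502250413103254, 354021245130503214,
  420531531420103254, 425013534102103254, 435102520413103254, 521430430521104253,
  521430430521203154, 234510103254325401, 235401103254324510, 245031354120103254,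
  254013103254345102, 324501103254235410, 325410103254234501, 340521103254251430,
  341502103254250413, 350412241503103254, 354021245103103254, 354021245130130254,
  435102254013103254, 435102524013143250, 521430430512103254, 354021241530103254,
  420531103254531420, 425013103254534102, 234501345012501234, 234501521430143052,
  235410421503153024, 241530103254350421, 245031103254354120, 245103103254354012,
  245130304251530412, 325401240513503124, 341520203451524013, 341520524013150234,
  350412103254241503, 351402425031140253, 430512103254521403, 520413103254431502,
  241530350421103254, 245103354012103254, 254013345102103254, 340521251430103254,
  430512521403103254, 520413431502103254, 234501145230301452, 235410124053351204,
  324510430251153402]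

theorem rowsSuffice_sixCycle : rowsSuffice [1, 2, 3, 4, 5, 0] sixCycleRows = true := by
  decide +kernel

theorem rowsSuffice_fourTwoCycle : rowsSuffice [1, 2, 3, 0, 5, 4] fourTwoCycleRows = true := by
  decide +kernel

theorem rowsSuffice_threeThreeCycle :
    rowsSuffice [1, 2, 0, 4, 5, 3] threeThreeCycleRows = true := by
  decide +kernel

theorem rowsSuffice_twoTwoTwoCycle :
    rowsSuffice [1, 0, 3, 2, 5, 4] twoTwoTwoCycleRows = true := by
  decide +kernel

theorem valueList_id : valueList id = [0, 1, 2, 3, 4, 5] := rfl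

theorem testBit_shiftLeft_one (m n : ℕ) : (Nat.shiftLeft 1 m).testBit n = true ↔ n = m := by
  change (1 <<< m).testBit n = true ↔ n = m
  rw [Nat.one_shiftLeft, Nat.testBit_two_pow]
  simp [eq_comm]

theorem testBit_lor (m n k : ℕ) :
    (Nat.lor m n).testBit k = true ↔ m.testBit k = true ∨ n.testBit k = true := by
  change (m ||| n).testBit k = true ↔ _
  simp

theorem disjointMasks_iff (m n : ℕ) :
    disjointMasks m n = true ↔ ∀ k, m.testBit k = true → ¬ n.testBit k = true := by
  have h : disjointMasks m n = true ↔ m &&& n = 0 := Nat.beq_eq ▸ Iff.rfl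
  rw [h]
  constructor
  · intro h k hm hn
    have := congrArg (fun x => x.testBit k) h
    simp [hm, hn] at this
  · intro h
    refine Nat.eq_of_testBit_eq fun k => ?_
    have := h k
    simp only [Nat.testBit_and, Nat.zero_testBit, Bool.and_eq_false_iff]
    grind

theorem testBit_valueMask (l : List ℕ) (n : ℕ) : (valueMask l).testBit n = true ↔ n ∈ l := by
  induction l with
  | nil => simp [valueMask]
  | cons x l ih => rw [valueMask, testBit_lor, testBit_shiftLeft_one, ih, List.mem_cons]

theorem mem_valueList (f : Fin 6 → Fin 6) (n : ℕ) : n ∈ valueList f ↔ ∃ i, n = f i := by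
  simp [valueList, Fin.exists_fin_succ]

theorem bijective_of_valueMask {f : Fin 6 → Fin 6}
    (h : Nat.beq (valueMask (valueList f)) 63 = true) : Function.Bijective f := by
  refine Function.Surjective.bijective_of_finite fun v => ?_
  have hv : (63 : ℕ).testBit v = true := by revert v; decide
  rw [← Nat.eq_of_beq_eq_true h, testBit_valueMask, mem_valueList] at hv
  obtain ⟨i, hi⟩ := hv
  exact ⟨i, Fin.ext hi.symm⟩

theorem testBit_pairMask (f g : Fin 6 → Fin 6) (n : ℕ) :
    (pairMask (valueList f) (valueList g)).testBit n = true ↔ ∃ i, n = 6 * (f i : ℕ) + g i := by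
  simp only [valueList, pairMask, testBit_lor, testBit_shiftLeft_one, Nat.zero_testBit]
  simp [Fin.exists_fin_succ]

/-- The pairs `(f i, g i)` and the pairs `(s j, t j)` are different. -/
def NoCommonPair (f g s t : Fin 6 → Fin 6) : Prop := ∀ i j, f i = s j → g i ≠ t j

theorem disjointMasks_pairMask (f g s t : Fin 6 → Fin 6) :
    disjointMasks (pairMask (valueList f) (valueList g)) (pairMask (valueList s) (valueList t)) = true
      ↔ NoCommonPair f g s t := by
  simp only [disjointMasks_iff, testBit_pairMask, NoCommonPair]
  constructor
  · rintro h i j hf hg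
    exact h _ ⟨i, rfl⟩ ⟨j, by rw [hf, hg]⟩
  · rintro h _ ⟨i, rfl⟩ ⟨j, hj⟩
    have := (g i).isLt
    have := (t j).isLt
    exact h i j (Fin.ext (by omega)) (Fin.ext (by omega))

theorem discordant_iff (s t : Fin 6 → Fin 6) :
    discordant (valueList s) (valueList t) = true ↔ ∀ i, s i ≠ t i := by
  rw [discordant, ← valueList_id, disjointMasks_pairMask]
  simp [NoCommonPair]

theorem testBit_keyMask (f g : Fin 6 → Fin 6) (n : ℕ) :
    (keyMask (valueList f) (valueList g)).testBit n = true ↔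
      (∃ i : Fin 6, n = 6 * (i : ℕ) + g i) ∨ ∃ i, n = 6 * (f i : ℕ) + g i + 36 := by
  rw [keyMask, testBit_lor, ← valueList_id, testBit_pairMask]
  refine or_congr Iff.rfl ?_
  change ((pairMask (valueList f) (valueList g)) <<< 36).testBit n = true ↔ _
  rw [Nat.testBit_shiftLeft, Bool.and_eq_true, testBit_pairMask, decide_eq_true_iff]
  constructor
  · rintro ⟨h, i, hi⟩
    exact ⟨i, by omega⟩
  · rintro ⟨i, hi⟩
    exact ⟨by omega, i, by omega⟩

theorem disjointMasks_keyMask (f g s t : Fin 6 → Fin 6) :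
    disjointMasks (keyMask (valueList f) (valueList g)) (keyMask (valueList s) (valueList t)) = true
      ↔ (∀ i, g i ≠ t i) ∧ NoCommonPair f g s t := by
  simp only [disjointMasks_iff, testBit_keyMask, NoCommonPair]
  constructor
  · intro h
    refine ⟨fun i hi => h _ (.inl ⟨i, rfl⟩) (.inl ⟨i, by rw [hi]⟩), fun i j hf hg =>
      h _ (.inr ⟨i, rfl⟩) (.inr ⟨j, by rw [hf, hg]⟩)⟩
  · rintro ⟨h, h'⟩ n (⟨i, rfl⟩ | ⟨i, rfl⟩) (⟨j, hj⟩ | ⟨j, hj⟩) <;>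
      have := (g i).isLt <;> have := (t j).isLt <;> have := i.isLt <;> have := j.isLt
    · obtain rfl : i = j := Fin.ext (by omega)
      exact h i (Fin.ext (by omega))
    · omega
    · omega
    · exact h' i j (Fin.ext (by omega)) (Fin.ext (by omega))

theorem withNumeral_eq (n : ℕ) (k : ℕ → Bool) : withNumeral n k = k n := rfl

theorem withKeys_eq (a : List ℕ) (k : List (List ℕ × ℕ) → Bool) (ls : List (List ℕ))
    (acc : List (List ℕ × ℕ)) :
    withKeys a k ls acc = k ((ls.map fun l => (l, keyMask a l)).reverse ++ acc) := by
  induction ls generalizing acc with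
  | nil => rfl
  | cons l ls ih => simp [withKeys, withNumeral_eq, ih]

/-- The masks recorded for the row `(1, p, q, r)` coded by `w`. -/
def rowMasks (w : ℕ) : ℕ × ℕ × ℕ :=
  (keyMask (valueList (digitFun 12 w)) (valueList (digitFun 6 w)),
    keyMask (valueList (digitFun 12 w)) (valueList (digitFun 0 w)),
    pairMask (valueList (digitFun 6 w)) (valueList (digitFun 0 w)))

theorem withRowMasks_eq (k : List (ℕ × ℕ × ℕ) → Bool) (ws : List ℕ) (acc : List (ℕ × ℕ × ℕ)) :
    withRowMasks k ws acc = k ((ws.map rowMasks).reverse ++ acc) := by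
  induction ws generalizing acc with
  | nil => rfl
  | cons w ws ih => simp [withRowMasks, withNumeral_eq, ih, rowMasks]

theorem filterThen_eq {α : Type} (t : α → Bool) (k : List α → Bool) (l acc : List α) :
    filterThen t k l acc = k ((l.filter t).reverse ++ acc) := by
  induction l generalizing acc with
  | nil => rfl
  | cons w ws ih => cases h : t w <;> simp [filterThen, ih, h]

theorem mem_selections_of_mem_acc (fs : List ℕ) (used : ℕ) (pre : List ℕ) (acc : List (List ℕ))
    (l : List ℕ) (h : l ∈ acc) : l ∈ selections fs used pre acc := by
  induction fs generalizing used pre acc with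
  | nil => exact List.mem_cons_of_mem _ h
  | cons f fs ih =>
    rw [selections]
    generalize [0, 1, 2, 3, 4, 5] = vs
    induction vs with
    | nil => exact h
    | cons v vs ihv =>
      rw [List.foldr_cons]
      cases disjointMasks (Nat.shiftLeft 1 v) (Nat.lor used f)
      · exact ihv
      · exact ih _ _ _ ihv

theorem mem_selections (fs l : List ℕ)
    (hl : List.Forall₂ (fun v f => v < 6 ∧ ¬ f.testBit v = true) l fs) (hn : l.Nodup)
    (used : ℕ) (hu : ∀ v ∈ l, ¬ used.testBit v = true) (pre : List ℕ) (acc : List (List ℕ)) :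
    l.reverse ++ pre ∈ selections fs used pre acc := by
  induction hl generalizing used pre acc with
  | nil => simp [selections]
  | @cons v f l fs hv _ ih =>
    rw [selections]
    have hmem : v ∈ [0, 1, 2, 3, 4, 5] := by
      have := hv.1
      simp only [List.mem_cons, List.not_mem_nil, or_false]
      omega
    have hd : disjointMasks (Nat.shiftLeft 1 v) (Nat.lor used f) = true := by
      rw [disjointMasks_iff]
      intro k hk
      rw [testBit_shiftLeft_one] at hk
      subst hk
      rw [testBit_lor, not_or]
      exact ⟨hu _ List.mem_cons_self, hv.2⟩
    rw [List.nodup_cons] at hn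
    generalize [0, 1, 2, 3, 4, 5] = vs at hmem
    induction vs with
    | nil => simp at hmem
    | cons x vs ihv =>
      rw [List.foldr_cons]
      rcases List.mem_cons.1 hmem with rfl | hmem
      · rw [hd, cond_true, List.reverse_cons, List.append_assoc]
        refine ih hn.2 _ (fun u hul => ?_) _ _
        rw [testBit_lor, testBit_shiftLeft_one, not_or]
        exact ⟨hu _ (List.mem_cons_of_mem _ hul), fun h => hn.1 (h ▸ hul)⟩
      · cases disjointMasks (Nat.shiftLeft 1 x) (Nat.lor used f)
        · exact ihv hmem
        · exact mem_selections_of_mem_acc _ _ _ _ _ (ihv hmem)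

theorem mem_discordantLists (a b : Fin 6 → Fin 6) (hb : Function.Injective b)
    (h₁ : ∀ i, b i ≠ i) (h₂ : ∀ i, b i ≠ a i) :
    valueList b ∈ discordantLists (valueList a) := by
  have key := mem_selections
    (List.zipWith (fun x y => Nat.lor (Nat.shiftLeft 1 x) (Nat.shiftLeft 1 y))
      [5, 4, 3, 2, 1, 0] (valueList a).reverse) (valueList b).reverse ?_ ?_ 0 (by simp) [] []
  · rwa [List.reverse_reverse, List.append_nil] at key
  · have h : ∀ i : Fin 6, (b i : ℕ) < 6 ∧
        ¬ (Nat.lor (Nat.shiftLeft 1 (i : ℕ)) (Nat.shiftLeft 1 (a i))).testBit (b i) = true := by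
      intro i
      refine ⟨(b i).isLt, ?_⟩
      rw [testBit_lor, testBit_shiftLeft_one, testBit_shiftLeft_one, not_or]
      exact ⟨fun h => h₁ i (Fin.ext h), fun h => h₂ i (Fin.ext h)⟩
    exact .cons (h 5) (.cons (h 4) (.cons (h 3) (.cons (h 2) (.cons (h 1) (.cons (h 0) .nil)))))
  · rw [List.nodup_reverse]
    have : valueList b = (List.finRange 6).map fun i => (b i : ℕ) := by
      simp [valueList, List.finRange_succ]
    rw [this]
    exact (List.nodup_finRange 6).map (Fin.val_injective.comp hb)

/-- Two rows of a quadruple of arrays, the first of which may record the columns, are compatible if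
no two of the arrays have the same pair of symbols in both rows. -/
def Compatible (R S : Fin 4 → Equiv.Perm (Fin 6)) : Prop :=
  ∀ i j, i < j → NoCommonPair (R i) (R j) (S i) (S j)

theorem compatible_iff (R S : Fin 4 → Equiv.Perm (Fin 6)) :
    Compatible R S ↔
      NoCommonPair (R 0) (R 1) (S 0) (S 1) ∧ NoCommonPair (R 0) (R 2) (S 0) (S 2) ∧
      NoCommonPair (R 0) (R 3) (S 0) (S 3) ∧ NoCommonPair (R 1) (R 2) (S 1) (S 2) ∧
      NoCommonPair (R 1) (R 3) (S 1) (S 3) ∧ NoCommonPair (R 2) (R 3) (S 2) (S 3) := by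
  simp [Compatible, Fin.forall_fin_succ]
  tauto

theorem noCommonPair_one (s t : Equiv.Perm (Fin 6)) :
    NoCommonPair (1 : Equiv.Perm (Fin 6)) (1 : Equiv.Perm (Fin 6)) s t ↔ ∀ i, s i ≠ t i := by
  simp only [NoCommonPair, Equiv.Perm.coe_one, id_eq, ne_eq]
  grind

theorem noCommonPair_one_left (s t : Fin 6 → Fin 6) :
    NoCommonPair (1 : Equiv.Perm (Fin 6)) s (1 : Equiv.Perm (Fin 6)) t ↔ ∀ i, s i ≠ t i := by
  simp [NoCommonPair]

theorem exists_third_row_of_rowsSuffice {a : Equiv.Perm (Fin 6)} {W : List ℕ}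
    (h : rowsSuffice (valueList a) W = true) (b c : Equiv.Perm (Fin 6))
    (hc : Compatible 1 ![1, a, b, c]) :
    ∃ T, Compatible 1 T ∧ Compatible ![1, a, b, c] T := by
  simp only [compatible_iff, Pi.one_apply, noCommonPair_one, Matrix.cons_val] at hc
  obtain ⟨-, h1b, h1c, hab, hac, hbc⟩ := hc
  have hb := mem_discordantLists a b b.injective (fun i => (h1b i).symm) (fun i => (hab i).symm)
  have hc := mem_discordantLists a c c.injective (fun i => (h1c i).symm) (fun i => (hac i).symm)
  simp only [rowsSuffice, withRowMasks_eq, withKeys_eq, filterThen_eq, withNumeral_eq,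
    Bool.and_eq_true, List.all_eq_true, List.append_nil, List.mem_reverse, List.mem_map,
    forall_exists_index, and_imp, forall_apply_eq_imp_iff₂, List.any_eq_true, List.mem_filter,
    Bool.or_eq_true, Bool.not_eq_true'] at h
  obtain ⟨hW, h⟩ := h
  have hd : disjointMasks (keyMask (valueList a) (valueList b))
      (keyMask (valueList a) (valueList c)) = true := by
    rw [disjointMasks_keyMask]
    refine ⟨hbc, fun i j hij => ?_⟩
    rw [a.injective hij]
    exact hbc j
  obtain h | ⟨_, ⟨⟨w, hw, rfl⟩, h₁⟩, h₂, h₃⟩ := h _ hb _ hc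
  · simp [hd] at h
  replace hW := hW w hw
  simp only [isNormalRow, Bool.and_eq_true, ← valueList_id, discordant_iff] at hW
  obtain ⟨⟨⟨⟨⟨⟨⟨⟨⟨hp, hq⟩, hr⟩, h1p⟩, h1q⟩, h1r⟩, hpq⟩, hpr⟩, hqr⟩, hap⟩ := hW
  simp only [rowMasks, disjointMasks_keyMask, disjointMasks_pairMask] at h₁ h₂ h₃
  let p := Equiv.ofBijective _ (bijective_of_valueMask hp)
  let q := Equiv.ofBijective _ (bijective_of_valueMask hq)
  let r := Equiv.ofBijective _ (bijective_of_valueMask hr)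
  refine ⟨![1, p, q, r], ?_, ?_⟩
  · simp only [compatible_iff, Pi.one_apply, noCommonPair_one, Matrix.cons_val]
    exact ⟨h1p, h1q, h1r, hpq, hpr, hqr⟩
  · simp only [compatible_iff, noCommonPair_one_left, Matrix.cons_val]
    exact ⟨hap, h₁.1, h₂.1, h₁.2, h₂.2, h₃⟩

theorem Compatible.mul {R S : Fin 4 → Equiv.Perm (Fin 6)} (h : Compatible R S)
    (σ : Fin 4 → Equiv.Perm (Fin 6)) (τ τ' : Equiv.Perm (Fin 6)) :
    Compatible (fun i => σ i * R i * τ) (fun i => σ i * S i * τ') := by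
  intro i j hij x y
  simpa using h i j hij (τ x) (τ' y)

theorem multiset_eq_of_sum_eq_six (m : Multiset ℕ) (h : ∀ x ∈ m, 2 ≤ x) (hs : m.sum = 6) :
    m = {6} ∨ m = {4, 2} ∨ m = {3, 3} ∨ m = {2, 2, 2} := by
  rcases m.empty_or_exists_mem with rfl | ⟨x, hx⟩
  · simp at hs
  obtain ⟨m, rfl⟩ := Multiset.exists_cons_of_mem hx
  simp only [Multiset.forall_mem_cons, Multiset.sum_cons] at h hs
  rcases m.empty_or_exists_mem with rfl | ⟨y, hy⟩
  · simp_all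
  obtain ⟨m, rfl⟩ := Multiset.exists_cons_of_mem hy
  simp only [Multiset.forall_mem_cons, Multiset.sum_cons] at h hs
  rcases m.empty_or_exists_mem with rfl | ⟨z, hz⟩
  · rw [Multiset.sum_zero] at hs
    obtain ⟨rfl, rfl⟩ | ⟨rfl, rfl⟩ | ⟨rfl, rfl⟩ :
      (x = 4 ∧ y = 2) ∨ (x = 3 ∧ y = 3) ∨ (x = 2 ∧ y = 4) := by omega
    all_goals decide
  obtain ⟨m, rfl⟩ := Multiset.exists_cons_of_mem hz
  simp only [Multiset.forall_mem_cons, Multiset.sum_cons] at h hs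
  rcases m.empty_or_exists_mem with rfl | ⟨t, ht⟩
  · rw [Multiset.sum_zero] at hs
    obtain ⟨rfl, rfl, rfl⟩ : x = 2 ∧ y = 2 ∧ z = 2 := by omega
    decide
  · have := h.2.2.2 t ht
    have := Multiset.le_sum_of_mem ht
    omega

theorem cycleType_cases (a : Equiv.Perm (Fin 6)) (h : ∀ i, a i ≠ i) :
    a.cycleType = {6} ∨ a.cycleType = {4, 2} ∨ a.cycleType = {3, 3} ∨
      a.cycleType = {2, 2, 2} := by
  refine multiset_eq_of_sum_eq_six _ (fun _ => Equiv.Perm.two_le_of_mem_cycleType) ?_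
  have hs : a.support = Finset.univ := by
    ext i
    simp [h i]
  rw [Equiv.Perm.sum_cycleType, hs]
  rfl

theorem exists_third_row_of_cycleType {s : Multiset ℕ} {g : Equiv.Perm (Fin 6)}
    (hg : g.cycleType = s) {l : List ℕ} (hl : valueList g = l) {W : List ℕ}
    (h : rowsSuffice l W = true)
    {a : Equiv.Perm (Fin 6)} (ha : a.cycleType = s) (b c : Equiv.Perm (Fin 6))
    (hc : Compatible 1 ![1, a, b, c]) :
    ∃ T, Compatible 1 T ∧ Compatible ![1, a, b, c] T := by
  obtain ⟨τ, hτ⟩ := isConj_iff.1 (Equiv.Perm.isConj_iff_cycleType_eq.2 (ha.trans hg.symm))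
  have h₁ : (fun i => τ * (1 : Fin 4 → Equiv.Perm (Fin 6)) i * τ⁻¹) = 1 := by
    funext i
    simp
  have h₂ : (fun i => τ * ![1, a, b, c] i * τ⁻¹) = ![1, g, τ * b * τ⁻¹, τ * c * τ⁻¹] := by
    funext i
    fin_cases i <;> simp [hτ]
  have hc' := hc.mul (fun _ => τ) τ⁻¹ τ⁻¹
  rw [h₁, h₂] at hc'
  subst hl
  obtain ⟨T, hT₁, hT₂⟩ := exists_third_row_of_rowsSuffice h _ _ hc'
  refine ⟨fun i => τ⁻¹ * T i * 1, ?_, ?_⟩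
  · have := hT₁.mul (fun _ => τ⁻¹) τ 1
    convert this using 2
    simp
  · rw [← h₂] at hT₂
    have := hT₂.mul (fun _ => τ⁻¹) τ 1
    simpa [mul_assoc] using this

theorem exists_third_row_of_one (a b c : Equiv.Perm (Fin 6)) (hc : Compatible 1 ![1, a, b, c]) :
    ∃ T, Compatible 1 T ∧ Compatible ![1, a, b, c] T := by
  have ha : ∀ i, a i ≠ i := by
    have := ((compatible_iff _ _).1 hc).1
    simp only [Pi.one_apply, noCommonPair_one, Matrix.cons_val] at this
    exact fun i => (this i).symm
  rcases cycleType_cases a ha with h | h | h | h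
  · exact exists_third_row_of_cycleType (g := c[0, 1, 2, 3, 4, 5]) (by decide +kernel)
      (by decide +kernel) rowsSuffice_sixCycle h b c hc
  · exact exists_third_row_of_cycleType (g := c[0, 1, 2, 3] * c[4, 5]) (by decide +kernel)
      (by decide +kernel) rowsSuffice_fourTwoCycle h b c hc
  · exact exists_third_row_of_cycleType (g := c[0, 1, 2] * c[3, 4, 5]) (by decide +kernel)
      (by decide +kernel) rowsSuffice_threeThreeCycle h b c hc
  · exact exists_third_row_of_cycleType (g := c[0, 1] * c[2, 3] * c[4, 5]) (by decide +kernel)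
      (by decide +kernel) rowsSuffice_twoTwoTwoCycle h b c hc

/-- Any two compatible rows admit a third row compatible with both. -/
theorem exists_third_row (R S : Fin 4 → Equiv.Perm (Fin 6)) (h : Compatible R S) :
    ∃ T, Compatible R T ∧ Compatible S T := by
  have h₁ : (fun i => (R i)⁻¹ * R i * 1) = 1 := by
    funext i
    simp
  let S' : Fin 4 → Equiv.Perm (Fin 6) := fun i => (R i)⁻¹ * S i * ((S 0)⁻¹ * R 0)
  have h₂ : S' = ![1, S' 1, S' 2, S' 3] := by
    funext i
    fin_cases i <;> simp [S', mul_assoc]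
  have h' : Compatible 1 S' := h₁ ▸ h.mul (fun i => (R i)⁻¹) 1 ((S 0)⁻¹ * R 0)
  rw [h₂] at h'
  obtain ⟨T, hT₁, hT₂⟩ := exists_third_row_of_one _ _ _ h'
  rw [← h₂] at hT₂
  refine ⟨fun i => R i * T i * 1, ?_, ?_⟩
  · simpa using hT₁.mul R 1 1
  · simpa [S', mul_assoc] using hT₂.mul R ((R 0)⁻¹ * S 0) 1

theorem Compatible.exists_normalized {R S T : Fin 4 → Equiv.Perm (Fin 6)}
    (hR : Compatible R T) (hS : Compatible S T) :
    ∃ X Y Z : Equiv.Perm (Fin 6), Compatible R ![1, X, Y, Z] ∧ Compatible S ![1, X, Y, Z] := by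
  have h : (fun i => 1 * T i * (T 0)⁻¹) =
      ![1, T 1 * (T 0)⁻¹, T 2 * (T 0)⁻¹, T 3 * (T 0)⁻¹] := by
    funext i
    fin_cases i <;> simp
  refine ⟨T 1 * (T 0)⁻¹, T 2 * (T 0)⁻¹, T 3 * (T 0)⁻¹, ?_⟩
  rw [← h]
  exact ⟨by simpa using hR.mul 1 1 (T 0)⁻¹, by simpa using hS.mul 1 1 (T 0)⁻¹⟩

theorem Orthogonal.noCommonPair {A B : Fin 2 → Fin 6 → Fin 6} (h : Orthogonal A B) :
    NoCommonPair (A 0) (B 0) (A 1) (B 1) := by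
  intro x y hA hB
  have : ((0 : Fin 2), x) = (1, y) := h (Prod.ext hA hB)
  simp at this

theorem isLatinRectangle_snoc {A : Fin 2 → Fin 6 → Fin 6} (hA : IsLatinRectangle A)
    (X : Equiv.Perm (Fin 6)) (h₀ : ∀ j, A 0 j ≠ X j) (h₁ : ∀ j, A 1 j ≠ X j) :
    IsLatinRectangle (Fin.snoc A X : Fin 3 → Fin 6 → Fin 6) := by
  have e : (Fin.snoc A X : Fin 3 → Fin 6 → Fin 6) = ![A 0, A 1, X] := by
    funext i
    fin_cases i <;> rfl
  rw [e]
  refine ⟨fun i => ?_, fun j => ?_⟩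
  · fin_cases i
    exacts [hA.1 0, hA.1 1, X.injective]
  · have h : A 0 j ≠ A 1 j := fun h => by simpa using hA.2 j h
    intro i i' hii
    fin_cases i <;> fin_cases i' <;> simp_all [eq_comm]

theorem orthogonal_snoc {A B : Fin 2 → Fin 6 → Fin 6} (h : Orthogonal A B)
    (X Y : Equiv.Perm (Fin 6)) (h₀ : NoCommonPair (A 0) (B 0) X Y)
    (h₁ : NoCommonPair (A 1) (B 1) X Y) :
    Orthogonal (Fin.snoc A X : Fin 3 → Fin 6 → Fin 6) (Fin.snoc B Y) := by
  have h' : ∀ i, NoCommonPair (A i) (B i) X Y := Fin.forall_fin_two.2 ⟨h₀, h₁⟩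
  rintro ⟨i, x⟩ ⟨j, y⟩ hxy
  simp only [Prod.mk.injEq] at hxy
  induction i using Fin.lastCases with
  | last =>
    induction j using Fin.lastCases with
    | last =>
      simp only [Fin.snoc_last] at hxy
      rw [X.injective hxy.1]
    | cast j =>
      simp only [Fin.snoc_last, Fin.snoc_castSucc] at hxy
      exact absurd hxy.2.symm (h' j y x hxy.1.symm)
  | cast i =>
    induction j using Fin.lastCases with
    | last =>
      simp only [Fin.snoc_last, Fin.snoc_castSucc] at hxy
      exact absurd hxy.2 (h' i x y hxy.1)
    | cast j =>
      simp only [Fin.snoc_castSucc] at hxy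
      have : (i, x) = (j, y) := h (Prod.ext hxy.1 hxy.2)
      rw [Prod.mk.injEq] at this
      rw [this.1, this.2]

theorem stmt_19 (A B C : Fin 2 → Fin 6 → Fin 6)
    (hA : IsLatinRectangle A) (hB : IsLatinRectangle B) (hC : IsLatinRectangle C)
    (hAB : Orthogonal A B) (hAC : Orthogonal A C) (hBC : Orthogonal B C) :
    ∃ A' B' C' : Fin 3 → Fin 6 → Fin 6,
      IsLatinRectangle A' ∧ IsLatinRectangle B' ∧ IsLatinRectangle C' ∧
      Orthogonal A' B' ∧ Orthogonal A' C' ∧ Orthogonal B' C' ∧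
      (∀ i : Fin 2, A' i.castSucc = A i) ∧
      (∀ i : Fin 2, B' i.castSucc = B i) ∧
      (∀ i : Fin 2, C' i.castSucc = C i) := by
  choose RA hRA using fun i => (⟨Equiv.ofBijective (A i) (hA.1 i).bijective_of_finite, rfl⟩ :
    ∃ e : Equiv.Perm (Fin 6), ⇑e = A i)
  choose RB hRB using fun i => (⟨Equiv.ofBijective (B i) (hB.1 i).bijective_of_finite, rfl⟩ :
    ∃ e : Equiv.Perm (Fin 6), ⇑e = B i)
  choose RC hRC using fun i => (⟨Equiv.ofBijective (C i) (hC.1 i).bijective_of_finite, rfl⟩ :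
    ∃ e : Equiv.Perm (Fin 6), ⇑e = C i)
  have hcol : ∀ D : Fin 2 → Fin 6 → Fin 6, IsLatinRectangle D → ∀ j, D 0 j ≠ D 1 j :=
    fun D hD j h => by simpa using hD.2 j h
  have hc : Compatible ![1, RA 0, RB 0, RC 0] ![1, RA 1, RB 1, RC 1] := by
    simp only [compatible_iff, noCommonPair_one_left, Matrix.cons_val, hRA, hRB, hRC]
    exact ⟨hcol A hA, hcol B hB, hcol C hC, hAB.noCommonPair, hAC.noCommonPair, hBC.noCommonPair⟩
  obtain ⟨T, h₀, h₁⟩ := exists_third_row _ _ hc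
  obtain ⟨X, Y, Z, h₀, h₁⟩ := h₀.exists_normalized h₁
  simp only [compatible_iff, noCommonPair_one_left, Matrix.cons_val, hRA, hRB, hRC] at h₀ h₁
  obtain ⟨hA₀, hB₀, hC₀, hAB₀, hAC₀, hBC₀⟩ := h₀
  obtain ⟨hA₁, hB₁, hC₁, hAB₁, hAC₁, hBC₁⟩ := h₁
  exact ⟨Fin.snoc A X, Fin.snoc B Y, Fin.snoc C Z, isLatinRectangle_snoc hA X hA₀ hA₁,
    isLatinRectangle_snoc hB Y hB₀ hB₁, isLatinRectangle_snoc hC Z hC₀ hC₁,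
    orthogonal_snoc hAB X Y hAB₀ hAB₁, orthogonal_snoc hAC X Z hAC₀ hAC₁,
    orthogonal_snoc hBC Y Z hBC₀ hBC₁, fun i => Fin.snoc_castSucc .., fun i => Fin.snoc_castSucc ..,
    fun i => Fin.snoc_castSucc ..⟩
end
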